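/- arXiv:2005.14334 — 6 statements merged into one kernel-verified Lean document; each statement's English description precedes it below -/
import Mathlib

section
/- Let N ≥ 10 be an integer, λ > 0, and let f : [0,∞) → ℝ satisfy condition (★). Let u : (0,1] → ℝ be C³ with u'(r) < 0 for all r ∈ (0,1], u(1) = 0, lim_{r→0⁺} u(r) = +∞, satisfying −u''(r) − ((N−1)/r)·u'(r) = λ·f(u(r)) for all r ∈ (0,1], and ∫₀¹ r^{N−1}(u'(r)² + u''(r)²) dr < ∞. Suppose Ψ(r) := λ·f'(u(r)) satisfies the radial stability inequality in dimension N. Then limsup_{r→0⁺} r²·λ·f'(u(r)) ≥ 2(N−2). -/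
open MeasureTheory Filter Set

/-- `Ψ` satisfies the radial stability inequality in dimension `N`. -/
def RadialStability (N : ℕ) (Ψ : ℝ → ℝ) : Prop :=
  ∀ ξ : ℝ → ℝ, (∃ K : NNReal, LipschitzOnWith K ξ (Set.Icc 0 1)) → ξ 1 = 0 →
    (∫ r in (0:ℝ)..1, r ^ (N - 1) * Ψ r * ξ r ^ 2) ≤
      ∫ r in (0:ℝ)..1, r ^ (N - 1) * (deriv ξ r) ^ 2

/-- Condition (★): `f` is `C¹`, nondecreasing, convex, `f 0 > 0`, and superlinear at `+∞`,
all on the domain `[0,∞)`. -/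
def StarCond (f : ℝ → ℝ) : Prop :=
  ContDiffOn ℝ 1 f (Set.Ici 0) ∧ MonotoneOn f (Set.Ici 0) ∧
    ConvexOn ℝ (Set.Ici 0) f ∧ 0 < f 0 ∧
    Tendsto (fun t => f t / t) atTop atTop

/-- If `Ψ` is nonnegative, antitone and continuous on `(0,1]` and satisfies the radial stability
inequality, then `r² Ψ r` is bounded near `0`. -/
theorem RadialStability.sq_mul_le {N : ℕ} {Ψ : ℝ → ℝ} (h : RadialStability N Ψ)
    (hc : ContinuousOn Ψ (Ioc 0 1)) (hanti : AntitoneOn Ψ (Ioc 0 1))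
    (hnn : ∀ r ∈ Ioc (0:ℝ) 1, 0 ≤ Ψ r) {a : ℝ} (ha : 0 < a) (ha2 : a < 1 / 2) :
    a ^ 2 * Ψ a ≤ 128 * (8 / 3 : ℝ) ^ (N - 1) := by
  set ξ : ℝ → ℝ := fun s => max 0 (a / 2 - |s - a|) with hξ
  have hlip : LipschitzWith 1 ξ := by
    refine LipschitzWith.of_dist_le_mul fun x y => ?_
    simp only [hξ, Real.dist_eq, NNReal.coe_one, one_mul]
    refine (abs_max_sub_max_le_max _ _ _ _).trans (max_le (by simp) ?_)
    rw [sub_sub_sub_cancel_left]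
    refine (abs_abs_sub_abs_le_abs_sub _ _).trans ?_
    rw [sub_sub_sub_cancel_right, abs_sub_comm]
  have hξ0 : ∀ s, s ≤ a / 2 ∨ 3 * a / 2 ≤ s → ξ s = 0 := by
    intro s hs
    refine max_eq_left ?_
    rcases hs with hs | hs
    · linarith [neg_abs_le (s - a)]
    · linarith [le_abs_self (s - a)]
  have key := h ξ ⟨1, hlip.lipschitzOnWith⟩ (hξ0 1 (Or.inr (by linarith)))
  have hR : ∫ r in (0:ℝ)..1, r ^ (N - 1) * (deriv ξ r) ^ 2 ≤ 2 * a * (2 * a) ^ (N - 1) := by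
    have h1 : ∫ r in (0:ℝ)..1, r ^ (N - 1) * (deriv ξ r) ^ 2
        = ∫ r in (0:ℝ)..(2 * a), r ^ (N - 1) * (deriv ξ r) ^ 2 := by
      rw [intervalIntegral.integral_of_le zero_le_one,
        intervalIntegral.integral_of_le (by linarith)]
      refine setIntegral_eq_of_subset_of_forall_sdiff_eq_zero measurableSet_Ioc
        (Ioc_subset_Ioc_right (by linarith)) fun x hx => ?_
      have hx2 : 2 * a < x := by
        by_contra! hcon
        exact hx.2 ⟨hx.1.1, hcon⟩
      have : ξ =ᶠ[nhds x] fun _ => 0 := by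
        filter_upwards [lt_mem_nhds (show 3 * a / 2 < x by linarith)] with y hy
        exact hξ0 y (Or.inr hy.le)
      rw [this.deriv_eq]
      simp
    rw [h1]
    refine (le_abs_self _).trans ?_
    rw [← Real.norm_eq_abs]
    refine (intervalIntegral.norm_integral_le_of_norm_le_const (C := (2 * a) ^ (N - 1))
      fun x hx => ?_).trans (le_of_eq ?_)
    · rw [uIoc_of_le (by linarith)] at hx
      have hd : ‖deriv ξ x‖ ≤ 1 := by simpa using norm_deriv_le_of_lipschitz hlip (x₀ := x)
      rw [norm_mul, norm_pow, norm_pow, Real.norm_of_nonneg hx.1.le]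
      have e1 : x ^ (N - 1) ≤ (2 * a) ^ (N - 1) := pow_le_pow_left₀ hx.1.le hx.2 _
      have e2 : ‖deriv ξ x‖ ^ 2 ≤ 1 := pow_le_one₀ (norm_nonneg _) hd
      calc _ ≤ (2 * a) ^ (N - 1) * 1 := by gcongr
        _ = _ := mul_one _
    · rw [sub_zero, abs_of_pos (by linarith)]
      ring
  have hL : a / 4 * ((3 * a / 4) ^ (N - 1) * Ψ a * (a / 4) ^ 2) ≤
      ∫ r in (0:ℝ)..1, r ^ (N - 1) * Ψ r * ξ r ^ 2 := by
    have h1 : ∫ r in (0:ℝ)..1, r ^ (N - 1) * Ψ r * ξ r ^ 2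
        = ∫ r in (a / 2)..1, r ^ (N - 1) * Ψ r * ξ r ^ 2 := by
      rw [intervalIntegral.integral_of_le zero_le_one,
        intervalIntegral.integral_of_le (by linarith)]
      refine setIntegral_eq_of_subset_of_forall_sdiff_eq_zero measurableSet_Ioc
        (Ioc_subset_Ioc_left (by linarith)) fun x hx => ?_
      have hx2 : x ≤ a / 2 := by
        by_contra! hcon
        exact hx.2 ⟨hcon, hx.1.2⟩
      rw [hξ0 x (Or.inl hx2)]
      simp
    have hcF : ContinuousOn (fun r => r ^ (N - 1) * Ψ r * ξ r ^ 2) (Icc (a / 2) 1) := by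
      have := hc.mono (show Icc (a / 2) 1 ⊆ Ioc 0 1 from
        fun x hx => ⟨by linarith [hx.1], hx.2⟩)
      have := hlip.continuous
      fun_prop
    have h2 : ∫ r in (3 * a / 4)..a, r ^ (N - 1) * Ψ r * ξ r ^ 2 ≤
        ∫ r in (a / 2)..1, r ^ (N - 1) * Ψ r * ξ r ^ 2 := by
      refine intervalIntegral.integral_mono_interval (by linarith) (by linarith) (by linarith)
        ?_ (hcF.intervalIntegrable_of_Icc (by linarith))
      refine (ae_restrict_iff' measurableSet_Ioc).2 (Eventually.of_forall fun x hx => ?_)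
      have hx0 : 0 < x := by linarith [hx.1]
      have := hnn x ⟨hx0, hx.2⟩
      simp only [Pi.zero_apply]
      positivity
    rw [h1]
    refine le_trans ?_ h2
    have h3 : ∫ r in (3 * a / 4)..a, ((3 * a / 4) ^ (N - 1) * Ψ a * (a / 4) ^ 2) =
        a / 4 * ((3 * a / 4) ^ (N - 1) * Ψ a * (a / 4) ^ 2) := by
      rw [intervalIntegral.integral_const, smul_eq_mul]
      ring
    rw [← h3]
    refine intervalIntegral.integral_mono_on (by linarith) intervalIntegrable_const
      ((hcF.mono (Icc_subset_Icc (by linarith) (by linarith))).intervalIntegrable_of_Icc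
        (by linarith)) fun x hx => ?_
    have hx0 : 0 < x := by linarith [hx.1]
    have e1 : (3 * a / 4) ^ (N - 1) ≤ x ^ (N - 1) := pow_le_pow_left₀ (by linarith) hx.1 _
    have e2 : Ψ a ≤ Ψ x := hanti ⟨hx0, by linarith [hx.2]⟩ ⟨ha, by linarith⟩ hx.2
    have e3 : a / 4 ≤ ξ x := by
      refine le_max_of_le_right ?_
      rw [abs_of_nonpos (by linarith [hx.2])]
      linarith [hx.1]
    have e4 := hnn a ⟨ha, by linarith⟩
    have e5 := e4.trans e2
    gcongr
  have hfin := hL.trans (key.trans hR)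
  have e : (3 * a / 4) ^ (N - 1) * (8 / 3 : ℝ) ^ (N - 1) = (2 * a) ^ (N - 1) := by
    rw [← mul_pow]
    ring
  rw [← e] at hfin
  have hp : 0 < a * (3 * a / 4) ^ (N - 1) := by positivity
  refine le_of_mul_le_mul_left ?_ hp
  linarith

/-- If `u' ≥ -C r ^ α` near `0` with
`α > -1`, then `u` cannot blow up at `0`. -/
theorem not_tendsto_atTop_of_deriv_ge {u u' : ℝ → ℝ} {b C α : ℝ} (hb : 0 < b) (hα : -1 < α)
    (hu : ∀ r ∈ Ioc (0:ℝ) b, HasDerivAt u (u' r) r)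
    (hC : ∀ r ∈ Ioc (0:ℝ) b, -(C * r ^ α) ≤ u' r) :
    ¬ Tendsto u (nhdsWithin 0 (Ioi 0)) atTop := by
  intro htop
  set g : ℝ → ℝ := fun r => u r + C / (α + 1) * r ^ (α + 1) with hg
  have hα1 : 0 < α + 1 := by linarith
  have hder : ∀ r ∈ Ioc (0:ℝ) b, HasDerivAt g (u' r + C * r ^ α) r := by
    intro r hr
    have h := (hu r hr).add ((Real.hasDerivAt_rpow_const (p := α + 1)
      (Or.inl hr.1.ne')).const_mul (C / (α + 1)))
    have e : C / (α + 1) * ((α + 1) * r ^ (α + 1 - 1)) = C * r ^ α := by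
      rw [add_sub_cancel_right]
      field_simp
    rwa [e] at h
  have hmono : MonotoneOn g (Ioc 0 b) := by
    refine monotoneOn_of_hasDerivWithinAt_nonneg (f' := fun r => u' r + C * r ^ α)
      (convex_Ioc 0 b) (fun r hr => (hder r hr).continuousAt.continuousWithinAt) ?_ ?_
    · intro r hr
      exact (hder r (interior_subset hr)).hasDerivWithinAt
    · intro r hr
      linarith [hC r (interior_subset hr)]
  have hpow : ∀ r ∈ Ioc (0:ℝ) b, -(|C| / (α + 1) * b ^ (α + 1)) ≤ C / (α + 1) * r ^ (α + 1) := by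
    intro r hr
    have h1 : r ^ (α + 1) ≤ b ^ (α + 1) := Real.rpow_le_rpow hr.1.le hr.2 hα1.le
    have h2 : 0 ≤ r ^ (α + 1) := Real.rpow_nonneg hr.1.le _
    have h3 : |C / (α + 1) * r ^ (α + 1)| ≤ |C| / (α + 1) * b ^ (α + 1) := by
      rw [abs_mul, abs_div, abs_of_pos hα1, abs_of_nonneg h2]
      gcongr
    exact (abs_le.1 h3).1
  obtain ⟨r, hr1, hr2⟩ := ((htop.eventually_gt_atTop
    (g b + |C| / (α + 1) * b ^ (α + 1))).and (Ioc_mem_nhdsGT hb)).exists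
  have h1 := hmono hr2 ⟨hb, le_rfl⟩ hr2.2
  have h2 := hpow r hr2
  simp only [hg] at h1 hr1
  linarith

/-- If `r u'' - α u'` times `r ^ γ` stays bounded away from zero, with `γ ≥ N / 2`, then
`u', u''` are not square integrable for the weight `r ^ (N - 1)`. -/
theorem not_intervalIntegrable_of_le {u' u'' : ℝ → ℝ} {N : ℕ} (hN : 1 ≤ N) {b k α γ : ℝ}
    (hb : 0 < b) (hb1 : b ≤ 1) (hk : 0 < k) (hα : |α| ≤ 1) (hγ : (N:ℝ) ≤ 2 * γ)
    (hle : ∀ r ∈ Ioc (0:ℝ) b, k ≤ (r * u'' r - α * u' r) * r ^ γ) :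
    ¬ IntervalIntegrable (fun r => r ^ (N - 1) * (u' r ^ 2 + u'' r ^ 2)) volume 0 1 := by
  intro hint
  have hint' := hint.mono_set (c := 0) (d := b) (by
    rw [uIcc_of_le hb.le, uIcc_of_le zero_le_one]
    exact Icc_subset_Icc_right hb1)
  have hinv : IntervalIntegrable (fun r : ℝ => r⁻¹) volume 0 b := by
    refine (hint'.const_mul (2 / k ^ 2)).mono_fun (by fun_prop) ?_
    refine (ae_restrict_iff' measurableSet_uIoc).2 (Eventually.of_forall fun r hr => ?_)
    rw [uIoc_of_le hb.le] at hr
    have hr0 := hr.1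
    have hr1 : r ≤ 1 := hr.2.trans hb1
    have h1 := hle r hr
    have h2 : k ^ 2 ≤ (r * u'' r - α * u' r) ^ 2 * r ^ N := by
      have e : (r ^ γ) ^ 2 ≤ r ^ N := by
        rw [← Real.rpow_natCast r N, ← Real.rpow_mul_natCast hr0.le]
        exact Real.rpow_le_rpow_of_exponent_ge hr0 hr1 (by push_cast; linarith)
      calc k ^ 2 ≤ ((r * u'' r - α * u' r) * r ^ γ) ^ 2 := pow_le_pow_left₀ hk.le h1 2
        _ = (r * u'' r - α * u' r) ^ 2 * (r ^ γ) ^ 2 := by ring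
        _ ≤ _ := by gcongr
    have h3 : (r * u'' r - α * u' r) ^ 2 ≤ 2 * (u' r ^ 2 + u'' r ^ 2) := by
      have a1 : α ^ 2 ≤ 1 := by
        rw [← sq_abs]
        exact pow_le_one₀ (abs_nonneg _) hα
      have a2 : r ^ 2 ≤ 1 := pow_le_one₀ hr0.le hr1
      nlinarith [sq_nonneg (r * u'' r + α * u' r),
        mul_le_mul_of_nonneg_right a1 (sq_nonneg (u' r)),
        mul_le_mul_of_nonneg_right a2 (sq_nonneg (u'' r))]
    beta_reduce
    rw [norm_inv, Real.norm_of_nonneg hr0.le, Real.norm_of_nonneg (by positivity),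
      inv_le_iff_one_le_mul₀ hr0]
    have h4 : r ^ N = r ^ (N - 1) * r := by
      rw [← pow_succ, Nat.sub_add_cancel hN]
    have h5 : k ^ 2 ≤ 2 * (u' r ^ 2 + u'' r ^ 2) * (r ^ (N - 1) * r) := by
      rw [← h4]
      refine h2.trans ?_
      gcongr
    rw [show 2 / k ^ 2 * (r ^ (N - 1) * (u' r ^ 2 + u'' r ^ 2)) * r =
      2 * (u' r ^ 2 + u'' r ^ 2) * (r ^ (N - 1) * r) / k ^ 2 by ring]
    rwa [le_div_iff₀ (by positivity), one_mul]
  rw [intervalIntegrable_inv_iff] at hinv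
  rcases hinv with h | h
  · exact hb.ne h
  · exact h left_mem_uIcc

/-- An asymptotic upper bound `c` on `r² Ψ` for the linearised equation
`u''' + (N-1)/r u'' - (N-1)/r² u' + Ψ u' = 0`, whose Euler exponents are `-1 + δ` and
`-(N - 3 + δ)`, is incompatible with a finite-energy unbounded decreasing `u`. -/
theorem false_of_sq_mul_le {N : ℕ} (hN : 10 ≤ N) {u u' u'' u''' Ψ : ℝ → ℝ} {b δ : ℝ}
    (hb : 0 < b) (hb1 : b ≤ 1) (hδ : 0 < δ) (hδ1 : δ < 1)
    (hu : ∀ r ∈ Ioc (0:ℝ) b, HasDerivAt u (u' r) r)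
    (hu' : ∀ r ∈ Ioc (0:ℝ) b, HasDerivAt u' (u'' r) r)
    (hu'' : ∀ r ∈ Ioc (0:ℝ) b, HasDerivAt u'' (u''' r) r)
    (hneg : ∀ r ∈ Ioc (0:ℝ) b, u' r < 0)
    (htop : Tendsto u (nhdsWithin 0 (Ioi 0)) atTop)
    (hlin : ∀ r ∈ Ioc (0:ℝ) b, r ^ 2 * u''' r + ((N:ℝ) - 1) * r * u'' r - ((N:ℝ) - 1) * u' r
      + r ^ 2 * Ψ r * u' r = 0)
    (hint : IntervalIntegrable (fun r => r ^ (N - 1) * (u' r ^ 2 + u'' r ^ 2)) volume 0 1)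
    (hΨ : ∀ r ∈ Ioc (0:ℝ) b, r ^ 2 * Ψ r ≤ 2 * ((N:ℝ) - 2) - ((N:ℝ) - 4) * δ - δ ^ 2) :
    False := by
  have hN' : (10:ℝ) ≤ N := by exact_mod_cast hN
  set α : ℝ := -1 + δ with hα
  set γ : ℝ := N - 3 + δ with hγ
  set m : ℝ → ℝ := fun r => (r * u'' r - α * u' r) * r ^ γ with hm
  have hder : ∀ r ∈ Ioc (0:ℝ) b, HasDerivAt m
      (((1 * u'' r + r * u''' r) - α * u'' r) * r ^ γ +
        (r * u'' r - α * u' r) * (γ * r ^ (γ - 1))) r := by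
    intro r hr
    exact (((hasDerivAt_id r).mul (hu'' r hr)).sub ((hu' r hr).const_mul α)).mul
      (Real.hasDerivAt_rpow_const (Or.inl hr.1.ne'))
  have hanti : AntitoneOn m (Ioc 0 b) := by
    refine antitoneOn_of_hasDerivWithinAt_nonpos (convex_Ioc 0 b)
      (fun r hr => (hder r hr).continuousAt.continuousWithinAt)
      (fun r hr => (hder r (interior_subset hr)).hasDerivWithinAt) ?_
    intro r hr
    replace hr := interior_subset hr
    have hr0 := hr.1
    have e : r ^ γ = r ^ (γ - 1) * r := by
      rw [← Real.rpow_add_one hr0.ne', sub_add_cancel]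
    have hpos : 0 < r ^ (γ - 1) := Real.rpow_pos_of_pos hr0 _
    have e2 : ((1 * u'' r + r * u''' r) - α * u'' r) * r ^ γ +
        (r * u'' r - α * u' r) * (γ * r ^ (γ - 1)) =
        r ^ (γ - 1) * ((2 * ((N:ℝ) - 2) - ((N:ℝ) - 4) * δ - δ ^ 2 - r ^ 2 * Ψ r) * u' r) := by
      rw [e, hα, hγ]
      linear_combination r ^ ((N:ℝ) - 3 + δ - 1) * hlin r hr
    rw [e2]
    exact mul_nonpos_of_nonneg_of_nonpos hpos.le
      (mul_nonpos_of_nonneg_of_nonpos (by linarith [hΨ r hr]) (hneg r hr).le)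
  by_cases hcase : ∃ r ∈ Ioc (0:ℝ) b, 0 < m r
  · obtain ⟨a, ha, hma⟩ := hcase
    refine not_intervalIntegrable_of_le (by omega) ha.1 (ha.2.trans hb1) hma (α := α) (γ := γ)
      ?_ (by linarith) (fun r hr => hanti ⟨hr.1, hr.2.trans ha.2⟩ ha hr.2) hint
    rw [abs_le]
    constructor <;> linarith
  · push Not at hcase
    have hanti2 : AntitoneOn (fun r => u' r * r ^ (-α)) (Ioc 0 b) := by
      have hd : ∀ r ∈ Ioc (0:ℝ) b, HasDerivAt (fun r => u' r * r ^ (-α))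
          (u'' r * r ^ (-α) + u' r * (-α * r ^ (-α - 1))) r := fun r hr =>
        (hu' r hr).mul (Real.hasDerivAt_rpow_const (Or.inl hr.1.ne'))
      refine antitoneOn_of_hasDerivWithinAt_nonpos (convex_Ioc 0 b)
        (fun r hr => (hd r hr).continuousAt.continuousWithinAt)
        (fun r hr => (hd r (interior_subset hr)).hasDerivWithinAt) ?_
      intro r hr
      replace hr := interior_subset hr
      have hr0 := hr.1
      have e : r ^ (-α) = r ^ (-α - 1) * r := by
        rw [← Real.rpow_add_one hr0.ne', sub_add_cancel]
      have hv : r * u'' r - α * u' r ≤ 0 :=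
        nonpos_of_mul_nonpos_left (hcase r hr) (Real.rpow_pos_of_pos hr0 _)
      have hpos : 0 < r ^ (-α - 1) := Real.rpow_pos_of_pos hr0 _
      rw [e]
      nlinarith [mul_nonpos_of_nonneg_of_nonpos hpos.le hv]
    refine not_tendsto_atTop_of_deriv_ge (C := -(u' b * b ^ (-α))) (α := α) hb (by linarith) hu
      (fun r hr => ?_) htop
    have h := hanti2 hr ⟨hb, le_rfl⟩ hr.2
    have hpos : 0 < r ^ α := Real.rpow_pos_of_pos hr.1 _
    have h2 := mul_le_mul_of_nonneg_right h hpos.le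
    simp only [mul_assoc] at h2
    rw [← Real.rpow_add hr.1, neg_add_cancel, Real.rpow_zero, mul_one] at h2
    linarith

theorem stmt1 (N : ℕ) (hN : 10 ≤ N) (lam : ℝ) (hlam : 0 < lam)
    (f u u' u'' u''' : ℝ → ℝ) (hf : StarCond f)
    (hud1 : ∀ r ∈ Set.Ioc (0:ℝ) 1, HasDerivWithinAt u (u' r) (Set.Ioc 0 1) r)
    (hud2 : ∀ r ∈ Set.Ioc (0:ℝ) 1, HasDerivWithinAt u' (u'' r) (Set.Ioc 0 1) r)
    (hud3 : ∀ r ∈ Set.Ioc (0:ℝ) 1, HasDerivWithinAt u'' (u''' r) (Set.Ioc 0 1) r)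
    (hud4 : ContinuousOn u''' (Set.Ioc 0 1))
    (hu'neg : ∀ r ∈ Set.Ioc (0:ℝ) 1, u' r < 0)
    (hu1 : u 1 = 0)
    (hublow : Tendsto u (nhdsWithin 0 (Set.Ioi 0)) atTop)
    (hpde : ∀ r ∈ Set.Ioc (0:ℝ) 1,
      -u'' r - ((N:ℝ) - 1) / r * u' r = lam * f (u r))
    (hint : IntervalIntegrable (fun r => r ^ (N - 1) * (u' r ^ 2 + u'' r ^ 2)) volume 0 1)
    (hstab : RadialStability N (fun r => lam * derivWithin f (Set.Ici 0) (u r))) :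
    2 * ((N:ℝ) - 2) ≤
      Filter.limsup (fun r => r ^ 2 * (lam * derivWithin f (Set.Ici 0) (u r)))
        (nhdsWithin 0 (Set.Ioi 0)) := by
  obtain ⟨hfC, hfmono, hfconv, -, -⟩ := hf
  have hN' : (10:ℝ) ≤ N := by exact_mod_cast hN
  have hucont : ContinuousOn u (Ioc 0 1) := fun r hr => (hud1 r hr).continuousWithinAt
  have hnhds : ∀ r ∈ Ioo (0:ℝ) 1, Ioc (0:ℝ) 1 ∈ nhds r := fun r hr => Ioc_mem_nhds hr.1 hr.2
  have huanti : StrictAntiOn u (Ioc 0 1) := by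
    refine strictAntiOn_of_hasDerivWithinAt_neg (f' := u') (convex_Ioc 0 1) hucont
      (fun r hr => (hud1 r (interior_subset hr)).mono interior_subset)
      (fun r hr => hu'neg r (interior_subset hr))
  have hupos : ∀ r ∈ Ioo (0:ℝ) 1, 0 < u r := fun r hr => by
    rw [← hu1]
    exact huanti ⟨hr.1, hr.2.le⟩ ⟨one_pos, le_rfl⟩ hr.2
  have hunn : ∀ r ∈ Ioc (0:ℝ) 1, u r ∈ Ici (0:ℝ) := fun r hr => by
    rw [mem_Ici, ← hu1]
    exact huanti.antitoneOn hr ⟨one_pos, le_rfl⟩ hr.2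
  have hbound : ∀ a : ℝ, 0 < a → a < 1 / 2 →
      a ^ 2 * (lam * derivWithin f (Ici 0) (u a)) ≤ 128 * (8 / 3 : ℝ) ^ (N - 1) := by
    intro a ha ha2
    refine hstab.sq_mul_le ?_ ?_ ?_ ha ha2
    · exact continuousOn_const.mul
        ((hfC.continuousOn_derivWithin (uniqueDiffOn_Ici 0) le_rfl).comp hucont hunn)
    · intro x hx y hy hxy
      have := hfconv.monotoneOn_derivWithin (hfC.differentiableOn one_ne_zero)
        (hunn y hy) (hunn x hx) (huanti.antitoneOn hx hy hxy)
      exact mul_le_mul_of_nonneg_left this hlam.le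
    · intro r _
      exact mul_nonneg hlam.le hfmono.derivWithin_nonneg
  have hbdd : IsBoundedUnder (· ≤ ·) (nhdsWithin (0:ℝ) (Ioi 0))
      (fun r => r ^ 2 * (lam * derivWithin f (Ici 0) (u r))) := by
    refine isBoundedUnder_of_eventually_le (a := 128 * (8 / 3 : ℝ) ^ (N - 1)) ?_
    filter_upwards [Ioo_mem_nhdsGT (show (0:ℝ) < 1 / 2 by norm_num)] with r hr
    exact hbound r hr.1 hr.2
  by_contra! hlt
  obtain ⟨c, hc1, hc2⟩ := exists_between hlt
  have hev := eventually_lt_of_limsup_lt hc1 hbdd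
  obtain ⟨δ, hδ, hδ1, hδc⟩ : ∃ δ : ℝ, 0 < δ ∧ δ < 1 ∧
      c ≤ 2 * ((N:ℝ) - 2) - ((N:ℝ) - 4) * δ - δ ^ 2 := by
    have hg : 0 < (2 * ((N:ℝ) - 2) - c) / N := div_pos (by linarith) (by linarith)
    refine ⟨min (1 / 2) ((2 * ((N:ℝ) - 2) - c) / N), lt_min (by norm_num) hg,
      (min_le_left _ _).trans_lt (by norm_num), ?_⟩
    set δ := min (1 / 2) ((2 * ((N:ℝ) - 2) - c) / N) with hδdef
    have h0 : 0 < δ := lt_min (by norm_num) hg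
    have h1 : δ ≤ 1 / 2 := min_le_left _ _
    have h2 : δ * N ≤ 2 * ((N:ℝ) - 2) - c := (le_div_iff₀ (by linarith)).1 (min_le_right _ _)
    nlinarith
  obtain ⟨b₀, hb₀, hsub⟩ := mem_nhdsGT_iff_exists_Ioc_subset.1 hev
  have hb₀' : (0:ℝ) < b₀ := hb₀
  set b := min b₀ (1 / 2) with hbdef
  have hb : 0 < b := lt_min hb₀' (by norm_num)
  have hIoo : ∀ r ∈ Ioc (0:ℝ) b, r ∈ Ioo (0:ℝ) 1 := fun r hr =>
    ⟨hr.1, by linarith [hr.2, min_le_right b₀ (1 / 2)]⟩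
  have hIoc : ∀ r ∈ Ioc (0:ℝ) b, r ∈ Ioc (0:ℝ) 1 := fun r hr => Ioo_subset_Ioc_self (hIoo r hr)
  have hd1 : ∀ r ∈ Ioc (0:ℝ) b, HasDerivAt u (u' r) r := fun r hr =>
    (hud1 r (hIoc r hr)).hasDerivAt (hnhds r (hIoo r hr))
  have hd2 : ∀ r ∈ Ioc (0:ℝ) b, HasDerivAt u' (u'' r) r := fun r hr =>
    (hud2 r (hIoc r hr)).hasDerivAt (hnhds r (hIoo r hr))
  have hd3 : ∀ r ∈ Ioc (0:ℝ) b, HasDerivAt u'' (u''' r) r := fun r hr =>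
    (hud3 r (hIoc r hr)).hasDerivAt (hnhds r (hIoo r hr))
  refine false_of_sq_mul_le (Ψ := fun r => lam * derivWithin f (Ici 0) (u r)) hN hb
    ((min_le_right _ _).trans (by norm_num)) hδ hδ1 hd1 hd2 hd3
    (fun r hr => hu'neg r (hIoc r hr)) hublow ?_ hint
    (fun r hr => (hsub ⟨hr.1, hr.2.trans (min_le_left _ _)⟩ : _ < c).le.trans hδc)
  intro r hr
  have hr0 : r ≠ 0 := hr.1.ne'
  have hfd : HasDerivAt f (derivWithin f (Ici 0) (u r)) (u r) :=
    ((hfC.differentiableOn one_ne_zero) _ (hunn r (hIoc r hr))).hasDerivWithinAt.hasDerivAt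
      (Ici_mem_nhds (hupos r (hIoo r hr)))
  have hleft := (hd3 r hr).neg.sub
    (((hasDerivAt_const r ((N:ℝ) - 1)).div (hasDerivAt_id r) hr0).mul (hd2 r hr))
  have hright := (hfd.comp r (hd1 r hr)).const_mul lam
  have heq := (hright.congr_of_eventuallyEq (by
    filter_upwards [hnhds r (hIoo r hr)] with s hs
    exact hpde s hs)).unique hleft
  simp only [Pi.div_apply, id] at heq
  field_simp at heq
  linear_combination heq
end

section
/- Let N ≥ 10 be an integer, λ > 0, and let f : [0,∞) → ℝ satisfy condition (★). Let u : (0,1] → ℝ be C³ with u'(r) < 0 for all r ∈ (0,1], u(1) = 0, lim_{r→0⁺} u(r) = +∞, satisfying −u''(r) − ((N−1)/r)·u'(r) = λ·f(u(r)) for all r ∈ (0,1], and ∫₀¹ r^{N−1}(u'(r)² + u''(r)²) dr < ∞. Suppose Ψ(r) := λ·f'(u(r)) satisfies the radial stability inequality in dimension N, and let λ₁ > 0 and φ₁ : [0,1] → ℝ be a C² function with φ₁ > 0 on [0,1), φ₁(1) = 0, φ₁'(0) = 0, and −φ₁''(r) − ((N−1)/r)·φ₁'(r) = λ₁·φ₁(r)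 on (0,1). Then 2(N−2) ≤ limsup_{r→0⁺} r²·λ·f'(u(r)) ≤ λ₁; in particular this limsup is a finite strictly positive number. -/
open MeasureTheory Filter Set

/-- Testing with tent functions supported in `[R / 2, R]` gives a crude pointwise bound. -/
lemma RadialStability.exists_mul_cube_le {N : ℕ} {Ψ : ℝ → ℝ} (hstab : RadialStability N Ψ)
    (hcont : ContinuousOn Ψ (Ioc 0 1)) (hanti : AntitoneOn Ψ (Ioc 0 1))
    (hnonneg : ∀ r ∈ Ioc (0 : ℝ) 1, 0 ≤ Ψ r) :
    ∃ C, ∀ r ∈ Ioc (0 : ℝ) 1, Ψ r * r ^ 3 ≤ C := by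
  refine ⟨256 * 2 ^ (N - 1), fun R hR => ?_⟩
  obtain ⟨hR0, hR1⟩ := hR
  set ξ : ℝ → ℝ := fun s => max 0 (min (s - R / 2) (R - s)) with hξ
  have hlip : LipschitzWith 1 ξ := by
    have h1 : LipschitzWith 1 (fun s : ℝ => s - R / 2) := by
      refine LipschitzWith.of_dist_le_mul fun x y => ?_
      simp [Real.dist_eq]
    have h2 : LipschitzWith 1 (fun s : ℝ => R - s) := by
      refine LipschitzWith.of_dist_le_mul fun x y => ?_
      rw [dist_sub_left]
      simp
    simpa using (h1.min h2).const_max 0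
  have hξc : Continuous ξ := hlip.continuous
  have hS := hstab ξ ⟨1, hlip.lipschitzOnWith⟩ (by
    simp only [hξ]
    exact max_eq_left ((min_le_right _ _).trans (by linarith)))
  have hup : (∫ r in (0 : ℝ)..1, r ^ (N - 1) * (deriv ξ r) ^ 2) ≤ R ^ (N - 1) := by
    have h := intervalIntegral.norm_integral_le_of_norm_le_const (a := (0 : ℝ)) (b := 1)
      (f := fun r => r ^ (N - 1) * (deriv ξ r) ^ 2) (C := R ^ (N - 1)) (by
        intro s hs
        rw [uIoc_of_le zero_le_one] at hs
        have hs0 : 0 ≤ s := hs.1.le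
        rw [Real.norm_of_nonneg (by positivity)]
        rcases le_or_gt s R with hsR | hsR
        · have hd : |deriv ξ s| ≤ 1 := by
            simpa using norm_deriv_le_of_lipschitz hlip (x₀ := s)
          have hd2 : (deriv ξ s) ^ 2 ≤ 1 := (sq_le_one_iff_abs_le_one _).2 hd
          calc s ^ (N - 1) * (deriv ξ s) ^ 2 ≤ R ^ (N - 1) * 1 := by gcongr
            _ = R ^ (N - 1) := mul_one _
        · have hev : ξ =ᶠ[nhds s] fun _ => 0 := by
            filter_upwards [lt_mem_nhds hsR] with t ht
            exact max_eq_left ((min_le_right _ _).trans (by linarith))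
          rw [hev.deriv_eq, deriv_const, zero_pow two_ne_zero, mul_zero]
          positivity)
    have h2 := (le_abs_self _).trans h
    simpa using h2
  have hint : IntervalIntegrable (fun r => r ^ (N - 1) * Ψ r * ξ r ^ 2) volume 0 1 := by
    have h1 : IntervalIntegrable (fun r => r ^ (N - 1) * Ψ r * ξ r ^ 2) volume 0 (R / 2) := by
      refine (intervalIntegrable_const (c := (0 : ℝ))).congr fun s hs => ?_
      rw [uIoc_of_le (by positivity)] at hs
      have : ξ s = 0 := max_eq_left ((min_le_left _ _).trans (by linarith [hs.2]))
      simp [this]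
    have h2 : IntervalIntegrable (fun r => r ^ (N - 1) * Ψ r * ξ r ^ 2) volume (R / 2) 1 := by
      refine ContinuousOn.intervalIntegrable ?_
      rw [uIcc_of_le (by linarith)]
      have : ContinuousOn Ψ (Icc (R / 2) 1) :=
        hcont.mono fun s hs => ⟨by linarith [hs.1], hs.2⟩
      fun_prop
    exact h1.trans h2
  have hlow : (∫ r in (5 * R / 8)..(7 * R / 8), (R / 2) ^ (N - 1) * Ψ R * (R / 8) ^ 2) ≤
      ∫ r in (0 : ℝ)..1, r ^ (N - 1) * Ψ r * ξ r ^ 2 := by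
    have hm := intervalIntegral.integral_mono_interval (μ := volume)
      (f := fun r => r ^ (N - 1) * Ψ r * ξ r ^ 2)
      (a := 5 * R / 8) (b := 7 * R / 8) (c := 0) (d := 1) (by positivity) (by linarith)
      (by linarith) (by
        filter_upwards [ae_restrict_mem measurableSet_Ioc] with s hs
        have := hnonneg s hs
        have := hs.1
        simp only [Pi.zero_apply]
        positivity) hint
    refine le_trans ?_ hm
    refine intervalIntegral.integral_mono_on (by linarith) (by simp)
      (hint.mono_set ?_) fun s hs => ?_
    · rw [uIcc_of_le (by linarith), uIcc_of_le (by linarith)]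
      exact Icc_subset_Icc (by positivity) (by linarith)
    · have hs1 : Ψ R ≤ Ψ s := hanti ⟨by linarith [hs.1], by linarith [hs.2]⟩ ⟨hR0, hR1⟩
        (by linarith [hs.2])
      have hξs : R / 8 ≤ ξ s :=
        le_max_of_le_right (le_min (by linarith [hs.1]) (by linarith [hs.2]))
      have h0 := hnonneg R ⟨hR0, hR1⟩
      have h1 : R / 2 ≤ s := by linarith [hs.1]
      have h2 : 0 ≤ s ^ (N - 1) := pow_nonneg (by linarith) _
      have h3 : 0 ≤ s ^ (N - 1) * Ψ s := mul_nonneg h2 (h0.trans hs1)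
      gcongr
  have hfin := hlow.trans (hS.trans hup)
  rw [intervalIntegral.integral_const, smul_eq_mul, div_pow] at hfin
  have hp : (0 : ℝ) < R ^ (N - 1) := by positivity
  have h2p : (0 : ℝ) < 2 ^ (N - 1) := by positivity
  have hfin' : R ^ (N - 1) * (Ψ R * R ^ 3) ≤ R ^ (N - 1) * (256 * 2 ^ (N - 1)) := by
    have := mul_le_mul_of_nonneg_left hfin (show (0 : ℝ) ≤ 256 * 2 ^ (N - 1) by positivity)
    refine le_trans (le_of_eq ?_) (this.trans (le_of_eq ?_))
    · field_simp
      ring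
    · ring
  exact le_of_mul_le_mul_left hfin' hp

/-- Energy identity for a radial Dirichlet eigenfunction, rescaled to the ball of radius `R`. -/
lemma integral_radial_eigenfunction_energy {k : ℕ} {lam1 R : ℝ} (hR : 0 < R)
    {φ φ' φ'' : ℝ → ℝ}
    (hφd1 : ∀ r ∈ Icc (0 : ℝ) 1, HasDerivWithinAt φ (φ' r) (Icc 0 1) r)
    (hφd2 : ∀ r ∈ Icc (0 : ℝ) 1, HasDerivWithinAt φ' (φ'' r) (Icc 0 1) r)
    (hφ1 : φ 1 = 0)
    (heig : ∀ r ∈ Ioo (0 : ℝ) 1, -φ'' r - ((k : ℝ) + 1) / r * φ' r = lam1 * φ r) :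
    (∫ s in (0 : ℝ)..R, s ^ (k + 1) * (φ' (s / R) / R) ^ 2) =
      lam1 / R ^ 2 * ∫ s in (0 : ℝ)..R, s ^ (k + 1) * φ (s / R) ^ 2 := by
  have hmaps : MapsTo (fun s : ℝ => s / R) (Icc 0 R) (Icc 0 1) := fun s hs =>
    ⟨div_nonneg hs.1 hR.le, (div_le_one hR).2 hs.2⟩
  have hdiv : ContinuousOn (fun s : ℝ => s / R) (Icc 0 R) := by fun_prop
  have hφc : ContinuousOn (fun s => φ (s / R)) (Icc 0 R) :=
    ContinuousOn.comp (fun r hr => (hφd1 r hr).continuousWithinAt) hdiv hmaps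
  have hφ'c : ContinuousOn (fun s => φ' (s / R)) (Icc 0 R) :=
    ContinuousOn.comp (fun r hr => (hφd2 r hr).continuousWithinAt) hdiv hmaps
  have hpow : ContinuousOn (fun s : ℝ => s ^ (k + 1)) (Icc 0 R) := by fun_prop
  have hi1 : IntervalIntegrable (fun s => s ^ (k + 1) * (φ' (s / R) / R) ^ 2) volume 0 R := by
    refine ContinuousOn.intervalIntegrable ?_
    rw [uIcc_of_le hR.le]
    exact hpow.mul ((hφ'c.div_const R).pow 2)
  have hi2 : IntervalIntegrable (fun s => lam1 / R ^ 2 * (s ^ (k + 1) * φ (s / R) ^ 2))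
      volume 0 R := by
    refine ContinuousOn.intervalIntegrable ?_
    rw [uIcc_of_le hR.le]
    exact continuousOn_const.mul (hpow.mul (hφc.pow 2))
  have hftc := intervalIntegral.integral_eq_sub_of_hasDerivAt_of_le hR.le
    (f := fun s => s ^ (k + 1) * φ' (s / R) * φ (s / R) / R)
    (f' := fun s => s ^ (k + 1) * (φ' (s / R) / R) ^ 2 -
      lam1 / R ^ 2 * (s ^ (k + 1) * φ (s / R) ^ 2))
    (((hpow.mul hφ'c).mul hφc).div_const R) (fun s hs => ?_) (hi1.sub hi2)
  · rw [intervalIntegral.integral_sub hi1 hi2, intervalIntegral.integral_const_mul] at hftc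
    simp only [div_self hR.ne', hφ1] at hftc
    simp at hftc
    linarith
  · have hx : s / R ∈ Ioo (0 : ℝ) 1 := ⟨div_pos hs.1 hR, (div_lt_one hR).2 hs.2⟩
    have hx' := Ioo_subset_Icc_self hx
    have hd : HasDerivAt (fun s : ℝ => s / R) (1 / R) s := (hasDerivAt_id s).div_const R
    have h1 : HasDerivAt (fun s => φ (s / R)) (φ' (s / R) * (1 / R)) s :=
      ((hφd1 _ hx').hasDerivAt (Icc_mem_nhds hx.1 hx.2)).comp s hd
    have h2 : HasDerivAt (fun s => φ' (s / R)) (φ'' (s / R) * (1 / R)) s :=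
      ((hφd2 _ hx').hasDerivAt (Icc_mem_nhds hx.1 hx.2)).comp s hd
    refine ((((hasDerivAt_pow (k + 1) s).mul h2).mul h1).div_const R).congr_deriv ?_
    have he := heig _ hx
    have hs0 : s ≠ 0 := hs.1.ne'
    have hR0 := hR.ne'
    have he' : φ'' (s / R) = -lam1 * φ (s / R) - ((k : ℝ) + 1) / (s / R) * φ' (s / R) := by
      linarith
    rw [he']
    simp only [Nat.add_sub_cancel, Pi.mul_apply]
    push_cast
    field_simp
    ring

/-- Testing with a rescaled first eigenfunction. -/
lemma RadialStability.sq_mul_le_eigenvalue {k : ℕ} (hk : 3 ≤ k) {Ψ : ℝ → ℝ}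
    (hstab : RadialStability (k + 2) Ψ)
    (hcont : ContinuousOn Ψ (Ioc 0 1)) (hanti : AntitoneOn Ψ (Ioc 0 1))
    (hnonneg : ∀ r ∈ Ioc (0 : ℝ) 1, 0 ≤ Ψ r) {lam1 : ℝ} {φ φ' φ'' : ℝ → ℝ}
    (hφd1 : ∀ r ∈ Icc (0 : ℝ) 1, HasDerivWithinAt φ (φ' r) (Icc 0 1) r)
    (hφd2 : ∀ r ∈ Icc (0 : ℝ) 1, HasDerivWithinAt φ' (φ'' r) (Icc 0 1) r)
    (hφpos : ∀ r ∈ Ico (0 : ℝ) 1, 0 < φ r) (hφ1 : φ 1 = 0)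
    (heig : ∀ r ∈ Ioo (0 : ℝ) 1, -φ'' r - ((k : ℝ) + 1) / r * φ' r = lam1 * φ r)
    {R : ℝ} (hR : R ∈ Ioc (0 : ℝ) 1) : R ^ 2 * Ψ R ≤ lam1 := by
  obtain ⟨C, hC⟩ := hstab.exists_mul_cube_le hcont hanti hnonneg
  obtain ⟨hR0, hR1⟩ := hR
  have hφc : ContinuousOn φ (Icc 0 1) := fun r hr => (hφd1 r hr).continuousWithinAt
  have hφ'c : ContinuousOn φ' (Icc 0 1) := fun r hr => (hφd2 r hr).continuousWithinAt
  obtain ⟨M, hM⟩ := isCompact_Icc.exists_bound_of_continuousOn hφ'c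
  obtain ⟨M₀, hM₀⟩ := isCompact_Icc.exists_bound_of_continuousOn hφc
  have hφL : LipschitzOnWith M.toNNReal φ (Icc 0 1) :=
    (convex_Icc (0 : ℝ) 1).lipschitzOnWith_of_nnnorm_hasDerivWithin_le hφd1 fun x hx => by
      rw [← NNReal.coe_le_coe]
      exact (hM x hx).trans (Real.le_coe_toNNReal M)
  set ξ : ℝ → ℝ := fun s => φ (min (s / R) 1) with hξ
  have hmL : LipschitzWith (1 / R).toNNReal (fun s : ℝ => min (s / R) 1) := by
    refine LipschitzWith.min_const (LipschitzWith.of_dist_le_mul fun x y => ?_) 1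
    rw [Real.coe_toNNReal _ (by positivity), Real.dist_eq, Real.dist_eq, ← sub_div, abs_div,
      abs_of_pos hR0]
    exact le_of_eq (by ring)
  have hmaps : MapsTo (fun s : ℝ => min (s / R) 1) (Icc 0 1) (Icc 0 1) := fun s hs =>
    ⟨le_min (div_nonneg hs.1 hR0.le) zero_le_one, min_le_right _ _⟩
  have hξL : LipschitzOnWith (M.toNNReal * (1 / R).toNNReal) ξ (Icc 0 1) :=
    hφL.comp hmL.lipschitzOnWith hmaps
  have hξin : ∀ s, s ≤ R → ξ s = φ (s / R) := fun s hs => by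
    simp only [hξ, min_eq_left ((div_le_one hR0).2 hs)]
  have hξout : ∀ s, R ≤ s → ξ s = 0 := fun s hs => by
    simp only [hξ, min_eq_right ((one_le_div hR0).2 hs), hφ1]
  have hS := hstab ξ ⟨_, hξL⟩ (hξout 1 hR1)
  rw [show k + 2 - 1 = k + 1 from rfl] at hS
  have hpow : ContinuousOn (fun s : ℝ => s ^ (k + 1)) (Icc 0 R) := by fun_prop
  have hright : (∫ s in (0 : ℝ)..1, s ^ (k + 1) * (deriv ξ s) ^ 2) =
      ∫ s in (0 : ℝ)..R, s ^ (k + 1) * (φ' (s / R) / R) ^ 2 := by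
    have hin : EqOn (fun s => s ^ (k + 1) * (φ' (s / R) / R) ^ 2)
        (fun s => s ^ (k + 1) * (deriv ξ s) ^ 2) (Ioo 0 R) := fun s hs => by
      have hx : s / R ∈ Ioo (0 : ℝ) 1 := ⟨div_pos hs.1 hR0, (div_lt_one hR0).2 hs.2⟩
      have hd : HasDerivAt (fun s : ℝ => s / R) (1 / R) s := (hasDerivAt_id s).div_const R
      have h1 : HasDerivAt (fun s => φ (s / R)) (φ' (s / R) * (1 / R)) s :=
        ((hφd1 _ (Ioo_subset_Icc_self hx)).hasDerivAt (Icc_mem_nhds hx.1 hx.2)).comp s hd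
      have hev : ξ =ᶠ[nhds s] fun s => φ (s / R) := by
        filter_upwards [gt_mem_nhds hs.2] with t ht using hξin t ht.le
      simp only [hev.deriv_eq, h1.deriv, mul_one_div]
    have hout : EqOn (fun _ => 0) (fun s => s ^ (k + 1) * (deriv ξ s) ^ 2) (Ioo R 1) :=
      fun s hs => by
        have hev : ξ =ᶠ[nhds s] fun _ => 0 := by
          filter_upwards [lt_mem_nhds hs.1] with t ht using hξout t ht.le
        simp [hev.deriv_eq]
    have hi1 : IntervalIntegrable (fun s => s ^ (k + 1) * (φ' (s / R) / R) ^ 2) volume 0 R := by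
      refine ContinuousOn.intervalIntegrable ?_
      rw [uIcc_of_le hR0.le]
      have : ContinuousOn (fun s => φ' (s / R)) (Icc 0 R) :=
        hφ'c.comp (by fun_prop) fun s hs => ⟨div_nonneg hs.1 hR0.le, (div_le_one hR0).2 hs.2⟩
      exact hpow.mul ((this.div_const R).pow 2)
    have hi1' : IntervalIntegrable (fun s => s ^ (k + 1) * (deriv ξ s) ^ 2) volume 0 R :=
      hi1.congr_uIoo (by rwa [uIoo_of_le hR0.le])
    have hi2' : IntervalIntegrable (fun s => s ^ (k + 1) * (deriv ξ s) ^ 2) volume R 1 :=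
      (intervalIntegrable_const (c := (0 : ℝ))).congr_uIoo (by rwa [uIoo_of_le hR1])
    rw [← intervalIntegral.integral_add_adjacent_intervals hi1' hi2',
      ← intervalIntegral.integral_congr_Ioo_of_le hR0.le hin,
      ← intervalIntegral.integral_congr_Ioo_of_le hR1 hout]
    simp
  have hiL : IntervalIntegrable (fun s => s ^ (k + 1) * Ψ s * ξ s ^ 2) volume 0 1 := by
    refine (intervalIntegrable_const (c := C * M₀ ^ 2)).mono_fun' ?_ ?_
    · rw [uIoc_of_le zero_le_one]
      refine ContinuousOn.aestronglyMeasurable ?_ measurableSet_Ioc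
      have := hξL.continuousOn.mono Ioc_subset_Icc_self
      fun_prop
    · rw [uIoc_of_le zero_le_one]
      filter_upwards [ae_restrict_mem measurableSet_Ioc] with s hs
      have h0 := hnonneg s hs
      have hs0 := hs.1
      rw [Real.norm_of_nonneg (by positivity)]
      have hb : ξ s ^ 2 ≤ M₀ ^ 2 :=
        sq_le_sq' (abs_le.1 (hM₀ _ (hmaps (Ioc_subset_Icc_self hs)))).1
          (abs_le.1 (hM₀ _ (hmaps (Ioc_subset_Icc_self hs)))).2
      have hpow : s ^ (k + 1) ≤ s ^ 3 := pow_le_pow_of_le_one hs0.le hs.2 (by omega)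
      calc s ^ (k + 1) * Ψ s * ξ s ^ 2 ≤ s ^ 3 * Ψ s * M₀ ^ 2 := by gcongr
        _ = Ψ s * s ^ 3 * M₀ ^ 2 := by ring
        _ ≤ C * M₀ ^ 2 := by
          gcongr
          exact hC s hs
  have hi0 : IntervalIntegrable (fun s => s ^ (k + 1) * φ (s / R) ^ 2) volume 0 R := by
    refine ContinuousOn.intervalIntegrable ?_
    rw [uIcc_of_le hR0.le]
    have : ContinuousOn (fun s => φ (s / R)) (Icc 0 R) :=
      hφc.comp (by fun_prop) fun s hs => ⟨div_nonneg hs.1 hR0.le, (div_le_one hR0).2 hs.2⟩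
    exact hpow.mul (this.pow 2)
  have hleft : Ψ R * (∫ s in (0 : ℝ)..R, s ^ (k + 1) * φ (s / R) ^ 2) ≤
      ∫ s in (0 : ℝ)..1, s ^ (k + 1) * Ψ s * ξ s ^ 2 := by
    rw [← intervalIntegral.integral_const_mul]
    refine le_trans ?_ (intervalIntegral.integral_mono_interval (a := 0) (b := R) le_rfl hR0.le
      hR1 ?_ hiL)
    · refine intervalIntegral.integral_mono_on_of_le_Ioo hR0.le (hi0.const_mul _)
        (hiL.mono_set ?_) fun s hs => ?_
      · rw [uIcc_of_le hR0.le, uIcc_of_le zero_le_one]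
        exact Icc_subset_Icc le_rfl hR1
      · rw [hξin s hs.2.le]
        have h1 : Ψ R ≤ Ψ s := hanti ⟨hs.1, by linarith [hs.2]⟩ ⟨hR0, hR1⟩ hs.2.le
        have hs0 := hs.1
        calc Ψ R * (s ^ (k + 1) * φ (s / R) ^ 2) ≤ Ψ s * (s ^ (k + 1) * φ (s / R) ^ 2) := by
              gcongr
          _ = _ := by ring
    · filter_upwards [ae_restrict_mem measurableSet_Ioc] with s hs
      have := hnonneg s hs
      have := hs.1
      simp only [Pi.zero_apply]
      positivity
  have hpos : 0 < ∫ s in (0 : ℝ)..R, s ^ (k + 1) * φ (s / R) ^ 2 := by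
    refine intervalIntegral.intervalIntegral_pos_of_pos_on hi0 (fun s hs => ?_) hR0
    have := hφpos (s / R) ⟨(div_pos hs.1 hR0).le, (div_lt_one hR0).2 hs.2⟩
    have := hs.1
    positivity
  have hfin := hleft.trans hS
  rw [hright, integral_radial_eigenfunction_energy hR0 hφd1 hφd2 hφ1 heig] at hfin
  have h3 := le_of_mul_le_mul_right hfin hpos
  rw [le_div_iff₀ (by positivity)] at h3
  linarith

/-- If `r ^ 2 * Ψ r` stays below a constant smaller than `2 (N - 2)` near the origin, where
`N = k + 3`, then a decreasing function whose derivative solves the linearized equation and whose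
second derivative has finite energy cannot blow up at the origin. -/
lemma not_tendsto_atTop_of_sq_mul_le {k : ℕ} (hk : 1 ≤ k) {c : ℝ} (hc : c < 2 * ((k : ℝ) + 1))
    {Ψ u u' u'' u''' : ℝ → ℝ}
    (hu : ∀ r ∈ Ioo (0 : ℝ) 1, HasDerivAt u (u' r) r)
    (hu' : ∀ r ∈ Ioo (0 : ℝ) 1, HasDerivAt u' (u'' r) r)
    (hu'' : ∀ r ∈ Ioo (0 : ℝ) 1, HasDerivAt u'' (u''' r) r)
    (hneg : ∀ r ∈ Ioo (0 : ℝ) 1, u' r < 0)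
    (hlin : ∀ r ∈ Ioo (0 : ℝ) 1,
      r ^ 2 * u''' r + (k + 2) * r * u'' r = (k + 2 - r ^ 2 * Ψ r) * u' r)
    (hint : IntervalIntegrable (fun r => r ^ (k + 2) * (u' r ^ 2 + u'' r ^ 2)) volume 0 1)
    (hΨ : ∀ᶠ r in nhdsWithin 0 (Ioi 0), r ^ 2 * Ψ r ≤ c) :
    ¬ Tendsto u (nhdsWithin 0 (Ioi 0)) atTop := by
  intro hlim
  obtain ⟨ε, hε0, hε1, hεc⟩ : ∃ ε : ℝ, 0 < ε ∧ ε < 1 ∧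
      c ≤ 2 * ((k : ℝ) + 1) - (k - 1) * ε - ε ^ 2 := by
    have hk0 : (0 : ℝ) ≤ k := Nat.cast_nonneg k
    refine ⟨min (1 / 2) ((2 * ((k : ℝ) + 1) - c) / (k + 1)), ?_, ?_, ?_⟩
    · exact lt_min (by norm_num) (div_pos (by linarith) (by linarith))
    · exact (min_le_left _ _).trans_lt (by norm_num)
    · set ε := min (1 / 2) ((2 * ((k : ℝ) + 1) - c) / (k + 1))
      have h1 : ε ≤ 1 / 2 := min_le_left _ _
      have h2 : ε ≤ (2 * ((k : ℝ) + 1) - c) / (k + 1) := min_le_right _ _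
      have h0 : 0 < ε := lt_min (by norm_num) (div_pos (by linarith) (by linarith))
      rw [le_div_iff₀ (by linarith)] at h2
      nlinarith
  obtain ⟨r₀, hr₀, hr₀Ψ⟩ := mem_nhdsGT_iff_exists_Ioo_subset.1 hΨ
  set ρ := min r₀ 1 with hρ
  have hρ0 : 0 < ρ := lt_min hr₀ one_pos
  have hsub : ∀ r ∈ Ioo 0 ρ, r ∈ Ioo (0 : ℝ) 1 := fun r hr =>
    ⟨hr.1, hr.2.trans_le (min_le_right _ _)⟩
  have hΨρ : ∀ r ∈ Ioo 0 ρ, r ^ 2 * Ψ r ≤ c := fun r hr =>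
    hr₀Ψ ⟨hr.1, hr.2.trans_le (min_le_left _ _)⟩
  have hw : ∀ (b : ℝ), ∀ r ∈ Ioo 0 ρ, HasDerivAt (fun r : ℝ => r ^ b) (b * r ^ b / r) r := by
    intro b r hr
    refine (Real.hasDerivAt_rpow_const (p := b) (Or.inl hr.1.ne')).congr_deriv ?_
    rw [Real.rpow_sub_one hr.1.ne']
    ring
  set a : ℝ := ε - 1 with ha
  set G : ℝ → ℝ := fun r => r ^ a * (a * (r ^ (k + 1) * u' r) - r ^ (k + 2) * u'' r) with hG
  have hGd : ∀ r ∈ Ioo 0 ρ, HasDerivAt G (r ^ a * r ^ k *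
      ((2 * ((k : ℝ) + 1) - (k - 1) * ε - ε ^ 2) - r ^ 2 * Ψ r) * (-u' r)) r := by
    intro r hr
    have h1 := hu' r (hsub r hr)
    have h2 := hu'' r (hsub r hr)
    refine ((hw a r hr).mul ((((hasDerivAt_pow (k + 1) r).mul h1).const_mul a).sub
      ((hasDerivAt_pow (k + 2) r).mul h2))).congr_deriv ?_
    have hr0 := hr.1.ne'
    have hl := hlin r (hsub r hr)
    simp only [Nat.add_sub_cancel, show k + 2 - 1 = k + 1 from rfl, Pi.mul_apply, Pi.sub_apply]
    push_cast
    have hΨu : r ^ 2 * Ψ r * u' r = (k + 2) * u' r - (r ^ 2 * u''' r + (k + 2) * r * u'' r) := by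
      linarith
    have hrhs : r ^ a * r ^ k * ((2 * ((k : ℝ) + 1) - (k - 1) * ε - ε ^ 2) - r ^ 2 * Ψ r) *
        (-u' r) = r ^ a * r ^ k * (-(2 * ((k : ℝ) + 1) - (k - 1) * ε - ε ^ 2) * u' r +
          r ^ 2 * Ψ r * u' r) := by ring
    rw [hrhs, hΨu]
    generalize r ^ a = w
    simp only [ha]
    field_simp
    ring
  have hGmono : MonotoneOn G (Ioo 0 ρ) := by
    refine monotoneOn_of_hasDerivWithinAt_nonneg (convex_Ioo 0 ρ)
      (fun r hr => (hGd r hr).continuousAt.continuousWithinAt)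
      (fun r hr => (hGd r (interior_subset hr)).hasDerivWithinAt) fun r hr => ?_
    have hr' := interior_subset hr
    have h1 := hΨρ r hr'
    have h2 := hneg r (hsub r hr')
    have h0 := hr'.1
    exact mul_nonneg (mul_nonneg (by positivity) (by linarith)) (by linarith)
  have hGnonneg : ∀ r ∈ Ioo 0 ρ, 0 ≤ G r := by
    intro R hR
    by_contra! hlt
    have hR1 := hsub R hR
    have hbound : ∀ r ∈ Ioc 0 R, r⁻¹ ≤
        (G R ^ 2)⁻¹ * (r ^ (k + 2) * (u' r ^ 2 + u'' r ^ 2)) := by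
      intro r hr
      have hrρ : r ∈ Ioo 0 ρ := ⟨hr.1, hr.2.trans_lt hR.2⟩
      have hr1 := hsub r hrρ
      have hr0 := hr.1
      have hle : G r ≤ G R := hGmono hrρ hR hr.2
      have hw0 : 0 < r ^ a := Real.rpow_pos_of_pos hr0 a
      have hv := hneg r hr1
      have h1 : -G R ≤ r ^ a * (r ^ (k + 2) * u'' r) := by
        have : 0 ≤ r ^ a * (a * (r ^ (k + 1) * u' r)) :=
          mul_nonneg hw0.le (mul_nonneg_of_nonpos_of_nonpos (by linarith)
            (mul_nonpos_of_nonneg_of_nonpos (by positivity) hv.le))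
        simp only [hG] at hle ⊢
        linarith
      have hu''pos : 0 < u'' r := by
        have : 0 < r ^ a * r ^ (k + 2) * u'' r := by linarith
        exact pos_of_mul_pos_right this (by positivity)
      have hwle : r ^ a ≤ r⁻¹ := by
        rw [← Real.rpow_neg_one]
        exact Real.rpow_le_rpow_of_exponent_ge hr0 hr1.2.le (by linarith)
      have h2 : -G R ≤ r ^ (k + 1) * u'' r := by
        calc -G R ≤ r ^ a * (r ^ (k + 2) * u'' r) := h1
          _ ≤ r⁻¹ * (r ^ (k + 2) * u'' r) := by gcongr
          _ = r ^ (k + 1) * u'' r := by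
            field_simp
            ring
      have h3 : G R ^ 2 ≤ r * (r ^ (k + 2) * u'' r ^ 2) := by
        calc G R ^ 2 = (-G R) ^ 2 := by ring
          _ ≤ (r ^ (k + 1) * u'' r) ^ 2 := by
            have : 0 ≤ -G R := by linarith
            gcongr
          _ = r ^ k * (r ^ (k + 2) * u'' r ^ 2) := by ring
          _ ≤ r ^ 1 * (r ^ (k + 2) * u'' r ^ 2) := by
            have := pow_le_pow_of_le_one hr0.le hr1.2.le hk
            gcongr
          _ = _ := by rw [pow_one]
      have hGR : 0 < G R ^ 2 := by nlinarith
      rw [inv_mul_eq_div, le_div_iff₀ hGR, inv_mul_le_iff₀ hr0]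
      refine h3.trans ?_
      gcongr
      nlinarith [sq_nonneg (u' r)]
    have hinv : IntervalIntegrable (fun r : ℝ => r⁻¹) volume 0 R := by
      have h1 : IntervalIntegrable (fun r => r ^ (k + 2) * (u' r ^ 2 + u'' r ^ 2))
          volume 0 R := by
        refine hint.mono_set ?_
        rw [uIcc_of_le hR.1.le, uIcc_of_le zero_le_one]
        exact Icc_subset_Icc le_rfl hR1.2.le
      refine (h1.const_mul (G R ^ 2)⁻¹).mono_fun' (by fun_prop) ?_
      rw [uIoc_of_le hR.1.le]
      filter_upwards [ae_restrict_mem measurableSet_Ioc] with r hr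
      rw [Real.norm_of_nonneg (inv_nonneg.2 hr.1.le)]
      exact hbound r hr
    rcases intervalIntegrable_inv_iff.1 hinv with h | h
    · exact hR.1.ne h
    · exact h left_mem_uIcc
  have hzmono : MonotoneOn (fun r => r ^ (-a) * -u' r) (Ioo 0 ρ) := by
    have hd : ∀ r ∈ Ioo 0 ρ, HasDerivAt (fun r => r ^ (-a) * -u' r)
        (-a * r ^ (-a) / r * -u' r + r ^ (-a) * -u'' r) r := fun r hr =>
      (hw (-a) r hr).mul (hu' r (hsub r hr)).neg
    refine monotoneOn_of_hasDerivWithinAt_nonneg (convex_Ioo 0 ρ)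
      (fun r hr => (hd r hr).continuousAt.continuousWithinAt)
      (fun r hr => (hd r (interior_subset hr)).hasDerivWithinAt) fun r hr => ?_
    have hr' := interior_subset hr
    have h0 := hr'.1
    have hw0 : 0 < r ^ a := Real.rpow_pos_of_pos h0 a
    have hz0 : 0 < r ^ (-a) := Real.rpow_pos_of_pos h0 (-a)
    have hGr : 0 ≤ a * (r ^ (k + 1) * u' r) - r ^ (k + 2) * u'' r :=
      nonneg_of_mul_nonneg_right (hGnonneg r hr') hw0
    have heq : -a * r ^ (-a) / r * -u' r + r ^ (-a) * -u'' r =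
        r ^ (-a) / r ^ (k + 2) * (a * (r ^ (k + 1) * u' r) - r ^ (k + 2) * u'' r) := by
      field_simp
      ring
    rw [heq]
    positivity
  set R := ρ / 2 with hRdef
  have hR : R ∈ Ioo 0 ρ := ⟨by positivity, by linarith⟩
  set C := R ^ (-a) * -u' R with hC
  have hu'le : ∀ r ∈ Ioc 0 R, 0 ≤ u' r + C * (r ^ ε / r) := by
    intro r hr
    have h := hzmono ⟨hr.1, hr.2.trans_lt hR.2⟩ hR hr.2
    have h0 := hr.1
    have hw0 : 0 < r ^ a := Real.rpow_pos_of_pos h0 a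
    have h2 := mul_le_mul_of_nonneg_left h hw0.le
    simp only [← mul_assoc, ← Real.rpow_add h0, add_neg_cancel, Real.rpow_zero] at h2
    rw [← Real.rpow_sub_one h0.ne', ← ha]
    have h3 : r ^ a * R ^ (-a) * -u' R = C * r ^ a := by rw [hC]; ring
    rw [h3] at h2
    linarith
  have humono : MonotoneOn (fun r => u r + C / ε * r ^ ε) (Ioc 0 R) := by
    have hd : ∀ r ∈ Ioc 0 R, HasDerivAt (fun r => u r + C / ε * r ^ ε)
        (u' r + C * (r ^ ε / r)) r := fun r hr => by
      have hrρ : r ∈ Ioo 0 ρ := ⟨hr.1, hr.2.trans_lt hR.2⟩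
      refine ((hu r (hsub r hrρ)).add ((hw ε r hrρ).const_mul (C / ε))).congr_deriv ?_
      field_simp
    exact monotoneOn_of_hasDerivWithinAt_nonneg (convex_Ioc 0 R)
      (fun r hr => (hd r hr).continuousAt.continuousWithinAt)
      (fun r hr => (hd r (interior_subset hr)).hasDerivWithinAt)
      fun r hr => hu'le r (interior_subset hr)
  have hC0 : 0 ≤ C := mul_nonneg (Real.rpow_nonneg hR.1.le _) (by
    linarith [hneg R (hsub R hR)])
  have hRmem : ∀ᶠ r in nhdsWithin 0 (Ioi 0), r ∈ Ioc 0 R := Ioc_mem_nhdsGT hR.1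
  obtain ⟨r, hr, hrlarge⟩ :=
    (hRmem.and (hlim.eventually_gt_atTop (u R + C / ε * R ^ ε))).exists
  have h1 := humono hr ⟨hR.1, le_rfl⟩ hr.2
  have h2 : 0 ≤ C / ε * r ^ ε := mul_nonneg (by positivity) (Real.rpow_nonneg hr.1.le _)
  simp only at h1
  linarith

theorem stmt2 (N : ℕ) (hN : 10 ≤ N) (lam : ℝ) (hlam : 0 < lam)
    (f u u' u'' u''' : ℝ → ℝ) (hf : StarCond f)
    (hud1 : ∀ r ∈ Set.Ioc (0:ℝ) 1, HasDerivWithinAt u (u' r) (Set.Ioc 0 1) r)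
    (hud2 : ∀ r ∈ Set.Ioc (0:ℝ) 1, HasDerivWithinAt u' (u'' r) (Set.Ioc 0 1) r)
    (hud3 : ∀ r ∈ Set.Ioc (0:ℝ) 1, HasDerivWithinAt u'' (u''' r) (Set.Ioc 0 1) r)
    (hud4 : ContinuousOn u''' (Set.Ioc 0 1))
    (hu'neg : ∀ r ∈ Set.Ioc (0:ℝ) 1, u' r < 0)
    (hu1 : u 1 = 0)
    (hublow : Tendsto u (nhdsWithin 0 (Set.Ioi 0)) atTop)
    (hpde : ∀ r ∈ Set.Ioc (0:ℝ) 1,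
      -u'' r - ((N:ℝ) - 1) / r * u' r = lam * f (u r))
    (hint : IntervalIntegrable (fun r => r ^ (N - 1) * (u' r ^ 2 + u'' r ^ 2)) volume 0 1)
    (hstab : RadialStability N (fun r => lam * derivWithin f (Set.Ici 0) (u r)))
    (lam1 : ℝ) (hlam1 : 0 < lam1)
    (φ φ' φ'' : ℝ → ℝ)
    (hφd1 : ∀ r ∈ Set.Icc (0:ℝ) 1, HasDerivWithinAt φ (φ' r) (Set.Icc 0 1) r)
    (hφd2 : ∀ r ∈ Set.Icc (0:ℝ) 1, HasDerivWithinAt φ' (φ'' r) (Set.Icc 0 1) r)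
    (hφc : ContinuousOn φ'' (Set.Icc 0 1))
    (hφpos : ∀ r ∈ Set.Ico (0:ℝ) 1, 0 < φ r)
    (hφ1 : φ 1 = 0) (hφ'0 : φ' 0 = 0)
    (heig : ∀ r ∈ Set.Ioo (0:ℝ) 1, -φ'' r - ((N:ℝ) - 1) / r * φ' r = lam1 * φ r) :
    2 * ((N:ℝ) - 2) ≤
        Filter.limsup (fun r => r ^ 2 * (lam * derivWithin f (Set.Ici 0) (u r)))
          (nhdsWithin 0 (Set.Ioi 0)) ∧
      Filter.limsup (fun r => r ^ 2 * (lam * derivWithin f (Set.Ici 0) (u r)))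
          (nhdsWithin 0 (Set.Ioi 0)) ≤ lam1 := by
  obtain ⟨hfC, hfmono, hfconv, -, -⟩ := hf
  have hfd : DifferentiableOn ℝ f (Ici 0) := hfC.differentiableOn one_ne_zero
  have hmem : ∀ r ∈ Ioo (0 : ℝ) 1, r ∈ Ioc (0 : ℝ) 1 := fun r hr => Ioo_subset_Ioc_self hr
  have hnhds : ∀ r ∈ Ioo (0 : ℝ) 1, Ioc (0 : ℝ) 1 ∈ nhds r := fun r hr =>
    Filter.mem_of_superset (Ioo_mem_nhds hr.1 hr.2) Ioo_subset_Ioc_self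
  have hu : ∀ r ∈ Ioo (0 : ℝ) 1, HasDerivAt u (u' r) r := fun r hr =>
    (hud1 r (hmem r hr)).hasDerivAt (hnhds r hr)
  have hu' : ∀ r ∈ Ioo (0 : ℝ) 1, HasDerivAt u' (u'' r) r := fun r hr =>
    (hud2 r (hmem r hr)).hasDerivAt (hnhds r hr)
  have hu'' : ∀ r ∈ Ioo (0 : ℝ) 1, HasDerivAt u'' (u''' r) r := fun r hr =>
    (hud3 r (hmem r hr)).hasDerivAt (hnhds r hr)
  have hucont : ContinuousOn u (Ioc 0 1) := fun r hr => (hud1 r hr).continuousWithinAt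
  have huanti : AntitoneOn u (Ioc 0 1) :=
    antitoneOn_of_hasDerivWithinAt_nonpos (convex_Ioc 0 1) hucont
      (fun r hr => (hud1 r (interior_subset hr)).mono interior_subset)
      fun r hr => (hu'neg r (interior_subset hr)).le
  have hmaps : MapsTo u (Ioc 0 1) (Ici 0) := fun r hr => by
    have := huanti hr ⟨one_pos, le_rfl⟩ hr.2
    rwa [hu1] at this
  set Ψ : ℝ → ℝ := fun r => lam * derivWithin f (Ici 0) (u r) with hΨ
  have hΨcont : ContinuousOn Ψ (Ioc 0 1) := continuousOn_const.mul
    ((hfC.continuousOn_derivWithin (uniqueDiffOn_Ici 0) le_rfl).comp hucont hmaps)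
  have hΨanti : AntitoneOn Ψ (Ioc 0 1) := fun r hr s hs hrs =>
    mul_le_mul_of_nonneg_left
      (hfconv.monotoneOn_derivWithin hfd (hmaps hs) (hmaps hr) (huanti hr hs hrs)) hlam.le
  have hΨnonneg : ∀ r, 0 ≤ Ψ r := fun r => mul_nonneg hlam.le hfmono.derivWithin_nonneg
  have hIoc : Ioc (0 : ℝ) 1 ∈ nhdsWithin 0 (Ioi 0) := Ioc_mem_nhdsGT one_pos
  have hle : ∀ᶠ r in nhdsWithin 0 (Ioi 0), r ^ 2 * Ψ r ≤ lam1 := by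
    filter_upwards [hIoc] with r hr
    obtain ⟨k, rfl⟩ : ∃ k, N = k + 2 := ⟨N - 2, by omega⟩
    refine hstab.sq_mul_le_eigenvalue (by omega) hΨcont hΨanti (fun r _ => hΨnonneg r) hφd1 hφd2
      hφpos hφ1 (fun s hs => ?_) hr
    rw [← heig s hs]
    push_cast
    ring
  refine ⟨?_, Filter.limsup_le_of_le (Filter.isCoboundedUnder_le_of_eventually_le _ (x := 0)
    (Filter.Eventually.of_forall fun r => mul_nonneg (sq_nonneg r) (hΨnonneg r))) hle⟩
  by_contra! hlt
  obtain ⟨c, hc1, hc2⟩ := exists_between hlt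
  have hev := Filter.eventually_lt_of_limsup_lt hc1 ⟨lam1, hle⟩
  obtain ⟨k, rfl⟩ : ∃ k, N = k + 3 := ⟨N - 3, by omega⟩
  push_cast at hc2 hpde
  refine not_tendsto_atTop_of_sq_mul_le (k := k) (by omega) (by linarith) hu hu' hu''
    (fun r hr => hu'neg r (hmem r hr)) (fun r hr => ?_) hint (hev.mono fun r hr => hr.le) hublow
  have hr0 := hr.1.ne'
  have hfu : HasDerivAt (fun s => lam * f (u s)) (Ψ r * u' r) r := by
    have h := ((hfd _ (hmaps (hmem r hr))).hasDerivWithinAt.comp r (hud1 r (hmem r hr))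
      hmaps).hasDerivAt (hnhds r hr)
    exact (h.const_mul lam).congr_deriv (by simp only [hΨ]; ring)
  have hlhs : HasDerivAt (fun s => -u'' s - ((k : ℝ) + 2) * s⁻¹ * u' s)
      (-u''' r - (((k : ℝ) + 2) * (-(r ^ 2)⁻¹) * u' r + ((k : ℝ) + 2) * r⁻¹ * u'' r)) r :=
    (hu'' r hr).neg.sub (((hasDerivAt_inv hr0).const_mul _).mul (hu' r hr))
  have heq : (fun s => -u'' s - ((k : ℝ) + 2) * s⁻¹ * u' s) =ᶠ[nhds r]
      fun s => lam * f (u s) := by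
    filter_upwards [hnhds r hr] with s hs
    rw [← hpde s hs]
    ring
  have hder := hlhs.unique (hfu.congr_of_eventuallyEq heq)
  have hmul : (k + 2 - r ^ 2 * Ψ r) * u' r = (k + 2) * u' r - r ^ 2 * (Ψ r * u' r) := by ring
  rw [hmul, ← hder]
  field_simp
  ring
end

section
/- Let N ≥ 3 be an integer and let Ψ : (0,1] → ℝ be measurable with |Ψ(r)|·r² ≤ C for some constant C > 0 and all r ∈ (0,1], and suppose Ψ satisfies the radial stability inequality in dimension N. Then there exists a radial solution ω of the linear problem (P_Ψ). -/
open MeasureTheory Filter Set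

/-- `ω`, with derivative `ω'` on `(0,1]`, is a radial solution of the linear
problem `(P_Ψ)`: it is `C¹` on `(0,1]`, `ω 1 = 1`,
`∫₀¹ r^(N-1) (ω² + ω'²) < ∞`, and the weak formulation of
`Δω + (Ψ - (N-1)/r²) ω = 0` holds against all Lipschitz test functions
vanishing at `1`. -/
def IsRadialSolution (N : ℕ) (Ψ ω ω' : ℝ → ℝ) : Prop :=
  (∀ r ∈ Set.Ioc (0:ℝ) 1, HasDerivWithinAt ω (ω' r) (Set.Ioc 0 1) r) ∧
  ContinuousOn ω' (Set.Ioc 0 1) ∧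
  ω 1 = 1 ∧
  IntervalIntegrable (fun r => r ^ (N - 1) * (ω r ^ 2 + ω' r ^ 2)) volume 0 1 ∧
  ∀ v : ℝ → ℝ, (∃ K : NNReal, LipschitzOnWith K v (Set.Icc 0 1)) → v 1 = 0 →
    (∫ r in (0:ℝ)..1, r ^ (N - 1) * ω' r * deriv v r) =
      ∫ r in (0:ℝ)..1, r ^ (N - 1) * (Ψ r - ((N:ℝ) - 1) / r ^ 2) * ω r * v r

/-- **Lax–Milgram on a dense subspace.** If the bilinear form
`(x, y) ↦ ⟪x.fst, y.fst⟫ - ⟪M x.snd, y.snd⟫` is coercive on a subspace `V`, then the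
corresponding variational problem is solvable in the closure of `V`. -/
theorem exists_mem_topologicalClosure_inner_sub_inner_eq {H : Type*} [NormedAddCommGroup H]
    [InnerProductSpace ℝ H] [CompleteSpace H] (M : H →L[ℝ] H)
    (V : Submodule ℝ (WithLp 2 (H × H))) {c : ℝ} (hc : 0 < c)
    (hV : ∀ x ∈ V, c * (‖x.fst‖ ^ 2 + ‖x.snd‖ ^ 2) ≤ ‖x.fst‖ ^ 2 - inner ℝ (M x.snd) x.snd)
    (b : H) :
    ∃ x ∈ V.topologicalClosure, ∀ y ∈ V,
      inner ℝ x.fst y.fst - inner ℝ (M x.snd) y.snd = inner ℝ b y.snd := by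
  let P₁ : WithLp 2 (H × H) →L[ℝ] H := WithLp.fstL 2 ℝ H H
  let P₂ : WithLp 2 (H × H) →L[ℝ] H := WithLp.sndL 2 ℝ H H
  let B : WithLp 2 (H × H) →L[ℝ] WithLp 2 (H × H) →L[ℝ] ℝ :=
    (innerSL ℝ).bilinearComp P₁ P₁ - (innerSL ℝ).bilinearComp (M ∘L P₂) P₂
  have hB : ∀ x y, B x y = inner ℝ x.fst y.fst - inner ℝ (M x.snd) y.snd := fun x y ↦ rfl
  let W := V.topologicalClosure
  have : CompleteSpace W := V.isClosed_topologicalClosure.completeSpace_coe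
  let BW : W →L[ℝ] W →L[ℝ] ℝ := B.bilinearComp W.subtypeL W.subtypeL
  have hcl : ∀ x ∈ W, c * ‖x‖ ^ 2 ≤ B x x := by
    intro x hx
    have hclosed : IsClosed {x : WithLp 2 (H × H) | c * ‖x‖ ^ 2 ≤ B x x} :=
      isClosed_le (by fun_prop) (by fun_prop)
    refine closure_minimal (fun y hy ↦ ?_) hclosed hx
    rw [mem_ofPred_eq, hB, WithLp.prod_norm_sq_eq_of_L2, real_inner_self_eq_norm_sq]
    exact hV y hy
  have hcoer : IsCoercive BW := ⟨c, hc, fun u ↦ by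
    rw [mul_assoc, ← pow_two]; exact hcl u u.2⟩
  let ℓ : W →L[ℝ] ℝ := (innerSL ℝ b) ∘L P₂ ∘L W.subtypeL
  obtain ⟨u, hu⟩ := hcoer.continuousLinearEquivOfBilin.surjective
    ((InnerProductSpace.toDual ℝ W).symm ℓ)
  refine ⟨u, u.2, fun y hy ↦ ?_⟩
  have h := hcoer.continuousLinearEquivOfBilin_apply u ⟨y, V.le_topologicalClosure hy⟩
  rw [hu, InnerProductSpace.toDual_symm_apply] at h
  rw [← hB]
  exact h.symm

/-- The measure `r ^ k dr` on `(0, 1]`. -/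
noncomputable def powMeasure (k : ℕ) : Measure ℝ :=
  (volume.restrict (Ioc 0 1)).withDensity fun r ↦ ENNReal.ofReal (r ^ k)

theorem ae_powMeasure (k : ℕ) : ae (powMeasure k) = ae (volume.restrict (Ioc (0 : ℝ) 1)) := by
  have hm : Measurable fun r : ℝ ↦ ENNReal.ofReal (r ^ k) := by fun_prop
  refine le_antisymm (withDensity_absolutelyContinuous _ _).ae_le
    (withDensity_absolutelyContinuous' hm.aemeasurable ?_).ae_le
  filter_upwards [ae_restrict_mem measurableSet_Ioc] with r hr
  have := pow_pos hr.1 k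
  simpa using this

theorem ae_mem_powMeasure (k : ℕ) : ∀ᵐ r ∂powMeasure k, r ∈ Ioc (0 : ℝ) 1 := by
  rw [ae_powMeasure]
  exact ae_restrict_mem measurableSet_Ioc

theorem toReal_ofReal_pow_smul_ae_eq (k : ℕ) (f : ℝ → ℝ) :
    (fun r ↦ (ENNReal.ofReal (r ^ k)).toReal • f r) =ᵐ[volume.restrict (Ioc (0 : ℝ) 1)]
      fun r ↦ r ^ k * f r := by
  filter_upwards [ae_restrict_mem measurableSet_Ioc] with r hr
  rw [ENNReal.toReal_ofReal (pow_nonneg hr.1.le k), smul_eq_mul]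

theorem integral_powMeasure (k : ℕ) (f : ℝ → ℝ) :
    ∫ r, f r ∂powMeasure k = ∫ r in (0 : ℝ)..1, r ^ k * f r := by
  rw [powMeasure, integral_withDensity_eq_integral_toReal_smul (by fun_prop) (by simp),
    intervalIntegral.integral_of_le zero_le_one]
  exact integral_congr_ae (toReal_ofReal_pow_smul_ae_eq k f)

theorem integrable_powMeasure_iff (k : ℕ) (f : ℝ → ℝ) :
    Integrable f (powMeasure k) ↔ IntervalIntegrable (fun r ↦ r ^ k * f r) volume 0 1 := by
  rw [powMeasure, integrable_withDensity_iff_integrable_smul' (by fun_prop) (by simp),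
    intervalIntegrable_iff_integrableOn_Ioc_of_le zero_le_one, IntegrableOn]
  exact integrable_congr (toReal_ofReal_pow_smul_ae_eq k f)

instance (k : ℕ) : IsFiniteMeasure (powMeasure k) := by
  have h : Integrable (fun _ ↦ (1 : ℝ)) (powMeasure k) := by
    rw [integrable_powMeasure_iff]
    exact (by fun_prop : Continuous fun r : ℝ ↦ r ^ k * 1).intervalIntegrable _ _
  exact (integrable_const_iff.1 h).resolve_left one_ne_zero

/-- A bounded measurable function. -/
def IsBoundedMeasurable (φ : ℝ → ℝ) : Prop :=
  Measurable φ ∧ ∃ K, ∀ r, |φ r| ≤ K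

namespace IsBoundedMeasurable

variable {φ ψ : ℝ → ℝ}

theorem intervalIntegrable (hφ : IsBoundedMeasurable φ) (a b : ℝ) :
    IntervalIntegrable φ volume a b := by
  obtain ⟨hm, K, hK⟩ := hφ
  exact (intervalIntegrable_const (c := K)).mono_fun' hm.aestronglyMeasurable
    (Eventually.of_forall hK)

theorem lipschitzWith_integral (hφ : IsBoundedMeasurable φ) :
    ∃ K, LipschitzWith K fun r ↦ ∫ s in (1 : ℝ)..r, φ s := by
  obtain ⟨K, hK⟩ := hφ.2
  refine ⟨K.toNNReal, LipschitzWith.of_dist_le_mul fun x y ↦ ?_⟩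
  rw [Real.dist_eq, Real.dist_eq,
    intervalIntegral.integral_interval_sub_left (hφ.intervalIntegrable _ _)
      (hφ.intervalIntegrable _ _), Real.coe_toNNReal K ((abs_nonneg _).trans (hK 0))]
  exact intervalIntegral.norm_integral_le_of_norm_le_const (f := φ) (C := K) fun r _ ↦ hK r

theorem ae_deriv_integral (hφ : IsBoundedMeasurable φ) :
    ∀ᵐ r, deriv (fun r ↦ ∫ s in (1 : ℝ)..r, φ s) r = φ r := by
  have hloc : LocallyIntegrable φ volume := by
    obtain ⟨hm, K, hK⟩ := hφ
    exact (locallyIntegrable_const K).mono hm.aestronglyMeasurable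
      (Eventually.of_forall fun r ↦ (hK r).trans (le_abs_self K))
  filter_upwards [_root_.LocallyIntegrable.ae_hasDerivAt_integral hloc] with r hr using (hr 1).deriv

theorem memLp_id_mul (hφ : IsBoundedMeasurable φ) (k : ℕ) :
    MemLp (fun r ↦ r * φ r) 2 (powMeasure k) := by
  obtain ⟨hm, K, hK⟩ := hφ
  refine MemLp.of_bound (measurable_id.mul hm).aestronglyMeasurable K ?_
  filter_upwards [ae_mem_powMeasure k] with r hr
  rw [Real.norm_eq_abs, abs_mul, abs_of_pos hr.1]
  exact (mul_le_of_le_one_left (abs_nonneg _) hr.2).trans (hK r)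

theorem memLp_integral (hφ : IsBoundedMeasurable φ) (k : ℕ) :
    MemLp (fun r ↦ ∫ s in (1 : ℝ)..r, φ s) 2 (powMeasure k) := by
  obtain ⟨K, hK⟩ := hφ.lipschitzWith_integral
  refine MemLp.of_bound hK.continuous.aestronglyMeasurable K ?_
  filter_upwards [ae_mem_powMeasure k] with r hr
  have h := hK.dist_le_mul r 1
  simp only [intervalIntegral.integral_same, dist_zero_right] at h
  refine h.trans (mul_le_of_le_one_right K.2 ?_)
  rw [Real.dist_eq, abs_le]
  constructor <;> linarith [hr.1, hr.2]

theorem add (hφ : IsBoundedMeasurable φ) (hψ : IsBoundedMeasurable ψ) :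
    IsBoundedMeasurable (φ + ψ) := by
  obtain ⟨hm, K, hK⟩ := hφ
  obtain ⟨hm', L, hL⟩ := hψ
  exact ⟨hm.add hm', K + L, fun r ↦ (abs_add_le _ _).trans (add_le_add (hK r) (hL r))⟩

theorem const_mul (hφ : IsBoundedMeasurable φ) (a : ℝ) :
    IsBoundedMeasurable fun r ↦ a * φ r := by
  obtain ⟨hm, K, hK⟩ := hφ
  refine ⟨hm.const_mul a, |a| * K, fun r ↦ ?_⟩
  rw [abs_mul]
  exact mul_le_mul_of_nonneg_left (hK r) (abs_nonneg a)

end IsBoundedMeasurable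

/-- The pairs `(r u', u)` in `L²(r ^ k dr)`, where `u` is Lipschitz and vanishes at `1`. -/
noncomputable def lipschitzPairs (k : ℕ) :
    Submodule ℝ (WithLp 2 (Lp ℝ 2 (powMeasure k) × Lp ℝ 2 (powMeasure k))) where
  carrier := {x | ∃ φ, IsBoundedMeasurable φ ∧ x.fst =ᵐ[powMeasure k] (fun r ↦ r * φ r) ∧
    x.snd =ᵐ[powMeasure k] fun r ↦ ∫ s in (1 : ℝ)..r, φ s}
  zero_mem' := by
    refine ⟨fun _ ↦ 0, ⟨measurable_const, 0, by simp⟩, ?_, ?_⟩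
    · simpa using! Lp.coeFn_zero ℝ 2 (powMeasure k)
    · simpa using! Lp.coeFn_zero ℝ 2 (powMeasure k)
  add_mem' := by
    rintro x y ⟨φ, hφ, hx, hx'⟩ ⟨ψ, hψ, hy, hy'⟩
    refine ⟨φ + ψ, hφ.add hψ, ?_, ?_⟩
    · filter_upwards [hx, hy, Lp.coeFn_add x.fst y.fst] with r h h' h''
      rw [WithLp.add_fst, h'', Pi.add_apply, Pi.add_apply, h, h', mul_add]
    · filter_upwards [hx', hy', Lp.coeFn_add x.snd y.snd] with r h h' h''
      rw [WithLp.add_snd, h'', Pi.add_apply, h, h']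
      exact (intervalIntegral.integral_add (hφ.intervalIntegrable _ _)
        (hψ.intervalIntegrable _ _)).symm
  smul_mem' := by
    rintro a x ⟨φ, hφ, hx, hx'⟩
    refine ⟨_, hφ.const_mul a, ?_, ?_⟩
    · filter_upwards [hx, Lp.coeFn_smul a x.fst] with r h h'
      rw [WithLp.smul_fst, h', Pi.smul_apply, h, smul_eq_mul, mul_left_comm]
    · filter_upwards [hx', Lp.coeFn_smul a x.snd] with r h h'
      rw [WithLp.smul_snd, h', Pi.smul_apply, h, smul_eq_mul, intervalIntegral.integral_const_mul]

theorem RadialStability.integral_powMeasure_le {k : ℕ} {Ψ φ : ℝ → ℝ}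
    (hstab : RadialStability (k + 3) Ψ) (hφ : IsBoundedMeasurable φ) :
    ∫ r, r ^ 2 * Ψ r * (∫ s in (1 : ℝ)..r, φ s) ^ 2 ∂powMeasure k ≤
      ∫ r, (r * φ r) ^ 2 ∂powMeasure k := by
  obtain ⟨K, hK⟩ := hφ.lipschitzWith_integral
  have h := hstab _ ⟨K, hK.lipschitzOnWith⟩ intervalIntegral.integral_same
  rw [integral_powMeasure, integral_powMeasure]
  convert h using 1
  · congr! 2 with r
    rw [show k + 3 - 1 = k + 2 by lia]
    ring
  · refine intervalIntegral.integral_congr_ae ?_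
    filter_upwards [hφ.ae_deriv_integral] with r hr _
    rw [hr, show k + 3 - 1 = k + 2 by lia]
    ring

theorem RadialStability.coercive {k : ℕ} {Ψ φ : ℝ → ℝ} (hmeas : Measurable Ψ) {C : ℝ} (hC : 0 < C)
    (hbd : ∀ r ∈ Ioc (0 : ℝ) 1, |Ψ r| * r ^ 2 ≤ C)
    (hstab : RadialStability (k + 3) Ψ) (hφ : IsBoundedMeasurable φ) :
    (1 + C)⁻¹ * (∫ r, (r * φ r) ^ 2 ∂powMeasure k +
        ∫ r, (∫ s in (1 : ℝ)..r, φ s) ^ 2 ∂powMeasure k) ≤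
      ∫ r, (r * φ r) ^ 2 ∂powMeasure k -
        ∫ r, (r ^ 2 * Ψ r - (k + 2)) * (∫ s in (1 : ℝ)..r, φ s) ^ 2 ∂powMeasure k := by
  have hst := hstab.integral_powMeasure_le hφ
  have hu : Integrable (fun r ↦ (∫ s in (1 : ℝ)..r, φ s) ^ 2) (powMeasure k) :=
    (hφ.memLp_integral k).integrable_sq
  have hbound : ∀ᵐ r ∂powMeasure k, |r ^ 2 * Ψ r| ≤ C := by
    filter_upwards [ae_mem_powMeasure k] with r hr
    rw [abs_mul, abs_of_nonneg (sq_nonneg r), mul_comm]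
    exact hbd r hr
  have hΨ : Integrable (fun r ↦ r ^ 2 * Ψ r * (∫ s in (1 : ℝ)..r, φ s) ^ 2) (powMeasure k) :=
    hu.bdd_mul (by fun_prop) hbound
  have hle : ∫ r, r ^ 2 * Ψ r * (∫ s in (1 : ℝ)..r, φ s) ^ 2 ∂powMeasure k ≤
      C * ∫ r, (∫ s in (1 : ℝ)..r, φ s) ^ 2 ∂powMeasure k := by
    rw [← integral_const_mul]
    refine integral_mono_ae hΨ (hu.const_mul C) ?_
    filter_upwards [hbound] with r hr
    exact mul_le_mul_of_nonneg_right ((le_abs_self _).trans hr) (sq_nonneg _)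
  have hE : 0 ≤ ∫ r, (∫ s in (1 : ℝ)..r, φ s) ^ 2 ∂powMeasure k :=
    integral_nonneg fun r ↦ sq_nonneg _
  simp only [sub_mul]
  rw [integral_sub hΨ (hu.const_mul _), integral_const_mul, inv_mul_le_iff₀ (by linarith)]
  nlinarith [mul_nonneg hC.le (sub_nonneg.2 hst), mul_nonneg (Nat.cast_nonneg (α := ℝ) k) hE,
    mul_nonneg (mul_nonneg hC.le (Nat.cast_nonneg (α := ℝ) k)) hE, mul_nonneg hC.le hE]

theorem exists_integral_div_eq_neg_inner (k : ℕ) {r : ℝ} (hr : r ∈ Ioc (0 : ℝ) 1) :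
    ∃ h : Lp ℝ 2 (powMeasure k), ∀ F : Lp ℝ 2 (powMeasure k),
      ∫ s in (1 : ℝ)..r, F s / s = -inner ℝ h F := by
  let h : ℝ → ℝ := (Ioc r 1).indicator fun s ↦ (s ^ (k + 1))⁻¹
  have hh : MemLp h 2 (powMeasure k) := by
    refine MemLp.of_bound (Measurable.indicator (by fun_prop)
      measurableSet_Ioc).aestronglyMeasurable (r ^ (k + 1))⁻¹ (Eventually.of_forall fun s ↦ ?_)
    have hr0 := hr.1
    by_cases hs : s ∈ Ioc r 1
    · have : 0 < s := hr.1.trans hs.1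
      simp only [h, indicator_of_mem hs]
      rw [Real.norm_eq_abs, abs_of_pos (by positivity)]
      exact inv_anti₀ (by positivity) (pow_le_pow_left₀ hr.1.le hs.1.le _)
    · simp only [h, indicator_of_notMem hs, norm_zero]
      positivity
  refine ⟨hh.toLp h, fun F ↦ ?_⟩
  rw [L2.inner_def, intervalIntegral.integral_symm, neg_inj]
  have hcongr : ∫ s, inner ℝ (hh.toLp h s) (F s) ∂powMeasure k = ∫ s, h s * F s ∂powMeasure k := by
    refine integral_congr_ae ?_
    filter_upwards [hh.coeFn_toLp] with s hs
    rw [hs, RCLike.inner_apply, conj_trivial, mul_comm]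
  rw [hcongr, integral_powMeasure, intervalIntegral.integral_of_le hr.2,
    intervalIntegral.integral_of_le zero_le_one,
    show Ioc r 1 = Ioc 0 1 ∩ Ioc r 1 from
      (inter_eq_right.2 (Ioc_subset_Ioc_left hr.1.le)).symm,
    ← setIntegral_indicator measurableSet_Ioc]
  refine setIntegral_congr_fun measurableSet_Ioc fun s hs ↦ ?_
  have hs0 : s ≠ 0 := hs.1.ne'
  by_cases hsr : s ∈ Ioc r 1
  · simp only [h, indicator_of_mem hsr]
    field_simp
    ring
  · simp only [h, indicator_of_notMem hsr]
    ring

theorem snd_ae_eq_integral_of_mem_closure {k : ℕ}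
    {x : WithLp 2 (Lp ℝ 2 (powMeasure k) × Lp ℝ 2 (powMeasure k))}
    (hx : x ∈ (lipschitzPairs k).topologicalClosure) :
    ∀ᵐ r ∂powMeasure k, x.snd r = ∫ s in (1 : ℝ)..r, x.fst s / s := by
  obtain ⟨y, hy, hyx⟩ := mem_closure_iff_seq_limit.1 hx
  choose φ hφ hfst hsnd using hy
  have hlim₁ : Tendsto (fun n ↦ (y n).fst) atTop (nhds x.fst) :=
    ((WithLp.fstL 2 ℝ _ _).continuous.tendsto x).comp hyx
  have hlim₂ : Tendsto (fun n ↦ (y n).snd) atTop (nhds x.snd) :=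
    ((WithLp.sndL 2 ℝ _ _).continuous.tendsto x).comp hyx
  obtain ⟨ns, hns, hae⟩ := (tendstoInMeasure_of_tendsto_Lp hlim₂).exists_seq_tendsto_ae
  filter_upwards [hae, ae_all_iff.2 hsnd, ae_mem_powMeasure k] with r hr hsr hr01
  obtain ⟨h, hh⟩ := exists_integral_div_eq_neg_inner k hr01
  refine tendsto_nhds_unique hr ?_
  have hyr : ∀ n, (y n).snd r = -inner ℝ h (y n).fst := by
    intro n
    rw [← hh, hsr n]
    refine intervalIntegral.integral_congr_ae ?_
    have := hfst n
    rw [EventuallyEq, ae_powMeasure, ae_restrict_iff' measurableSet_Ioc] at this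
    filter_upwards [this] with s hs hsr
    rw [uIoc_of_ge hr01.2] at hsr
    have hs0 : 0 < s := hr01.1.trans hsr.1
    rw [hs ⟨hs0, hsr.2⟩]
    field_simp
  simp only [hyr, hh]
  exact (((tendsto_const_nhds.inner (𝕜 := ℝ) hlim₁).neg).comp hns.tendsto_atTop)

theorem exists_weak_solution (k : ℕ) {m : ℝ → ℝ} (hm : MemLp m ⊤ (powMeasure k)) {c : ℝ}
    (hc : 0 < c) (hcoer : ∀ φ, IsBoundedMeasurable φ →
      c * (∫ r, (r * φ r) ^ 2 ∂powMeasure k +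
          ∫ r, (∫ s in (1 : ℝ)..r, φ s) ^ 2 ∂powMeasure k) ≤
        ∫ r, (r * φ r) ^ 2 ∂powMeasure k -
          ∫ r, m r * (∫ s in (1 : ℝ)..r, φ s) ^ 2 ∂powMeasure k) :
    ∃ F W : ℝ → ℝ, MemLp F 2 (powMeasure k) ∧ MemLp W 2 (powMeasure k) ∧
      (∀ᵐ r ∂powMeasure k, W r = 1 + ∫ s in (1 : ℝ)..r, F s / s) ∧
      ∀ φ, IsBoundedMeasurable φ → ∫ r, F r * (r * φ r) ∂powMeasure k =
        ∫ r, m r * W r * (∫ s in (1 : ℝ)..r, φ s) ∂powMeasure k := by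
  have hinner : ∀ (f g : Lp ℝ 2 (powMeasure k)) {f' g' : ℝ → ℝ}, f =ᵐ[powMeasure k] f' →
      g =ᵐ[powMeasure k] g' → inner ℝ f g = ∫ r, f' r * g' r ∂powMeasure k := by
    intro f g f' g' hf hg
    rw [L2.inner_def]
    refine integral_congr_ae ?_
    filter_upwards [hf, hg] with r h h'
    rw [h, h', RCLike.inner_apply, conj_trivial, mul_comm]
  let M : Lp ℝ 2 (powMeasure k) →L[ℝ] Lp ℝ 2 (powMeasure k) :=
    (ContinuousLinearMap.mul ℝ ℝ).holderL (powMeasure k) ⊤ 2 2 (hm.toLp m)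
  have hM : ∀ (g : Lp ℝ 2 (powMeasure k)) {g' : ℝ → ℝ}, g =ᵐ[powMeasure k] g' →
      M g =ᵐ[powMeasure k] fun r ↦ m r * g' r := by
    intro g g' hg
    filter_upwards [(ContinuousLinearMap.mul ℝ ℝ).coeFn_holder (r := 2) (hm.toLp m) g,
      hm.coeFn_toLp, hg] with r h h' h''
    rw [ContinuousLinearMap.holderL_apply_apply, h, h', h'']
    rfl
  have hm2 : MemLp m 2 (powMeasure k) := hm.mono_exponent le_top
  obtain ⟨x, hx, hxy⟩ := exists_mem_topologicalClosure_inner_sub_inner_eq M (lipschitzPairs k) hc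
    (fun x ⟨φ, hφ, h₁, h₂⟩ ↦ by
      rw [← real_inner_self_eq_norm_sq, ← real_inner_self_eq_norm_sq, hinner _ _ h₁ h₁,
        hinner _ _ h₂ h₂, hinner _ _ (hM _ h₂) h₂]
      simpa only [pow_two, mul_assoc] using hcoer φ hφ) (hm2.toLp m)
  have hW : MemLp (fun r ↦ 1 + x.snd r) 2 (powMeasure k) :=
    (memLp_const (1 : ℝ)).add (Lp.memLp x.snd)
  refine ⟨x.fst, fun r ↦ 1 + x.snd r, Lp.memLp _, hW, ?_, fun φ hφ ↦ ?_⟩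
  · filter_upwards [snd_ae_eq_integral_of_mem_closure hx] with r hr
    rw [hr]
  have hF := hφ.memLp_id_mul k
  have hG := hφ.memLp_integral k
  have h : inner ℝ x.fst (hF.toLp _) - inner ℝ (M x.snd) (hG.toLp _) =
      inner ℝ (hm2.toLp m) (hG.toLp _) :=
    hxy (WithLp.toLp 2 (hF.toLp _, hG.toLp _)) ⟨φ, hφ, hF.coeFn_toLp, hG.coeFn_toLp⟩
  have hMG : MemLp (fun r ↦ m r * x.snd r) 2 (powMeasure k) :=
    (memLp_congr_ae (hM _ ae_eq_rfl)).1 (Lp.memLp (M x.snd))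
  rw [hinner _ _ ae_eq_rfl hF.coeFn_toLp, hinner _ _ (hM _ ae_eq_rfl) hG.coeFn_toLp,
    hinner _ _ hm2.coeFn_toLp hG.coeFn_toLp, sub_eq_iff_eq_add] at h
  have hadd := integral_add (hm2.integrable_mul hG) (hMG.integrable_mul hG)
  simp only [Pi.mul_apply] at hadd
  rw [h, ← hadd]
  refine integral_congr_ae (Eventually.of_forall fun r ↦ ?_)
  simp only
  ring

theorem integral_primitive_mul_eq_neg {g φ : ℝ → ℝ} (hg : IntervalIntegrable g volume 0 1)
    (hφ : IsBoundedMeasurable φ) :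
    ∫ r in (0 : ℝ)..1, (∫ s in (0 : ℝ)..r, g s) * φ r =
      -∫ r in (0 : ℝ)..1, g r * ∫ s in (1 : ℝ)..r, φ s := by
  have h := (hg.absolutelyContinuousOnInterval_intervalIntegral
    (c := 0) (by simp)).integral_mul_deriv_eq_deriv_mul
    ((hφ.intervalIntegrable 0 1).absolutelyContinuousOnInterval_intervalIntegral
      (c := 1) (by simp))
  simp only [intervalIntegral.integral_same, mul_zero, zero_mul, sub_zero, zero_sub] at h
  convert h using 1
  · refine intervalIntegral.integral_congr_ae ?_
    filter_upwards [hφ.ae_deriv_integral] with r hr _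
    rw [hr]
  · rw [neg_inj]
    refine intervalIntegral.integral_congr_ae ?_
    filter_upwards [hg.ae_hasDerivAt_integral] with r hr hr'
    rw [(hr (uIoc_subset_uIcc hr') 0 (by simp)).deriv]

theorem exists_isBoundedMeasurable_of_lipschitzOnWith {v : ℝ → ℝ} {K : NNReal}
    (hv : LipschitzOnWith K v (Icc 0 1)) (hv1 : v 1 = 0) :
    ∃ φ, IsBoundedMeasurable φ ∧ (∀ᵐ r ∂volume.restrict (Ioc (0 : ℝ) 1), φ r = deriv v r) ∧
      ∀ r ∈ Icc (0 : ℝ) 1, v r = ∫ s in (1 : ℝ)..r, φ s := by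
  have hae : ∀ᵐ r, r ∈ Ioc (0 : ℝ) 1 → (Ioo (0 : ℝ) 1).indicator (deriv v) r = deriv v r := by
    filter_upwards [(Ioo_ae_eq_Ioc (μ := volume) (a := (0 : ℝ)) (b := 1)).mem_iff] with r hr hr'
    exact indicator_of_mem (hr.2 hr') _
  refine ⟨(Ioo 0 1).indicator (deriv v), ⟨(measurable_deriv v).indicator measurableSet_Ioo, K,
    fun r ↦ ?_⟩, (ae_restrict_iff' measurableSet_Ioc).2 hae, fun r hr ↦ ?_⟩
  · by_cases hr : r ∈ Ioo (0 : ℝ) 1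
    · rw [indicator_of_mem hr]
      exact norm_deriv_le_of_lipschitzOn (Icc_mem_nhds hr.1 hr.2) hv
    · rw [indicator_of_notMem hr, abs_zero]
      exact K.2
  · have hsub : uIcc 1 r ⊆ Icc (0 : ℝ) 1 := by
      rw [uIcc_of_ge hr.2]
      exact Icc_subset_Icc_left hr.1
    have h := (hv.mono hsub).absolutelyContinuousOnInterval.integral_deriv_eq_sub
    rw [hv1, sub_zero] at h
    rw [← h]
    refine intervalIntegral.integral_congr_ae ?_
    filter_upwards [hae] with s hs hs'
    rw [uIoc_of_ge hr.2] at hs'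
    exact (hs ⟨hr.1.trans_lt hs'.1, hs'.2⟩).symm

theorem exists_continuousOn_ae_eq_of_weak_solution {k : ℕ} {m F W : ℝ → ℝ}
    (hm : MemLp m ⊤ (powMeasure k)) (hF : MemLp F 2 (powMeasure k))
    (hW : MemLp W 2 (powMeasure k))
    (hweak : ∀ φ, IsBoundedMeasurable φ → ∫ r, F r * (r * φ r) ∂powMeasure k =
        ∫ r, m r * W r * (∫ s in (1 : ℝ)..r, φ s) ∂powMeasure k) :
    ∃ ω' : ℝ → ℝ, ContinuousOn ω' (Ioi 0) ∧ ∀ᵐ r ∂powMeasure k, F r = r * ω' r := by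
  have hmW : Integrable (fun r ↦ m r * W r) (powMeasure k) :=
    (hm.mono_exponent (p := 2) le_top).integrable_mul hW
  let g : ℝ → ℝ := (Ioc 0 1).indicator fun r ↦ r ^ k * (m r * W r)
  have hg : Integrable g := by
    rw [integrable_powMeasure_iff, intervalIntegrable_iff_integrableOn_Ioc_of_le zero_le_one]
      at hmW
    exact hmW.integrable_indicator measurableSet_Ioc
  have hcont : Continuous fun r ↦ ∫ s in (0 : ℝ)..r, g s :=
    intervalIntegral.continuous_primitive (fun _ _ ↦ hg.intervalIntegrable) 0
  refine ⟨fun r ↦ -(∫ s in (0 : ℝ)..r, g s) / r ^ (k + 2),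
    hcont.neg.continuousOn.div (by fun_prop) fun r hr ↦ pow_ne_zero _ (ne_of_gt hr), ?_⟩
  have hF1 : IntervalIntegrable (fun r ↦ r ^ k * F r) volume 0 1 :=
    (integrable_powMeasure_iff k F).1 (hF.integrable (by norm_num))
  have hF2 : IntervalIntegrable (fun r ↦ r ^ (k + 1) * F r) volume 0 1 := by
    convert hF1.continuousOn_mul (continuousOn_id) using 2 with r
    rw [id, pow_succ']
    ring
  have hW2 : IntervalIntegrable (fun r ↦ ∫ s in (0 : ℝ)..r, g s) volume 0 1 :=
    hcont.intervalIntegrable _ _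
  have hzero : (fun r ↦ r ^ (k + 1) * F r + ∫ s in (0 : ℝ)..r, g s)
      =ᵐ[volume.restrict (Ioc 0 1)] 0 := by
    have hint := hF2.add hW2
    rw [intervalIntegrable_iff_integrableOn_Ioc_of_le zero_le_one] at hint
    refine hint.ae_eq_zero_of_forall_setIntegral_eq_zero fun t ht _ ↦ ?_
    let φ : ℝ → ℝ := t.indicator 1
    have hφ : IsBoundedMeasurable φ := by
      refine ⟨measurable_one.indicator ht, 1, fun r ↦ ?_⟩
      by_cases hr : r ∈ t <;> simp [φ, hr]
    have h₁ := hweak φ hφ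
    have h₂ := integral_primitive_mul_eq_neg hg.intervalIntegrable hφ
    have h₃ : ∫ r in (0 : ℝ)..1, g r * ∫ s in (1 : ℝ)..r, φ s =
        ∫ r in (0 : ℝ)..1, r ^ k * (m r * W r * ∫ s in (1 : ℝ)..r, φ s) := by
      rw [intervalIntegral.integral_of_le zero_le_one, intervalIntegral.integral_of_le zero_le_one]
      refine setIntegral_congr_fun measurableSet_Ioc fun r hr ↦ ?_
      simp only [g, indicator_of_mem hr]
      ring
    rw [integral_powMeasure, integral_powMeasure, ← h₃, ← neg_eq_iff_eq_neg.2 h₂,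
      eq_neg_iff_add_eq_zero] at h₁
    obtain ⟨hφm, K, hK⟩ := hφ
    have hbdd : ∀ {f : ℝ → ℝ}, IntervalIntegrable f volume 0 1 →
        IntervalIntegrable (fun r ↦ f r * φ r) volume 0 1 := by
      intro f hf
      rw [intervalIntegrable_iff] at hf ⊢
      exact hf.mul_bdd hφm.aestronglyMeasurable (Eventually.of_forall hK)
    have h₄ : ∫ r in (0 : ℝ)..1, (r ^ (k + 1) * F r + ∫ s in (0 : ℝ)..r, g s) * φ r = 0 := by
      rw [← intervalIntegral.integral_add _ (hbdd hW2)] at h₁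
      · refine Eq.trans ?_ h₁
        congr! 2 with r
        ring
      · convert hbdd hF2 using 2 with r
        ring
    rw [intervalIntegral.integral_of_le zero_le_one] at h₄
    rw [← integral_indicator ht]
    refine Eq.trans ?_ h₄
    congr! 2 with r
    by_cases hr : r ∈ t <;> simp [φ, hr]
  rw [← ae_powMeasure k] at hzero
  filter_upwards [hzero, ae_mem_powMeasure k] with r hr hr01
  have hr0 : r ≠ 0 := hr01.1.ne'
  rw [← eq_neg_of_add_eq_zero_left hr]
  field_simp
  ring

theorem stmt4 (N : ℕ) (hN : 3 ≤ N) (Ψ : ℝ → ℝ) (hmeas : Measurable Ψ)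
    (C : ℝ) (hC : 0 < C) (hbd : ∀ r ∈ Set.Ioc (0:ℝ) 1, |Ψ r| * r ^ 2 ≤ C)
    (hstab : RadialStability N Ψ) :
    ∃ ω ω' : ℝ → ℝ, IsRadialSolution N Ψ ω ω' := by
  obtain ⟨k, rfl⟩ : ∃ k, N = k + 3 := ⟨N - 3, by lia⟩
  let m : ℝ → ℝ := fun r ↦ r ^ 2 * Ψ r - (k + 2)
  have hm : MemLp m ⊤ (powMeasure k) := by
    refine memLp_top_of_bound (by fun_prop) (C + (k + 2)) ?_
    filter_upwards [ae_mem_powMeasure k] with r hr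
    have h := hbd r hr
    rw [← abs_of_nonneg (sq_nonneg r), ← abs_mul, mul_comm] at h
    refine (norm_sub_le _ _).trans (add_le_add h ?_)
    rw [Real.norm_of_nonneg (by positivity)]
  obtain ⟨F, W, hF, hW, hWF, hweak⟩ := exists_weak_solution k hm (by positivity)
    fun φ hφ ↦ hstab.coercive hmeas hC hbd hφ
  obtain ⟨ω', hcont, hFω⟩ := exists_continuousOn_ae_eq_of_weak_solution hm hF hW hweak
  let ω : ℝ → ℝ := fun r ↦ 1 + ∫ s in (1 : ℝ)..r, ω' s
  have hω : ∀ᵐ r ∂powMeasure k, ω r = W r := by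
    filter_upwards [hWF, ae_mem_powMeasure k] with r hr hr01
    simp only [ω, hr]
    congr 1
    refine intervalIntegral.integral_congr_ae ?_
    rw [ae_powMeasure, ae_restrict_iff' measurableSet_Ioc] at hFω
    filter_upwards [hFω] with s hs hs'
    rw [uIoc_of_ge hr01.2] at hs'
    have hs0 : 0 < s := hr01.1.trans hs'.1
    rw [hs ⟨hs0, hs'.2⟩]
    field_simp
  refine ⟨ω, ω', fun r hr ↦ ?_, hcont.mono fun r hr ↦ hr.1, by simp [ω], ?_, ?_⟩
  · refine (HasDerivAt.const_add _ ?_).hasDerivWithinAt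
    refine intervalIntegral.integral_hasDerivAt_right ?_
      (hcont.stronglyMeasurableAtFilter isOpen_Ioi r hr.1) (hcont.continuousAt (Ioi_mem_nhds hr.1))
    refine (hcont.mono ?_).intervalIntegrable
    rw [uIcc_of_ge hr.2]
    exact fun s hs ↦ hr.1.trans_le hs.1
  · have hrW : MemLp (fun r ↦ r * W r) 2 (powMeasure k) := by
      refine hW.of_le (aestronglyMeasurable_id.mul hW.aestronglyMeasurable) ?_
      filter_upwards [ae_mem_powMeasure k] with r hr
      rw [norm_mul, Real.norm_of_nonneg hr.1.le]
      exact mul_le_of_le_one_left (norm_nonneg _) hr.2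
    have h : Integrable (fun r ↦ r ^ 2 * (ω r ^ 2 + ω' r ^ 2)) (powMeasure k) := by
      refine (hrW.integrable_sq.add hF.integrable_sq).congr ?_
      filter_upwards [hω, hFω] with r h h'
      rw [Pi.add_apply, h, h']
      ring
    rw [integrable_powMeasure_iff] at h
    convert h using 2 with r
    rw [show k + 3 - 1 = k + 2 by lia]
    ring
  · rintro v ⟨K, hv⟩ hv1
    obtain ⟨φ, hφ, hφv, hvφ⟩ := exists_isBoundedMeasurable_of_lipschitzOnWith hv hv1
    have h := hweak φ hφ
    rw [integral_powMeasure, integral_powMeasure] at h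
    rw [ae_powMeasure] at hω hFω
    simp only [intervalIntegral.integral_of_le zero_le_one] at h ⊢
    convert h using 1
    · refine integral_congr_ae ?_
      filter_upwards [hφv, hFω] with r h₁ h₂
      rw [← h₁, h₂, show k + 3 - 1 = k + 2 by lia]
      ring
    · refine integral_congr_ae ?_
      filter_upwards [hω, ae_restrict_mem measurableSet_Ioc] with r h₁ h₂
      have hr0 : r ≠ 0 := h₂.1.ne'
      rw [← hvφ r (Ioc_subset_Icc_self h₂), h₁, show k + 3 - 1 = k + 2 by lia]
      simp only [m]
      push_cast
      field_simp
      ring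
end

section
/- Let N ≥ 3 be an integer and let Ψ : (0,1] → ℝ be measurable with |Ψ(r)|·r² ≤ C for some constant C > 0 and all r ∈ (0,1], and suppose Ψ satisfies the radial stability inequality in dimension N. If ω₁ and ω₂ are both radial solutions of the linear problem (P_Ψ), then ω₁(r) = ω₂(r) for every r ∈ (0,1]. -/
open MeasureTheory Filter Set

/-- The function equal to `g δ` on `(-∞, δ]` and to `g` on `[δ, ∞)` is Lipschitz on `[0,1]`
when `g` is `C¹` on `[δ,1]`. -/
lemma exists_lipschitzOnWith_comp_max {δ : ℝ} (hδ1 : δ ≤ 1) {g g' : ℝ → ℝ}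
    (hg : ∀ r ∈ Icc δ 1, HasDerivWithinAt g (g' r) (Icc δ 1) r)
    (hg' : ContinuousOn g' (Icc δ 1)) :
    ∃ K : NNReal, LipschitzOnWith K (fun r => g (max r δ)) (Icc 0 1) := by
  obtain ⟨K, hK⟩ := isCompact_Icc.exists_bound_of_continuousOn hg'
  have hL : LipschitzOnWith K.toNNReal g (Icc δ 1) := by
    refine (convex_Icc δ 1).lipschitzOnWith_of_nnnorm_hasDerivWithin_le hg fun x hx => ?_
    rw [← NNReal.coe_le_coe, coe_nnnorm]
    exact (hK x hx).trans (Real.le_coe_toNNReal K)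
  have hm : LipschitzOnWith 1 (fun r : ℝ => max r δ) (Icc 0 1) :=
    (LipschitzWith.id.max_const δ).lipschitzOnWith
  exact ⟨_, hL.comp hm fun r hr => ⟨le_max_right _ _, max_le hr.2 hδ1⟩⟩

lemma deriv_comp_max_of_lt {δ r : ℝ} (g : ℝ → ℝ) (hr : r < δ) :
    deriv (fun r => g (max r δ)) r = 0 := by
  have h : (fun r => g (max r δ)) =ᶠ[nhds r] fun _ => g δ := by
    filter_upwards [Iio_mem_nhds hr] with x hx
    rw [max_eq_right (le_of_lt hx)]
  rw [h.deriv_eq, deriv_const]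

lemma deriv_comp_max_of_mem_Ioo {δ r : ℝ} {g g' : ℝ → ℝ}
    (hg : ∀ r ∈ Icc δ 1, HasDerivWithinAt g (g' r) (Icc δ 1) r) (hr : r ∈ Ioo δ 1) :
    deriv (fun r => g (max r δ)) r = g' r := by
  have h : (fun r => g (max r δ)) =ᶠ[nhds r] g := by
    filter_upwards [Ioi_mem_nhds hr.1] with x hx
    rw [max_eq_left (le_of_lt hx)]
  rw [h.deriv_eq]
  exact ((hg r (Ioo_subset_Icc_self hr)).hasDerivAt (Icc_mem_nhds hr.1 hr.2)).deriv

/-- An integral over `[0,1]` of a function vanishing on `(0,δ)` only sees `(δ,1)`. -/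
lemma integral_eq_of_eq_zero_of_eq {δ : ℝ} (hδ0 : 0 < δ) (hδ1 : δ < 1) {f h : ℝ → ℝ}
    (h0 : ∀ r ∈ Ioo 0 δ, f r = 0) (h1 : ∀ r ∈ Ioo δ 1, f r = h r) :
    ∫ r in (0:ℝ)..1, f r = ∫ r in δ..1, h r := by
  rw [intervalIntegral.integral_of_le zero_le_one, intervalIntegral.integral_of_le hδ1.le,
    setIntegral_eq_of_subset_of_ae_sdiff_eq_zero (s := Ioc δ 1)
      measurableSet_Ioc.nullMeasurableSet (Ioc_subset_Ioc_left hδ0.le)]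
  · rw [integral_Ioc_eq_integral_Ioo, integral_Ioc_eq_integral_Ioo]
    exact setIntegral_congr_fun measurableSet_Ioo h1
  · have hne : ∀ᵐ x : ℝ, x ≠ δ := by simp [ae_iff]
    filter_upwards [hne] with x hx hmem
    refine h0 x ⟨hmem.1.1, lt_of_le_of_ne ?_ hx⟩
    by_contra! hlt
    exact hmem.2 ⟨hlt, hmem.1.2⟩

/-- The stability inequality for test functions supported in `[δ,1]`. -/
lemma RadialStability.integral_le {N : ℕ} {Ψ : ℝ → ℝ} (h : RadialStability N Ψ)
    {δ : ℝ} (hδ0 : 0 < δ) (hδ1 : δ < 1) {g g' : ℝ → ℝ}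
    (hg : ∀ r ∈ Icc δ 1, HasDerivWithinAt g (g' r) (Icc δ 1) r)
    (hg' : ContinuousOn g' (Icc δ 1)) (hgδ : g δ = 0) (hg1 : g 1 = 0) :
    ∫ r in δ..1, r ^ (N - 1) * Ψ r * g r ^ 2 ≤ ∫ r in δ..1, r ^ (N - 1) * g' r ^ 2 := by
  have key := h _ (exists_lipschitzOnWith_comp_max hδ1.le hg hg') (by simp [hδ1.le, hg1])
  rwa [integral_eq_of_eq_zero_of_eq (h := fun r => r ^ (N - 1) * Ψ r * g r ^ 2) hδ0 hδ1
      (fun r hr => by simp [hr.2.le, hgδ]) (fun r hr => by simp [hr.1.le]),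
    integral_eq_of_eq_zero_of_eq (h := fun r => r ^ (N - 1) * g' r ^ 2) hδ0 hδ1
      (fun r hr => by simp [deriv_comp_max_of_lt g hr.2])
      (fun r hr => by rw [deriv_comp_max_of_mem_Ioo hg hr])] at key

/-- The weak formulation for test functions supported in `[δ,1]`. -/
lemma IsRadialSolution.integral_eq {N : ℕ} {Ψ ω ω' : ℝ → ℝ} (h : IsRadialSolution N Ψ ω ω')
    {δ : ℝ} (hδ0 : 0 < δ) (hδ1 : δ < 1) {g g' : ℝ → ℝ}
    (hg : ∀ r ∈ Icc δ 1, HasDerivWithinAt g (g' r) (Icc δ 1) r)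
    (hg' : ContinuousOn g' (Icc δ 1)) (hgδ : g δ = 0) (hg1 : g 1 = 0) :
    ∫ r in δ..1, r ^ (N - 1) * ω' r * g' r =
      ∫ r in δ..1, r ^ (N - 1) * (Ψ r - ((N:ℝ) - 1) / r ^ 2) * ω r * g r := by
  have key := h.2.2.2.2 _ (exists_lipschitzOnWith_comp_max hδ1.le hg hg')
    (by simp [hδ1.le, hg1])
  rwa [integral_eq_of_eq_zero_of_eq (h := fun r => r ^ (N - 1) * ω' r * g' r) hδ0 hδ1
      (fun r hr => by simp [deriv_comp_max_of_lt g hr.2])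
      (fun r hr => by rw [deriv_comp_max_of_mem_Ioo hg hr]),
    integral_eq_of_eq_zero_of_eq
      (h := fun r => r ^ (N - 1) * (Ψ r - ((N:ℝ) - 1) / r ^ 2) * ω r * g r) hδ0 hδ1
      (fun r hr => by simp [hr.2.le, hgδ]) (fun r hr => by simp [hr.1.le])] at key

lemma IsRadialSolution.continuousOn {N : ℕ} {Ψ ω ω' : ℝ → ℝ} (h : IsRadialSolution N Ψ ω ω') :
    ContinuousOn ω (Ioc 0 1) :=
  fun r hr => (h.1 r hr).continuousWithinAt

/-- A potential with inverse-square growth is integrable away from the origin. -/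
lemma intervalIntegrable_of_abs_mul_sq_le {Ψ : ℝ → ℝ} (hmeas : Measurable Ψ) {C : ℝ}
    (hbd : ∀ r ∈ Ioc (0:ℝ) 1, |Ψ r| * r ^ 2 ≤ C) {δ : ℝ} (hδ0 : 0 < δ) (hδ1 : δ ≤ 1) :
    IntervalIntegrable Ψ volume δ 1 := by
  refine IntervalIntegrable.mono_fun' (g := fun _ => C / δ ^ 2) intervalIntegrable_const
    hmeas.aestronglyMeasurable ?_
  rw [uIoc_of_le hδ1]
  filter_upwards [ae_restrict_mem measurableSet_Ioc] with r hr
  rw [Real.norm_eq_abs, le_div_iff₀ (by positivity)]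
  refine le_trans ?_ (hbd r ⟨hδ0.trans hr.1, hr.2⟩)
  gcongr
  exact hr.1.le

/-- Testing the equation for the difference `ω` of two solutions with `(r - δ)₊² ω` and the
stability inequality with `(r - δ)₊ ω`. -/
lemma integral_sub_sq_le {N : ℕ} {Ψ : ℝ → ℝ} (hmeas : Measurable Ψ) {C : ℝ}
    (hbd : ∀ r ∈ Ioc (0:ℝ) 1, |Ψ r| * r ^ 2 ≤ C) (hstab : RadialStability N Ψ)
    {ω₁ ω₁' ω₂ ω₂' : ℝ → ℝ}
    (h₁ : IsRadialSolution N Ψ ω₁ ω₁') (h₂ : IsRadialSolution N Ψ ω₂ ω₂')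
    {δ : ℝ} (hδ0 : 0 < δ) (hδ1 : δ < 1) :
    ((N:ℝ) - 1) * ∫ r in δ..1, r ^ (N - 1) * (((r - δ) / r) ^ 2 * (ω₁ r - ω₂ r) ^ 2) ≤
      ∫ r in δ..1, r ^ (N - 1) * (ω₁ r - ω₂ r) ^ 2 := by
  have hsub : Icc δ 1 ⊆ Ioc 0 1 := fun r hr => ⟨hδ0.trans_le hr.1, hr.2⟩
  have hpos : ∀ r ∈ Icc δ 1, r ≠ 0 := fun r hr => (hsub hr).1.ne'
  have c₁ := h₁.continuousOn.mono hsub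
  have c₂ := h₂.continuousOn.mono hsub
  have c₁' := h₁.2.1.mono hsub
  have c₂' := h₂.2.1.mono hsub
  have hΨ := intervalIntegrable_of_abs_mul_sq_le hmeas hbd hδ0 hδ1.le
  have hω : ∀ r ∈ Icc δ 1, HasDerivWithinAt (fun r => ω₁ r - ω₂ r) (ω₁' r - ω₂' r) (Icc δ 1) r :=
    fun r hr => ((h₁.1 r (hsub hr)).mono hsub).sub ((h₂.1 r (hsub hr)).mono hsub)
  have hlin : ∀ r, HasDerivWithinAt (fun r : ℝ => r - δ) 1 (Icc δ 1) r := fun r =>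
    (hasDerivWithinAt_id r _).sub_const δ
  have hξ : ∀ r ∈ Icc δ 1, HasDerivWithinAt (fun r => (r - δ) * (ω₁ r - ω₂ r))
      ((ω₁ r - ω₂ r) + (r - δ) * (ω₁' r - ω₂' r)) (Icc δ 1) r := fun r hr => by
    simpa using (hlin r).fun_mul (hω r hr)
  have hv : ∀ r ∈ Icc δ 1, HasDerivWithinAt (fun r => (r - δ) * ((r - δ) * (ω₁ r - ω₂ r)))
      ((r - δ) * (ω₁ r - ω₂ r) + (r - δ) * ((ω₁ r - ω₂ r) + (r - δ) * (ω₁' r - ω₂' r)))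
      (Icc δ 1) r := fun r hr => by
    simpa using (hlin r).fun_mul (hξ r hr)
  have hone : ω₁ 1 - ω₂ 1 = 0 := by rw [h₁.2.2.1, h₂.2.2.1, sub_self]
  have hS := hstab.integral_le hδ0 hδ1 hξ (by fun_prop) (by simp) (by simp [hone])
  have e₁ := h₁.integral_eq hδ0 hδ1 hv (by fun_prop) (by simp) (by simp [hone])
  have e₂ := h₂.integral_eq hδ0 hδ1 hv (by fun_prop) (by simp) (by simp [hone])
  have cI : ∀ {f : ℝ → ℝ}, ContinuousOn f (Icc δ 1) → IntervalIntegrable f volume δ 1 :=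
    fun hf => hf.intervalIntegrable_of_Icc hδ1.le
  have cdiv : ContinuousOn (fun r : ℝ => ((N:ℝ) - 1) / r ^ 2) (Icc δ 1) :=
    continuousOn_const.div (by fun_prop) fun r hr => pow_ne_zero 2 (hpos r hr)
  have cquot : ContinuousOn (fun r : ℝ => (r - δ) / r) (Icc δ 1) :=
    ContinuousOn.div (by fun_prop) (by fun_prop) hpos
  have hpot : IntervalIntegrable (fun r => Ψ r - ((N:ℝ) - 1) / r ^ 2) volume δ 1 :=
    hΨ.sub (cI cdiv)
  have hR : ∀ {ω : ℝ → ℝ}, ContinuousOn ω (Icc δ 1) → IntervalIntegrable (fun r => r ^ (N - 1) *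
      (Ψ r - ((N:ℝ) - 1) / r ^ 2) * ω r * ((r - δ) * ((r - δ) * (ω₁ r - ω₂ r)))) volume δ 1 := by
    intro ω hω
    refine ((hpot.continuousOn_mul ?_).mul_continuousOn ?_).mul_continuousOn ?_ <;>
    · rw [uIcc_of_le hδ1.le]
      fun_prop
  have hSint : IntervalIntegrable
      (fun r => r ^ (N - 1) * Ψ r * ((r - δ) * (ω₁ r - ω₂ r)) ^ 2) volume δ 1 := by
    refine (hΨ.continuousOn_mul ?_).mul_continuousOn ?_ <;>
    · rw [uIcc_of_le hδ1.le]
      fun_prop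
  have hL : ∫ r in δ..1, (r ^ (N - 1) * ((ω₁ r - ω₂ r) + (r - δ) * (ω₁' r - ω₂' r)) ^ 2 -
        r ^ (N - 1) * (ω₁ r - ω₂ r) ^ 2) =
      ∫ r in δ..1, (r ^ (N - 1) * Ψ r * ((r - δ) * (ω₁ r - ω₂ r)) ^ 2 -
        ((N:ℝ) - 1) * (r ^ (N - 1) * (((r - δ) / r) ^ 2 * (ω₁ r - ω₂ r) ^ 2))) := by
    have e := congrArg₂ (· - ·) e₁ e₂
    rw [← intervalIntegral.integral_sub (cI (by fun_prop)) (cI (by fun_prop)),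
      ← intervalIntegral.integral_sub (hR c₁) (hR c₂)] at e
    convert e using 1
    · refine intervalIntegral.integral_congr fun r _ => ?_
      ring
    · refine intervalIntegral.integral_congr fun r hr => ?_
      rw [uIcc_of_le hδ1.le] at hr
      have := hpos r hr
      field_simp
  rw [intervalIntegral.integral_sub (cI (by fun_prop)) (cI (by fun_prop)),
    intervalIntegral.integral_sub hSint (cI (by fun_prop)),
    intervalIntegral.integral_const_mul] at hL
  linarith

lemma IsRadialSolution.intervalIntegrable_sub_sq {N : ℕ} {Ψ ω₁ ω₁' ω₂ ω₂' : ℝ → ℝ}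
    (h₁ : IsRadialSolution N Ψ ω₁ ω₁') (h₂ : IsRadialSolution N Ψ ω₂ ω₂') :
    IntervalIntegrable (fun r => r ^ (N - 1) * (ω₁ r - ω₂ r) ^ 2) volume 0 1 := by
  have c₁ := h₁.continuousOn
  have c₂ := h₂.continuousOn
  refine IntervalIntegrable.mono_fun' ((h₁.2.2.2.1.add h₂.2.2.2.1).const_mul 2) ?_ ?_
  · rw [uIoc_of_le zero_le_one]
    exact ContinuousOn.aestronglyMeasurable (by fun_prop) measurableSet_Ioc
  · rw [uIoc_of_le zero_le_one]
    filter_upwards [ae_restrict_mem measurableSet_Ioc] with r hr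
    have hp : 0 ≤ r ^ (N - 1) := pow_nonneg hr.1.le _
    rw [Real.norm_of_nonneg (by positivity)]
    calc r ^ (N - 1) * (ω₁ r - ω₂ r) ^ 2
        ≤ r ^ (N - 1) * (2 * ((ω₁ r ^ 2 + ω₁' r ^ 2) + (ω₂ r ^ 2 + ω₂' r ^ 2))) := by
          gcongr
          nlinarith [sq_nonneg (ω₁ r + ω₂ r), sq_nonneg (ω₁' r), sq_nonneg (ω₂' r)]
      _ = _ := by ring

/-- The integral bound obtained from `integral_sub_sq_le` as `δ → 0`. -/
lemma mul_integral_sub_sq_le {N : ℕ} {Ψ : ℝ → ℝ} (hmeas : Measurable Ψ) {C : ℝ}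
    (hbd : ∀ r ∈ Ioc (0:ℝ) 1, |Ψ r| * r ^ 2 ≤ C) (hstab : RadialStability N Ψ)
    {ω₁ ω₁' ω₂ ω₂' : ℝ → ℝ}
    (h₁ : IsRadialSolution N Ψ ω₁ ω₁') (h₂ : IsRadialSolution N Ψ ω₂ ω₂') :
    ((N:ℝ) - 1) * ∫ r in (0:ℝ)..1, r ^ (N - 1) * (ω₁ r - ω₂ r) ^ 2 ≤
      ∫ r in (0:ℝ)..1, r ^ (N - 1) * (ω₁ r - ω₂ r) ^ 2 := by
  have c₁ := h₁.continuousOn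
  have c₂ := h₂.continuousOn
  have hint := h₁.intervalIntegrable_sub_sq h₂
  have hlim : Tendsto (fun δ : ℝ => ∫ r in (0:ℝ)..1,
      r ^ (N - 1) * ((max (r - δ) 0 / r) ^ 2 * (ω₁ r - ω₂ r) ^ 2)) (nhdsWithin 0 (Ioi 0))
      (nhds (∫ r in (0:ℝ)..1, r ^ (N - 1) * (ω₁ r - ω₂ r) ^ 2)) := by
    refine intervalIntegral.tendsto_integral_filter_of_dominated_convergence _ ?_ ?_ hint ?_
    · refine Eventually.of_forall fun δ => ?_
      rw [uIoc_of_le zero_le_one]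
      have cq : ContinuousOn (fun r : ℝ => max (r - δ) 0 / r) (Ioc 0 1) :=
        ContinuousOn.div (by fun_prop) (by fun_prop) fun r hr => hr.1.ne'
      exact ContinuousOn.aestronglyMeasurable (by fun_prop) measurableSet_Ioc
    · filter_upwards [self_mem_nhdsWithin] with δ hδ
      refine Eventually.of_forall fun r hr => ?_
      rw [uIoc_of_le zero_le_one] at hr
      have hr0 : 0 < r := hr.1
      have hδ0 : (0:ℝ) < δ := hδ
      have hle : max (r - δ) 0 / r ≤ 1 :=
        (div_le_one hr0).2 (max_le (by linarith) hr0.le)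
      have hnn : 0 ≤ max (r - δ) 0 / r := div_nonneg (le_max_right _ _) hr0.le
      rw [Real.norm_of_nonneg (by positivity)]
      gcongr
      exact mul_le_of_le_one_left (sq_nonneg _) (pow_le_one₀ hnn hle)
    · refine Eventually.of_forall fun r hr => ?_
      rw [uIoc_of_le zero_le_one] at hr
      have hc : Continuous fun δ : ℝ =>
          r ^ (N - 1) * ((max (r - δ) 0 / r) ^ 2 * (ω₁ r - ω₂ r) ^ 2) := by fun_prop
      have h0 := (hc.tendsto 0).mono_left (nhdsWithin_le_nhds (s := Ioi 0))
      simpa [hr.1.le, hr.1.ne'] using h0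
  refine le_of_tendsto (hlim.const_mul ((N:ℝ) - 1)) ?_
  filter_upwards [Ioo_mem_nhdsGT (zero_lt_one (α := ℝ))] with δ hδ
  rw [integral_eq_of_eq_zero_of_eq
    (h := fun r => r ^ (N - 1) * (((r - δ) / r) ^ 2 * (ω₁ r - ω₂ r) ^ 2)) hδ.1 hδ.2
    (fun r hr => by simp [hr.2.le]) (fun r hr => by simp [hr.1.le])]
  refine (integral_sub_sq_le hmeas hbd hstab h₁ h₂ hδ.1 hδ.2).trans ?_
  refine intervalIntegral.integral_mono_interval hδ.1.le hδ.2.le le_rfl ?_ hint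
  filter_upwards [ae_restrict_mem measurableSet_Ioc] with r hr
  exact mul_nonneg (pow_nonneg hr.1.le _) (sq_nonneg _)

theorem stmt5 (N : ℕ) (hN : 3 ≤ N) (Ψ : ℝ → ℝ) (hmeas : Measurable Ψ)
    (C : ℝ) (hC : 0 < C) (hbd : ∀ r ∈ Set.Ioc (0:ℝ) 1, |Ψ r| * r ^ 2 ≤ C)
    (hstab : RadialStability N Ψ)
    (ω₁ ω₁' ω₂ ω₂' : ℝ → ℝ)
    (h₁ : IsRadialSolution N Ψ ω₁ ω₁') (h₂ : IsRadialSolution N Ψ ω₂ ω₂') :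
    ∀ r ∈ Set.Ioc (0:ℝ) 1, ω₁ r = ω₂ r := by
  have c₁ := h₁.continuousOn
  have c₂ := h₂.continuousOn
  have hle := mul_integral_sub_sq_le hmeas hbd hstab h₁ h₂
  have hint := h₁.intervalIntegrable_sub_sq h₂
  have hN' : (3:ℝ) ≤ N := by exact_mod_cast hN
  rw [intervalIntegral.integral_of_le zero_le_one] at hle
  have hnn : 0 ≤ᵐ[volume.restrict (Ioc (0:ℝ) 1)]
      fun r => r ^ (N - 1) * (ω₁ r - ω₂ r) ^ 2 := by
    filter_upwards [ae_restrict_mem measurableSet_Ioc] with r hr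
    exact mul_nonneg (pow_nonneg hr.1.le _) (sq_nonneg _)
  have hI := integral_nonneg_of_ae hnn
  have hzero : ∫ r in Ioc (0:ℝ) 1, r ^ (N - 1) * (ω₁ r - ω₂ r) ^ 2 = 0 := by nlinarith
  have hae := (setIntegral_eq_zero_iff_of_nonneg_ae hnn hint.1).1 hzero
  intro r hr
  have := Measure.eqOn_Ioc_of_ae_eq volume hae (by fun_prop) continuousOn_const hr
  have hr0 := hr.1.ne'
  simpa [hr0, sub_eq_zero] using this
end

section
/- Let N ≥ 3 be an integer and let Ψ : (0,1] → ℝ be measurable with |Ψ(r)|·r² ≤ C for some constant C > 0 and all r ∈ (0,1], and suppose Ψ satisfies the radial stability inequality in dimension N. If ω is a radial solution of the linear problem (P_Ψ), then ω(r) > 0 for every r ∈ (0,1]. -/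
open MeasureTheory Filter Set

/-- The function equal to `p` on `[s, t]` and constant on either side. -/
def clampExtend (p : ℝ → ℝ) (s t r : ℝ) : ℝ := p (max s (min r t))

lemma clampExtend_of_mem {p : ℝ → ℝ} {s t r : ℝ} (hr : r ∈ Icc s t) :
    clampExtend p s t r = p r := by
  simp [clampExtend, hr.1, hr.2]

lemma clampExtend_of_le {p : ℝ → ℝ} {s t r : ℝ} (hr : r ≤ s) :
    clampExtend p s t r = p s := by
  simp [clampExtend, hr]

lemma clampExtend_of_ge {p : ℝ → ℝ} {s t r : ℝ} (hst : s ≤ t) (hr : t ≤ r) :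
    clampExtend p s t r = p t := by
  simp [clampExtend, hr, hst]

lemma exists_lipschitzOnWith_clampExtend {p p' : ℝ → ℝ} {s t : ℝ} (hst : s ≤ t)
    (hp : ∀ r ∈ Icc s t, HasDerivWithinAt p (p' r) (Icc s t) r)
    (hp' : ContinuousOn p' (Icc s t)) (u : Set ℝ) :
    ∃ K : NNReal, LipschitzOnWith K (clampExtend p s t) u := by
  obtain ⟨B, hB⟩ := isCompact_Icc.exists_bound_of_continuousOn hp'
  have hB0 : 0 ≤ B := (norm_nonneg _).trans (hB s (left_mem_Icc.2 hst))
  have hL : LipschitzOnWith B.toNNReal p (Icc s t) := by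
    refine (convex_Icc s t).lipschitzOnWith_of_nnnorm_hasDerivWithin_le hp fun r hr => ?_
    rw [← NNReal.coe_le_coe, Real.coe_toNNReal B hB0]
    exact hB r hr
  refine ⟨B.toNNReal * 1, ?_⟩
  have hclamp : LipschitzWith 1 (fun r : ℝ => max s (min r t)) :=
    (LipschitzWith.id.min_const t).const_max s
  exact hL.comp hclamp.lipschitzOnWith
    (fun r _ => ⟨le_max_left _ _, max_le hst (min_le_right _ _)⟩)

lemma deriv_clampExtend_of_mem {p p' : ℝ → ℝ} {s t r : ℝ}
    (hp : ∀ r ∈ Icc s t, HasDerivWithinAt p (p' r) (Icc s t) r) (hr : r ∈ Ioo s t) :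
    deriv (clampExtend p s t) r = p' r := by
  have h1 : HasDerivAt p (p' r) r :=
    (hp r (Ioo_subset_Icc_self hr)).hasDerivAt (Icc_mem_nhds hr.1 hr.2)
  refine (h1.congr_of_eventuallyEq ?_).deriv
  filter_upwards [Icc_mem_nhds hr.1 hr.2] with x hx using clampExtend_of_mem hx

lemma deriv_clampExtend_of_lt {p : ℝ → ℝ} {s t r : ℝ} (hr : r < s) :
    deriv (clampExtend p s t) r = 0 := by
  refine ((hasDerivAt_const r (p s)).congr_of_eventuallyEq ?_).deriv
  filter_upwards [Iio_mem_nhds hr] with x hx using clampExtend_of_le (le_of_lt hx)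

lemma deriv_clampExtend_of_gt {p : ℝ → ℝ} {s t r : ℝ} (hst : s ≤ t) (hr : t < r) :
    deriv (clampExtend p s t) r = 0 := by
  refine ((hasDerivAt_const r (p t)).congr_of_eventuallyEq ?_).deriv
  filter_upwards [Ioi_mem_nhds hr] with x hx using clampExtend_of_ge hst (le_of_lt hx)

/-- An integral over `[0, 1]` of a function vanishing off `[s, t]`. -/
lemma integral_eq_integral_of_eqOn_Ioo {f g : ℝ → ℝ} {s t : ℝ} (hs : 0 ≤ s) (hst : s ≤ t)
    (ht : t ≤ 1) (hleft : ∀ r ∈ Ioo 0 s, f r = 0) (hright : ∀ r ∈ Ioo t 1, f r = 0)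
    (hmid : ∀ r ∈ Ioo s t, f r = g r) :
    ∫ r in (0 : ℝ)..1, f r = ∫ r in s..t, g r := by
  rw [intervalIntegral.integral_of_le zero_le_one, intervalIntegral.integral_of_le hst]
  have hne (x : ℝ) : ∀ᵐ r : ℝ, r ≠ x := by
    simp [ae_iff, measure_singleton]
  have h1 : ∫ r in Ioc s t, f r = ∫ r in Ioc (0 : ℝ) 1, f r := by
    refine (setIntegral_eq_of_subset_of_ae_sdiff_eq_zero measurableSet_Ioc.nullMeasurableSet
      (Ioc_subset_Ioc hs ht) ?_).symm
    filter_upwards [hne s, hne 1] with r hrs hr1 hr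
    rcases le_or_gt r s with h | h
    · exact hleft r ⟨hr.1.1, lt_of_le_of_ne h hrs⟩
    · refine hright r ⟨?_, lt_of_le_of_ne hr.1.2 hr1⟩
      by_contra! hrt
      exact hr.2 ⟨h, hrt⟩
  rw [← h1]
  refine setIntegral_congr_ae measurableSet_Ioc ?_
  filter_upwards [hne t] with r hrt hr using hmid r ⟨hr.1, lt_of_le_of_ne hr.2 hrt⟩

lemma intervalIntegrable_mul_of_bounded {f Ψ : ℝ → ℝ} {s t B : ℝ} (hst : s ≤ t)
    (hΨ : Measurable Ψ) (hB : ∀ r ∈ Icc s t, |Ψ r| ≤ B) (hf : ContinuousOn f (Icc s t)) :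
    IntervalIntegrable (fun r => Ψ r * f r) volume s t := by
  rw [intervalIntegrable_iff_integrableOn_Ioc_of_le hst]
  have hfi : IntegrableOn f (Ioc s t) :=
    (hf.integrableOn_Icc).mono_set Ioc_subset_Icc_self
  refine hfi.bdd_mul (c := B) hΨ.aestronglyMeasurable ?_
  filter_upwards [ae_restrict_mem measurableSet_Ioc] with r hr
  exact hB r (Ioc_subset_Icc_self hr)

lemma abs_le_div_sq_of_le {Ψ : ℝ → ℝ} {C s r : ℝ} (hC : 0 < C)
    (hbd : ∀ r ∈ Ioc (0 : ℝ) 1, |Ψ r| * r ^ 2 ≤ C) (hs : 0 < s) (hsr : s ≤ r) (hr : r ≤ 1) :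
    |Ψ r| ≤ C / s ^ 2 := by
  have h0 : 0 < r := hs.trans_le hsr
  calc |Ψ r| ≤ C / r ^ 2 := (le_div_iff₀ (by positivity)).2 (hbd r ⟨h0, hr⟩)
    _ ≤ C / s ^ 2 := by gcongr

namespace IsRadialSolution

variable {N : ℕ} {Ψ ω ω' : ℝ → ℝ}

lemma continuousOn_s6 (hω : IsRadialSolution N Ψ ω ω') : ContinuousOn ω (Ioc 0 1) :=
  fun r hr => (hω.1 r hr).continuousWithinAt

/-- The Caccioppoli-type estimate obtained by testing stability with `(r - ε) ω` and the
equation with `(r - ε)² ω` on `[ε, a]`. -/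
lemma integral_le_integral (hω : IsRadialSolution N Ψ ω ω') (hmeas : Measurable Ψ)
    {C : ℝ} (hC : 0 < C) (hbd : ∀ r ∈ Ioc (0 : ℝ) 1, |Ψ r| * r ^ 2 ≤ C)
    (hstab : RadialStability N Ψ) {ε a : ℝ} (hε : 0 < ε) (hεa : ε ≤ a) (ha : a ≤ 1)
    (hωa : ω a = 0) :
    ∫ r in ε..a, r ^ (N - 1) * (((N : ℝ) - 1) / r ^ 2) * ((r - ε) * ω r) ^ 2 ≤
      ∫ r in ε..a, r ^ (N - 1) * ω r ^ 2 := by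
  have hsub : Icc ε a ⊆ Ioc 0 1 := fun r hr => ⟨hε.trans_le hr.1, hr.2.trans ha⟩
  have hd : ∀ r ∈ Icc ε a, HasDerivWithinAt ω (ω' r) (Icc ε a) r :=
    fun r hr => (hω.1 r (hsub hr)).mono hsub
  have hc : ContinuousOn ω (Icc ε a) := hω.continuousOn_s6.mono hsub
  have hc' : ContinuousOn ω' (Icc ε a) := hω.2.1.mono hsub
  have hp : ∀ r ∈ Icc ε a, HasDerivWithinAt (fun r => (r - ε) * ω r)
      (ω r + (r - ε) * ω' r) (Icc ε a) r := fun r hr => by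
    simpa using ((hasDerivWithinAt_id r _).sub_const ε).fun_mul (hd r hr)
  have hq : ∀ r ∈ Icc ε a, HasDerivWithinAt (fun r => (r - ε) ^ 2 * ω r)
      (2 * (r - ε) * ω r + (r - ε) ^ 2 * ω' r) (Icc ε a) r := fun r hr => by
    simpa using (((hasDerivWithinAt_id r _).sub_const ε).fun_pow 2).fun_mul (hd r hr)
  have hS := hstab _ (exists_lipschitzOnWith_clampExtend hεa hp (by fun_prop) _)
    (by simp [clampExtend_of_ge hεa ha, hωa])
  have hW := hω.2.2.2.2 _ (exists_lipschitzOnWith_clampExtend hεa hq (by fun_prop) _)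
    (by simp [clampExtend_of_ge hεa ha, hωa])
  rw [integral_eq_integral_of_eqOn_Ioo (s := ε) (t := a)
      (g := fun r => Ψ r * (r ^ (N - 1) * ((r - ε) * ω r) ^ 2)) hε.le hεa ha
      (fun r hr => by simp [clampExtend_of_le hr.2.le])
      (fun r hr => by simp [clampExtend_of_ge hεa hr.1.le, hωa])
      (fun r hr => by rw [clampExtend_of_mem (Ioo_subset_Icc_self hr)]; ring),
    integral_eq_integral_of_eqOn_Ioo (s := ε) (t := a)
      (g := fun r => r ^ (N - 1) * (ω r + (r - ε) * ω' r) ^ 2) hε.le hεa ha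
      (fun r hr => by simp [deriv_clampExtend_of_lt hr.2])
      (fun r hr => by simp [deriv_clampExtend_of_gt hεa hr.1])
      (fun r hr => by rw [deriv_clampExtend_of_mem hp hr])] at hS
  rw [integral_eq_integral_of_eqOn_Ioo (s := ε) (t := a)
      (g := fun r => r ^ (N - 1) * (ω r + (r - ε) * ω' r) ^ 2 - r ^ (N - 1) * ω r ^ 2)
      hε.le hεa ha
      (fun r hr => by simp [deriv_clampExtend_of_lt hr.2])
      (fun r hr => by simp [deriv_clampExtend_of_gt hεa hr.1])
      (fun r hr => by rw [deriv_clampExtend_of_mem hq hr]; ring),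
    integral_eq_integral_of_eqOn_Ioo (s := ε) (t := a)
      (g := fun r => Ψ r * (r ^ (N - 1) * ((r - ε) * ω r) ^ 2) -
        r ^ (N - 1) * (((N : ℝ) - 1) / r ^ 2) * ((r - ε) * ω r) ^ 2) hε.le hεa ha
      (fun r hr => by simp [clampExtend_of_le hr.2.le])
      (fun r hr => by simp [clampExtend_of_ge hεa hr.1.le, hωa])
      (fun r hr => by rw [clampExtend_of_mem (Ioo_subset_Icc_self hr)]; ring)] at hW
  have hne : ∀ r ∈ Icc ε a, r ^ 2 ≠ 0 := fun r hr => pow_ne_zero _ (hsub hr).1.ne'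
  rw [intervalIntegral.integral_sub, intervalIntegral.integral_sub] at hW
  · linarith
  · exact intervalIntegrable_mul_of_bounded hεa hmeas
      (fun r hr => abs_le_div_sq_of_le hC hbd hε hr.1 (hr.2.trans ha)) (by fun_prop)
  · refine ContinuousOn.intervalIntegrable_of_Icc hεa ?_
    exact ((continuousOn_id.pow _).mul (continuousOn_const.div (by fun_prop) hne)).mul
      (by fun_prop)
  · exact ContinuousOn.intervalIntegrable_of_Icc hεa (by fun_prop)
  · exact ContinuousOn.intervalIntegrable_of_Icc hεa (by fun_prop)

/-- A radial solution vanishing at `a` vanishes on `(0, a]`. -/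
lemma eq_zero_of_zero (hω : IsRadialSolution N Ψ ω ω') (hN : 3 ≤ N) (hmeas : Measurable Ψ)
    {C : ℝ} (hC : 0 < C) (hbd : ∀ r ∈ Ioc (0 : ℝ) 1, |Ψ r| * r ^ 2 ≤ C)
    (hstab : RadialStability N Ψ) {a : ℝ} (ha0 : 0 < a) (ha : a ≤ 1) (hωa : ω a = 0) :
    ∀ r ∈ Ioc 0 a, ω r = 0 := by
  have hN1 : (2 : ℝ) ≤ (N : ℝ) - 1 := by
    have : (3 : ℝ) ≤ N := by exact_mod_cast hN
    linarith
  have hsub : Ioc 0 a ⊆ Ioc (0 : ℝ) 1 := Ioc_subset_Ioc_right ha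
  have hcω : ContinuousOn ω (Ioc 0 a) := hω.continuousOn_s6.mono hsub
  have hcf : ContinuousOn (fun r => r ^ (N - 1) * ω r ^ 2) (Ioc 0 a) := by fun_prop
  have hint1 : IntegrableOn (fun r => r ^ (N - 1) * ω r ^ 2) (Ioc 0 a) := by
    have h := (intervalIntegrable_iff_integrableOn_Ioc_of_le zero_le_one).1 hω.2.2.2.1
    refine (h.mono_set hsub).mono' (hcf.aestronglyMeasurable measurableSet_Ioc) ?_
    filter_upwards [ae_restrict_mem measurableSet_Ioc] with r hr
    have hr0 : 0 < r := hr.1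
    rw [Real.norm_of_nonneg (by positivity)]
    gcongr
    nlinarith [sq_nonneg (ω' r)]
  have hint : IntervalIntegrable (fun r => r ^ (N - 1) * ω r ^ 2) volume 0 a :=
    (intervalIntegrable_iff_integrableOn_Ioc_of_le ha0.le).2 hint1
  have hnn : ∀ r ∈ Ioc 0 a, 0 ≤ r ^ (N - 1) * ω r ^ 2 := fun r hr => by
    have hr0 : 0 < r := hr.1
    positivity
  have hIoc : uIoc 0 a = Ioc 0 a := uIoc_of_le ha0.le
  set F : ℝ → ℝ → ℝ := fun ε r =>
    r ^ (N - 1) * (((N : ℝ) - 1) / r ^ 2) * (max (r - ε) 0 * ω r) ^ 2 with hF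
  have hmono : ∀ c ∈ Ioc 0 a, ∫ r in c..a, r ^ (N - 1) * ω r ^ 2 ≤
      ∫ r in (0 : ℝ)..a, r ^ (N - 1) * ω r ^ 2 := fun c hc => by
    refine intervalIntegral.integral_mono_interval hc.1.le hc.2 le_rfl ?_ hint
    filter_upwards [ae_restrict_mem measurableSet_Ioc] with r hr using hnn r hr
  have hlim : Tendsto (fun ε => ∫ r in (0 : ℝ)..a, F ε r) (nhdsWithin 0 (Ioi 0))
      (nhds (∫ r in (0 : ℝ)..a, ((N : ℝ) - 1) * (r ^ (N - 1) * ω r ^ 2))) := by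
    refine intervalIntegral.tendsto_integral_filter_of_dominated_convergence
      (fun r => ((N : ℝ) - 1) * (r ^ (N - 1) * ω r ^ 2)) ?_ ?_ (hint.const_mul _) ?_
    · refine Eventually.of_forall fun ε => ?_
      rw [hIoc]
      refine ContinuousOn.aestronglyMeasurable ?_ measurableSet_Ioc
      exact ((continuousOn_id.pow _).mul (continuousOn_const.div (by fun_prop)
        fun r hr => pow_ne_zero _ hr.1.ne')).mul (by fun_prop)
    · filter_upwards [self_mem_nhdsWithin] with ε hε
      refine Eventually.of_forall fun r hr => ?_
      rw [hIoc] at hr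
      have hr0 : 0 < r := hr.1
      have hε0 : 0 < ε := hε
      have hm : max (r - ε) 0 ≤ r := max_le (by linarith) hr0.le
      have hm0 : 0 ≤ max (r - ε) 0 := le_max_right _ _
      have h0 : (0 : ℝ) ≤ (N : ℝ) - 1 := by linarith
      rw [Real.norm_of_nonneg (by positivity)]
      calc F ε r = r ^ (N - 1) * (((N : ℝ) - 1) / r ^ 2) * (max (r - ε) 0 ^ 2 * ω r ^ 2) := by
            rw [hF]; ring
        _ ≤ r ^ (N - 1) * (((N : ℝ) - 1) / r ^ 2) * (r ^ 2 * ω r ^ 2) := by gcongr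
        _ = ((N : ℝ) - 1) * (r ^ (N - 1) * ω r ^ 2) := by field_simp
    · refine Eventually.of_forall fun r hr => ?_
      rw [hIoc] at hr
      have hr0 : 0 < r := hr.1
      have hcont : Continuous fun ε => F ε r := by
        simp only [hF]
        fun_prop
      have h := (hcont.tendsto 0).mono_left (nhdsWithin_le_nhds (s := Ioi 0))
      have hv : F 0 r = ((N : ℝ) - 1) * (r ^ (N - 1) * ω r ^ 2) := by
        simp only [hF, sub_zero, max_eq_left hr0.le]
        field_simp
      rwa [hv] at h
  have hle : ∫ r in (0 : ℝ)..a, ((N : ℝ) - 1) * (r ^ (N - 1) * ω r ^ 2) ≤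
      ∫ r in (0 : ℝ)..a, r ^ (N - 1) * ω r ^ 2 := by
    refine le_of_tendsto hlim ?_
    filter_upwards [Ioc_mem_nhdsGT ha0] with ε hε
    have hsplit : ∫ r in (0 : ℝ)..a, F ε r =
        ∫ r in ε..a, r ^ (N - 1) * (((N : ℝ) - 1) / r ^ 2) * ((r - ε) * ω r) ^ 2 := by
      rw [intervalIntegral.integral_of_le ha0.le, intervalIntegral.integral_of_le hε.2,
        setIntegral_eq_of_subset_of_forall_sdiff_eq_zero (s := Ioc ε a) measurableSet_Ioc
          (Ioc_subset_Ioc_left hε.1.le)]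
      · refine setIntegral_congr_fun measurableSet_Ioc fun r hr => ?_
        simp only [hF, max_eq_left (sub_nonneg.2 hr.1.le)]
      · intro r hr
        have : r ≤ ε := by
          by_contra! h
          exact hr.2 ⟨h, hr.1.2⟩
        simp [hF, max_eq_right (sub_nonpos.2 this)]
    rw [hsplit]
    exact (hω.integral_le_integral hmeas hC hbd hstab hε.1 hε.2 ha hωa).trans (hmono ε hε)
  rw [intervalIntegral.integral_const_mul] at hle
  intro r hr
  by_contra hne
  have hra : r < a := lt_of_le_of_ne hr.2 fun h => hne (h ▸ hωa)
  have hr0 : 0 < r := hr.1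
  have hpos : 0 < ∫ x in r..a, x ^ (N - 1) * ω x ^ 2 :=
    intervalIntegral.integral_pos hra
      (hcf.mono fun x hx => ⟨hr.1.trans_le hx.1, hx.2⟩)
      (fun x hx => hnn x ⟨hr.1.trans hx.1, hx.2⟩) ⟨r, left_mem_Icc.2 hra.le, by positivity⟩
  nlinarith [hmono r hr]

/-- Unique continuation: a radial solution vanishing on `(0, a]` cannot be positive on `(a, 1]`. -/
lemma false_of_zero_of_pos (hω : IsRadialSolution N Ψ ω ω') (hN : 1 ≤ N)
    {C : ℝ} (hC : 0 < C) (hbd : ∀ r ∈ Ioc (0 : ℝ) 1, |Ψ r| * r ^ 2 ≤ C)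
    {a : ℝ} (ha0 : 0 < a) (ha : a < 1) (hzero : ∀ r ∈ Ioc 0 a, ω r = 0)
    (hpos : ∀ r ∈ Ioc a 1, 0 < ω r) : False := by
  have hN1 : (0 : ℝ) ≤ (N : ℝ) - 1 := by
    have : (1 : ℝ) ≤ N := by exact_mod_cast hN
    linarith
  set M : ℝ := C / a ^ 2 + ((N : ℝ) - 1) / a ^ 2 with hM
  have hM0 : 0 < M := by positivity
  obtain ⟨c, hca, hc1, hcM⟩ : ∃ c, a < c ∧ c ≤ 1 ∧ M * (c - a) ^ 2 < a ^ (N - 1) := by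
    have hcont : Continuous fun c => M * (c - a) ^ 2 := by fun_prop
    have h : ∀ᶠ c in nhdsWithin a (Ioi a), M * (c - a) ^ 2 < a ^ (N - 1) :=
      ((hcont.tendsto a).mono_left nhdsWithin_le_nhds).eventually_lt_const
        (by simpa using pow_pos ha0 _)
    obtain ⟨c, hc, hc'⟩ := (h.and (Ioc_mem_nhdsGT ha)).exists
    exact ⟨c, hc'.1, hc'.2, hc⟩
  have hωa : ω a = 0 := hzero a ⟨ha0, le_rfl⟩
  have hsubc : Icc a c ⊆ Ioc 0 1 := fun r hr => ⟨ha0.trans_le hr.1, hr.2.trans hc1⟩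
  obtain ⟨b, hb, hbmax⟩ := isCompact_Icc.exists_isMaxOn (nonempty_Icc.2 hca.le)
    (hω.continuousOn_s6.mono hsubc)
  have hm : 0 < ω b := (hpos c ⟨hca, hc1⟩).trans_le (hbmax (right_mem_Icc.2 hca.le))
  have hab : a < b := lt_of_le_of_ne hb.1 fun h => by rw [← h, hωa] at hm; exact hm.false
  have hb1 : b ≤ 1 := hb.2.trans hc1
  have hsub : Icc a b ⊆ Ioc 0 1 := (Icc_subset_Icc_right hb.2).trans hsubc
  have hd : ∀ r ∈ Icc a b, HasDerivWithinAt (fun r => ω r - ω b) (ω' r) (Icc a b) r :=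
    fun r hr => ((hω.1 r (hsub hr)).mono hsub).sub_const _
  have hcont : ContinuousOn ω (Icc a b) := hω.continuousOn_s6.mono hsub
  have hcont' : ContinuousOn ω' (Icc a b) := hω.2.1.mono hsub
  have hW := hω.2.2.2.2 _ (exists_lipschitzOnWith_clampExtend hab.le hd hcont' _)
    (by simp [clampExtend_of_ge hab.le hb1])
  rw [integral_eq_integral_of_eqOn_Ioo (s := a) (t := b)
      (g := fun r => r ^ (N - 1) * ω' r ^ 2) ha0.le hab.le hb1
      (fun r hr => by simp [deriv_clampExtend_of_lt hr.2])
      (fun r hr => by simp [deriv_clampExtend_of_gt hab.le hr.1])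
      (fun r hr => by rw [deriv_clampExtend_of_mem hd hr]; ring),
    integral_eq_integral_of_eqOn_Ioo (s := a) (t := b)
      (g := fun r => r ^ (N - 1) * (Ψ r - ((N : ℝ) - 1) / r ^ 2) * ω r * (ω r - ω b))
      ha0.le hab.le hb1
      (fun r hr => by simp [hzero r ⟨hr.1, hr.2.le⟩])
      (fun r hr => by simp [clampExtend_of_ge hab.le hr.1.le])
      (fun r hr => by rw [clampExtend_of_mem (Ioo_subset_Icc_self hr)])] at hW
  have hupper : ∫ r in a..b, r ^ (N - 1) * (Ψ r - ((N : ℝ) - 1) / r ^ 2) * ω r * (ω r - ω b) ≤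
      M * ω b ^ 2 * (b - a) := by
    have h := intervalIntegral.norm_integral_le_of_norm_le_const (a := a) (b := b)
      (C := M * ω b ^ 2)
      (f := fun r => r ^ (N - 1) * (Ψ r - ((N : ℝ) - 1) / r ^ 2) * ω r * (ω r - ω b)) ?_
    · rw [abs_of_pos (sub_pos.2 hab)] at h
      exact (le_abs_self _).trans h
    intro r hr
    rw [uIoc_of_le hab.le] at hr
    have hr0 : 0 < r := ha0.trans hr.1
    have hr1 : r ≤ 1 := hr.2.trans hb1
    have hωr : 0 < ω r := hpos r ⟨hr.1, hr1⟩
    have hωrb : ω r ≤ ω b := hbmax ⟨hr.1.le, hr.2.trans hb.2⟩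
    have hV : |Ψ r - ((N : ℝ) - 1) / r ^ 2| ≤ M := by
      refine (abs_sub _ _).trans ?_
      rw [abs_of_nonneg (by positivity : 0 ≤ ((N : ℝ) - 1) / r ^ 2)]
      have := abs_le_div_sq_of_le hC hbd ha0 hr.1.le hr1
      have h2 : ((N : ℝ) - 1) / r ^ 2 ≤ ((N : ℝ) - 1) / a ^ 2 := by
        gcongr
        exact hr.1.le
      linarith
    rw [norm_mul, norm_mul, norm_mul, Real.norm_eq_abs, Real.norm_eq_abs, Real.norm_eq_abs,
      Real.norm_eq_abs, abs_of_pos (pow_pos hr0 _), abs_of_pos hωr]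
    have h1 : |ω r - ω b| ≤ ω b := abs_le.2 ⟨by linarith, by linarith⟩
    calc r ^ (N - 1) * |Ψ r - ((N : ℝ) - 1) / r ^ 2| * ω r * |ω r - ω b|
        ≤ 1 * M * ω b * ω b := by
          gcongr
          exact pow_le_one₀ hr0.le hr1
      _ = M * ω b ^ 2 := by ring
  set k : ℝ := ω b / (b - a) with hk
  have hba : 0 < b - a := sub_pos.2 hab
  have hFTC : ∫ r in a..b, ω' r = ω b := by
    rw [intervalIntegral.integral_eq_sub_of_hasDerivAt_of_le hab.le hcont
      (fun r hr => (hω.1 r (hsub (Ioo_subset_Icc_self hr))).hasDerivAt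
        (mem_of_superset (Icc_mem_nhds hr.1 hr.2) hsub))
      (hcont'.intervalIntegrable_of_Icc hab.le), hωa, sub_zero]
  have hlower : a ^ (N - 1) * (2 * k * ω b - k ^ 2 * (b - a)) ≤
      ∫ r in a..b, r ^ (N - 1) * ω' r ^ 2 := by
    have hcalc : ∫ r in a..b, a ^ (N - 1) * (2 * k * ω' r - k ^ 2) =
        a ^ (N - 1) * (2 * k * ω b - k ^ 2 * (b - a)) := by
      rw [intervalIntegral.integral_const_mul, intervalIntegral.integral_sub,
        intervalIntegral.integral_const_mul, hFTC, intervalIntegral.integral_const, smul_eq_mul]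
      · ring
      · exact ContinuousOn.intervalIntegrable_of_Icc hab.le (by fun_prop)
      · exact intervalIntegrable_const
    rw [← hcalc]
    refine intervalIntegral.integral_mono_on hab.le
      (ContinuousOn.intervalIntegrable_of_Icc hab.le (by fun_prop))
      (ContinuousOn.intervalIntegrable_of_Icc hab.le (by fun_prop)) fun r hr => ?_
    calc a ^ (N - 1) * (2 * k * ω' r - k ^ 2) ≤ a ^ (N - 1) * ω' r ^ 2 := by
          gcongr
          nlinarith [sq_nonneg (ω' r - k)]
      _ ≤ r ^ (N - 1) * ω' r ^ 2 := by
          gcongr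
          exact hr.1
  have hkval : 2 * k * ω b - k ^ 2 * (b - a) = ω b ^ 2 / (b - a) := by
    rw [hk]
    field_simp
    ring
  rw [hkval] at hlower
  have hfin : a ^ (N - 1) * (ω b ^ 2 / (b - a)) ≤ M * ω b ^ 2 * (b - a) := by linarith
  rw [mul_div_assoc', div_le_iff₀ hba] at hfin
  have hbc : M * (b - a) ^ 2 ≤ M * (c - a) ^ 2 := by
    gcongr
    exact hb.2
  have := mul_lt_mul_of_pos_right (hbc.trans_lt hcM) (pow_pos hm 2)
  nlinarith

end IsRadialSolution

theorem stmt6 (N : ℕ) (hN : 3 ≤ N) (Ψ : ℝ → ℝ) (hmeas : Measurable Ψ)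
    (C : ℝ) (hC : 0 < C) (hbd : ∀ r ∈ Set.Ioc (0:ℝ) 1, |Ψ r| * r ^ 2 ≤ C)
    (hstab : RadialStability N Ψ)
    (ω ω' : ℝ → ℝ) (hω : IsRadialSolution N Ψ ω ω') :
    ∀ r ∈ Set.Ioc (0:ℝ) 1, 0 < ω r := by
  intro r₀ hr₀
  by_contra! hneg
  have hsub : Icc r₀ 1 ⊆ Ioc 0 1 := fun r hr => ⟨hr₀.1.trans_le hr.1, hr.2⟩
  have hcont : ContinuousOn ω (Icc r₀ 1) := hω.continuousOn_s6.mono hsub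
  have hcompact : IsCompact (Icc r₀ 1 ∩ ω ⁻¹' Iic 0) :=
    isCompact_Icc.of_isClosed_subset (hcont.preimage_isClosed_of_isClosed isClosed_Icc isClosed_Iic)
      inter_subset_left
  obtain ⟨a, ⟨haI, haneg⟩, hamax⟩ := hcompact.exists_isGreatest
    ⟨r₀, left_mem_Icc.2 hr₀.2, hneg⟩
  have haneg : ω a ≤ 0 := haneg
  have hω1 : ω 1 = 1 := hω.2.2.1
  have hωa : ω a = 0 := by
    obtain ⟨z, hz, hz0⟩ := intermediate_value_Icc haI.2
      (hcont.mono (Icc_subset_Icc_left haI.1)) (⟨haneg, by simp [hω1]⟩ : (0 : ℝ) ∈ Icc (ω a) (ω 1))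
    have hza : z ≤ a := hamax ⟨⟨haI.1.trans hz.1, hz.2⟩, hz0.le⟩
    rwa [le_antisymm hza hz.1] at hz0
  have ha1 : a < 1 := lt_of_le_of_ne haI.2 fun h => by
    rw [h, hω1] at hωa
    exact one_ne_zero hωa
  have ha0 : 0 < a := (hsub haI).1
  refine hω.false_of_zero_of_pos (by omega) hC hbd ha0 ha1
    (hω.eq_zero_of_zero hN hmeas hC hbd hstab ha0 ha1.le hωa) fun r hr => ?_
  by_contra! h
  exact absurd (hamax ⟨⟨haI.1.trans hr.1.le, hr.2⟩, h⟩) (not_le.2 hr.1)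
end

section
/- Let N ≥ 3 be an integer and let Ψ₁, Ψ₂ : (0,1] → ℝ be measurable functions with Ψ₁(r) ≤ Ψ₂(r) for all r ∈ (0,1], such that for i = 1, 2 one has |Ψᵢ(r)|·r² ≤ C for some constant C > 0 and all r ∈ (0,1], and Ψᵢ satisfies the radial stability inequality in dimension N. If ωᵢ is a radial solution of the linear problem (P_{Ψᵢ}) for i = 1, 2, then ω₁(r) ≤ ω₂(r) for every r ∈ (0,1]. -/
open MeasureTheory Filter Set

/-- Products of real Lipschitz functions on the unit interval are Lipschitz. -/
lemma exists_lipschitzOnWith_mul {f g : ℝ → ℝ}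
    (hf : ∃ K : NNReal, LipschitzOnWith K f (Icc 0 1))
    (hg : ∃ K : NNReal, LipschitzOnWith K g (Icc 0 1)) :
    ∃ K : NNReal, LipschitzOnWith K (fun x => f x * g x) (Icc 0 1) := by
  obtain ⟨K, hf⟩ := hf
  obtain ⟨L, hg⟩ := hg
  obtain ⟨A, hA⟩ := isCompact_Icc.exists_bound_of_continuousOn hf.continuousOn
  obtain ⟨B, hB⟩ := isCompact_Icc.exists_bound_of_continuousOn hg.continuousOn
  have hA0 : 0 ≤ A := (norm_nonneg _).trans (hA 0 (by simp))
  have hB0 : 0 ≤ B := (norm_nonneg _).trans (hB 0 (by simp))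
  refine ⟨⟨A * L + B * K, by positivity⟩, LipschitzOnWith.of_dist_le_mul fun x hx y hy => ?_⟩
  have h1 := hf.dist_le_mul x hx y hy
  have h2 := hg.dist_le_mul x hx y hy
  have h3 := hA x hx
  have h4 := hB y hy
  simp only [Real.dist_eq, Real.norm_eq_abs] at *
  have e : f x * g x - f y * g y = f x * (g x - g y) + (f x - f y) * g y := by ring
  calc |f x * g x - f y * g y| ≤ |f x| * |g x - g y| + |f x - f y| * |g y| := by
        rw [e, ← abs_mul, ← abs_mul]; exact abs_add_le _ _
    _ ≤ A * (L * |x - y|) + (K * |x - y|) * B := by gcongr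
    _ = (A * L + B * K) * |x - y| := by ring

/-- A function on `(0,1]` with continuous derivative is Lipschitz on `[ε,1]`. -/
lemma exists_lipschitzOnWith_of_hasDerivWithinAt_Ioc {w w' : ℝ → ℝ} {ε : ℝ} (hε : 0 < ε)
    (hd : ∀ r ∈ Ioc (0:ℝ) 1, HasDerivWithinAt w (w' r) (Ioc 0 1) r)
    (hc : ContinuousOn w' (Ioc 0 1)) :
    ∃ K : NNReal, LipschitzOnWith K w (Icc ε 1) := by
  have hs : Icc ε 1 ⊆ Ioc (0:ℝ) 1 := fun x hx => ⟨hε.trans_le hx.1, hx.2⟩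
  obtain ⟨A, hA⟩ := isCompact_Icc.exists_bound_of_continuousOn (hc.mono hs)
  refine ⟨A.toNNReal, (convex_Icc ε 1).lipschitzOnWith_of_nnnorm_hasDerivWithin_le
    (f' := w') (fun x hx => (hd x (hs hx)).mono hs) fun x hx => ?_⟩
  rw [← NNReal.coe_le_coe, coe_nnnorm]
  exact (hA x hx).trans (Real.le_coe_toNNReal A)

lemma intervalIntegrable_mul_of_vanishing {f g : ℝ → ℝ} {ε M : ℝ} (hε : 0 < ε)
    (hf : ContinuousOn f (Ioc 0 1))
    (hg : AEStronglyMeasurable g (volume.restrict (Ioo 0 1)))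
    (hg0 : ∀ r ∈ Ioo (0:ℝ) 1, r < ε → g r = 0)
    (hgM : ∀ r ∈ Ioo (0:ℝ) 1, ε ≤ r → |g r| ≤ M) :
    IntervalIntegrable (fun r => f r * g r) volume 0 1 := by
  rw [intervalIntegrable_iff_integrableOn_Ioo_of_le zero_le_one]
  have hs : Icc ε 1 ⊆ Ioc (0:ℝ) 1 := fun x hx => ⟨hε.trans_le hx.1, hx.2⟩
  obtain ⟨A, hA⟩ := isCompact_Icc.exists_bound_of_continuousOn (hf.mono hs)
  refine IntegrableOn.of_bound (by simp)
    (((hf.mono Ioo_subset_Ioc_self).aestronglyMeasurable measurableSet_Ioo).mul hg)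
    (|A| * |M|) ((ae_restrict_mem measurableSet_Ioo).mono fun r hr => ?_)
  rcases lt_or_ge r ε with h | h
  · simp only [hg0 r hr h, mul_zero, norm_zero]
    positivity
  · rw [norm_mul]
    exact mul_le_mul ((hA r ⟨h, hr.2.le⟩).trans (le_abs_self A))
      ((hgM r hr h).trans (le_abs_self M)) (norm_nonneg _) (abs_nonneg _)

lemma intervalIntegrable_weight_mul_deriv {N : ℕ} {f v : ℝ → ℝ} {ε : ℝ} (hε : 0 < ε)
    (hf : ContinuousOn f (Ioc 0 1))
    (hv : ∃ K : NNReal, LipschitzOnWith K v (Icc 0 1)) (hv0 : ∀ r ≤ ε, v r = 0) :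
    IntervalIntegrable (fun r => r ^ (N - 1) * f r * deriv v r) volume 0 1 := by
  obtain ⟨K, hv⟩ := hv
  refine intervalIntegrable_mul_of_vanishing (M := K) hε
    ((continuousOn_id.pow _).mul hf) (measurable_deriv v).aestronglyMeasurable ?_ ?_
  · intro r _ hrε
    have : v =ᶠ[nhds r] fun _ => 0 := by
      filter_upwards [Iio_mem_nhds hrε] with s hs using hv0 s (le_of_lt hs)
    simpa using this.deriv_eq
  · intro r hr _
    exact norm_deriv_le_of_lipschitzOn (Icc_mem_nhds hr.1 hr.2) hv

lemma intervalIntegrable_weight_mul_potential {N : ℕ} {q f v : ℝ → ℝ} {ε M : ℝ} (hε : 0 < ε)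
    (hq : Measurable q) (hqM : ∀ r ∈ Ioc (0:ℝ) 1, |q r| * r ^ 2 ≤ M)
    (hf : ContinuousOn f (Ioc 0 1))
    (hv : ContinuousOn v (Icc 0 1)) (hv0 : ∀ r ≤ ε, v r = 0) :
    IntervalIntegrable (fun r => r ^ (N - 1) * q r * f r * v r) volume 0 1 := by
  have hs : Ioc (0:ℝ) 1 ⊆ Icc 0 1 := Ioc_subset_Icc_self
  have key : IntervalIntegrable (fun r => r ^ (N - 1) * f r * v r *
      (if r < ε then 0 else q r)) volume 0 1 := by
    refine intervalIntegrable_mul_of_vanishing (M := M / ε ^ 2) hε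
      (((continuousOn_id.pow _).mul hf).mul (hv.mono hs)) ?_ ?_ ?_
    · exact (Measurable.ite measurableSet_Iio measurable_const hq).aestronglyMeasurable
    · intro r _ h
      simp [h]
    · intro r hr h
      rw [if_neg h.not_gt, le_div_iff₀ (by positivity)]
      refine le_trans ?_ (hqM r ⟨hr.1, hr.2.le⟩)
      gcongr
  refine key.congr fun r _ => ?_
  by_cases h : r < ε
  · simp [h, hv0 r h.le]
  · simp only [h, if_false]
    ring

/-- The positive part of `w`, cut off linearly to vanish on `(-∞, ε]`. -/
noncomputable def cutPos (w : ℝ → ℝ) (ε s : ℝ) : ℝ := max (w (max s ε)) 0 * max (s - ε) 0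

lemma cutPos_nonneg (w : ℝ → ℝ) (ε s : ℝ) : 0 ≤ cutPos w ε s := by
  unfold cutPos; positivity

lemma cutPos_of_le (w : ℝ → ℝ) {ε s : ℝ} (h : s ≤ ε) : cutPos w ε s = 0 := by
  simp [cutPos, h]

lemma cutPos_of_ge (w : ℝ → ℝ) {ε s : ℝ} (h : ε ≤ s) :
    cutPos w ε s = max (w s) 0 * (s - ε) := by
  simp [cutPos, h]

lemma exists_lipschitzOnWith_max_sub (ε : ℝ) :
    ∃ K : NNReal, LipschitzOnWith K (fun s : ℝ => max (s - ε) 0) (Icc 0 1) :=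
  ⟨1, ((LipschitzWith.of_dist_le_mul fun x y => by
    simp [Real.dist_eq]).max_const 0).lipschitzOnWith⟩

lemma exists_lipschitzOnWith_cutPos {w w' : ℝ → ℝ} {ε : ℝ} (hε : 0 < ε) (hε1 : ε ≤ 1)
    (hd : ∀ r ∈ Ioc (0:ℝ) 1, HasDerivWithinAt w (w' r) (Ioc 0 1) r)
    (hc : ContinuousOn w' (Ioc 0 1)) :
    ∃ K : NNReal, LipschitzOnWith K (cutPos w ε) (Icc 0 1) := by
  obtain ⟨K, hK⟩ := exists_lipschitzOnWith_of_hasDerivWithinAt_Ioc hε hd hc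
  refine exists_lipschitzOnWith_mul ⟨1 * (K * 1), ?_⟩ (exists_lipschitzOnWith_max_sub ε)
  have h1 : LipschitzOnWith (K * 1) (w ∘ fun s => max s ε) (Icc 0 1) :=
    hK.comp (LipschitzWith.id.max_const ε).lipschitzOnWith
      fun s hs => ⟨le_max_right _ _, max_le hs.2 hε1⟩
  exact (LipschitzWith.id.max_const 0).comp_lipschitzOnWith h1

/-- Pointwise energy identity for the cut-off positive part. -/
lemma deriv_cutPos_sq_le {w w' : ℝ → ℝ} {ε : ℝ}
    (hd : ∀ r ∈ Ioc (0:ℝ) 1, HasDerivWithinAt w (w' r) (Ioc 0 1) r)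
    {r : ℝ} (hr : r ∈ Ioo (0:ℝ) 1) :
    deriv (cutPos w ε) r ^ 2 ≤
      w' r * deriv (fun s => cutPos w ε s * max (s - ε) 0) r + max (w r) 0 ^ 2 := by
  by_cases hpos : ε < r ∧ 0 < w r
  · obtain ⟨hεr, hw⟩ := hpos
    have hwd : HasDerivAt w (w' r) r :=
      (hd r ⟨hr.1, hr.2.le⟩).hasDerivAt (Ioc_mem_nhds hr.1 hr.2)
    have hl : HasDerivAt (fun s : ℝ => s - ε) 1 r := (hasDerivAt_id r).sub_const ε
    have hev : ∀ᶠ s in nhds r, ε < s ∧ 0 < w s :=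
      (eventually_gt_nhds hεr).and (hwd.continuousAt.eventually_mem (Ioi_mem_nhds hw))
    have e1 : cutPos w ε =ᶠ[nhds r] fun s => w s * (s - ε) := by
      filter_upwards [hev] with s hs
      rw [cutPos_of_ge w hs.1.le, max_eq_left hs.2.le]
    have e2 : (fun s => cutPos w ε s * max (s - ε) 0) =ᶠ[nhds r]
        fun s => w s * (s - ε) * (s - ε) := by
      filter_upwards [hev, e1] with s hs h
      rw [h, max_eq_left (sub_nonneg.2 hs.1.le)]
    rw [e1.deriv_eq, e2.deriv_eq, (hwd.fun_mul hl).deriv,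
      ((hwd.fun_mul hl).fun_mul hl).deriv, max_eq_left hw.le]
    exact le_of_eq (by ring)
  · have h0 : cutPos w ε r = 0 := by
      rcases le_or_gt r ε with h | h
      · exact cutPos_of_le w h
      · have : w r ≤ 0 := not_lt.1 fun h' => hpos ⟨h, h'⟩
        simp [cutPos_of_ge w h.le, this]
    have d1 : deriv (cutPos w ε) r = 0 := IsLocalMin.deriv_eq_zero
      (Eventually.of_forall fun s => h0 ▸ cutPos_nonneg w ε s)
    have d2 : deriv (fun s => cutPos w ε s * max (s - ε) 0) r = 0 := by
      refine IsLocalMin.deriv_eq_zero (Eventually.of_forall fun s => ?_)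
      simp only [h0, zero_mul]
      exact mul_nonneg (cutPos_nonneg w ε s) (le_max_right _ _)
    rw [d1, d2]
    simp only [ne_eq, OfNat.ofNat_ne_zero, not_false_eq_true, zero_pow, mul_zero, zero_add]
    positivity

lemma intervalIntegrable_weight_mul_posPart_sq {N : ℕ} {w : ℝ → ℝ}
    (hw : ContinuousOn w (Ioc 0 1))
    (hint : IntervalIntegrable (fun r => r ^ (N - 1) * w r ^ 2) volume 0 1) :
    IntervalIntegrable (fun r => r ^ (N - 1) * max (w r) 0 ^ 2) volume 0 1 := by
  have hcont : ContinuousOn (fun r => r ^ (N - 1) * max (w r) 0 ^ 2) (Ioc 0 1) :=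
    (continuousOn_id.pow _).mul ((hw.sup continuousOn_const).pow 2)
  refine hint.mono_fun ?_ ?_
  · rw [uIoc_of_le zero_le_one]
    exact hcont.aestronglyMeasurable measurableSet_Ioc
  · refine Eventually.of_forall fun r => ?_
    simp only [norm_mul, norm_pow, Real.norm_eq_abs]
    gcongr |r| ^ (N - 1) * ?_ ^ 2
    exact abs_max_le_max_abs_abs.trans (by simp)

/-- Caccioppoli-type estimate: testing a subsolution with its cut-off positive part. -/
lemma integral_cutPos_sq_le {N : ℕ} {Ψ w w' : ℝ → ℝ} {C ε : ℝ} (hε : 0 < ε) (hε1 : ε ≤ 1)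
    (hmeas : Measurable Ψ) (hbd : ∀ r ∈ Ioc (0:ℝ) 1, |Ψ r| * r ^ 2 ≤ C)
    (hstab : RadialStability N Ψ)
    (hd : ∀ r ∈ Ioc (0:ℝ) 1, HasDerivWithinAt w (w' r) (Ioc 0 1) r)
    (hc : ContinuousOn w' (Ioc 0 1)) (hw1 : w 1 ≤ 0)
    (hint : IntervalIntegrable (fun r => r ^ (N - 1) * w r ^ 2) volume 0 1)
    (hsub : ∀ v : ℝ → ℝ, (∃ K : NNReal, LipschitzOnWith K v (Icc 0 1)) → v 1 = 0 →
      (∀ r, 0 ≤ v r) → (∃ ε > 0, ∀ r ≤ ε, v r = 0) →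
      (∫ r in (0:ℝ)..1, r ^ (N - 1) * w' r * deriv v r) ≤
        ∫ r in (0:ℝ)..1, r ^ (N - 1) * (Ψ r - ((N:ℝ) - 1) / r ^ 2) * w r * v r) :
    (∫ r in (0:ℝ)..1, r ^ (N - 1) * (((N:ℝ) - 1) / r ^ 2) * cutPos w ε r ^ 2) ≤
      ∫ r in (0:ℝ)..1, r ^ (N - 1) * max (w r) 0 ^ 2 := by
  have hw : ContinuousOn w (Ioc 0 1) := fun r hr => (hd r hr).continuousWithinAt
  have hξ := exists_lipschitzOnWith_cutPos hε hε1 hd hc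
  have hv := exists_lipschitzOnWith_mul hξ (exists_lipschitzOnWith_max_sub ε)
  have hξ1 : cutPos w ε 1 = 0 := by simp [cutPos, hε1, hw1]
  have hξc : ContinuousOn (cutPos w ε) (Icc 0 1) := hξ.choose_spec.continuousOn
  have hv0 : ∀ r ≤ ε, cutPos w ε r * max (r - ε) 0 = 0 := fun r hr => by
    rw [cutPos_of_le w hr, zero_mul]
  have hstab' := hstab _ hξ hξ1
  have hsub' := hsub _ hv (by simp [hξ1])
    (fun r => mul_nonneg (cutPos_nonneg w ε r) (le_max_right _ _)) ⟨ε, hε, hv0⟩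
  have hiu := intervalIntegrable_weight_mul_posPart_sq hw hint
  have hidv := intervalIntegrable_weight_mul_deriv (N := N) hε hc hv hv0
  have hidξ : IntervalIntegrable (fun r => r ^ (N - 1) * deriv (cutPos w ε) r ^ 2)
      volume 0 1 := by
    obtain ⟨K, hK⟩ := hξ
    have hb : ∀ r ∈ Ioo (0:ℝ) 1, |deriv (cutPos w ε) r| ≤ K := fun r hr =>
      norm_deriv_le_of_lipschitzOn (Icc_mem_nhds hr.1 hr.2) hK
    refine intervalIntegrable_mul_of_vanishing (M := K ^ 2) hε (continuousOn_id.pow _)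
      ((measurable_deriv _).pow_const 2).aestronglyMeasurable ?_ ?_
    · intro r hr hrε
      have : deriv (cutPos w ε) r = 0 := IsLocalMin.deriv_eq_zero
        (Eventually.of_forall fun s => (cutPos_of_le w hrε.le).symm ▸ cutPos_nonneg w ε s)
      simp [this]
    · intro r hr _
      rw [abs_pow]
      gcongr
      exact hb r hr
  have hmono : (∫ r in (0:ℝ)..1, r ^ (N - 1) * deriv (cutPos w ε) r ^ 2) ≤
      (∫ r in (0:ℝ)..1, r ^ (N - 1) * w' r *
        deriv (fun s => cutPos w ε s * max (s - ε) 0) r) +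
      ∫ r in (0:ℝ)..1, r ^ (N - 1) * max (w r) 0 ^ 2 := by
    rw [← intervalIntegral.integral_add hidv hiu]
    refine intervalIntegral.integral_mono_on_of_le_Ioo zero_le_one hidξ (hidv.add hiu)
      fun r hr => ?_
    have := mul_le_mul_of_nonneg_left (deriv_cutPos_sq_le (ε := ε) hd hr)
      (pow_nonneg hr.1.le (N - 1))
    linarith
  have hiΨ := intervalIntegrable_weight_mul_potential (N := N) hε hmeas hbd
    (hξc.mono Ioc_subset_Icc_self) hξc (fun r hr => cutPos_of_le w hr)
  have hiN := intervalIntegrable_weight_mul_potential (N := N) (M := |(N:ℝ) - 1|)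
    (q := fun r => ((N:ℝ) - 1) / r ^ 2) hε (by fun_prop)
    (fun r hr => by
      have := hr.1
      rw [abs_div, abs_of_pos (by positivity : 0 < r ^ 2), div_mul_cancel₀ _ (by positivity)])
    (hξc.mono Ioc_subset_Icc_self) hξc (fun r hr => cutPos_of_le w hr)
  have hsplit : (∫ r in (0:ℝ)..1, r ^ (N - 1) * (Ψ r - ((N:ℝ) - 1) / r ^ 2) * w r *
        (cutPos w ε r * max (r - ε) 0)) =
      (∫ r in (0:ℝ)..1, r ^ (N - 1) * Ψ r * cutPos w ε r ^ 2) -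
      ∫ r in (0:ℝ)..1, r ^ (N - 1) * (((N:ℝ) - 1) / r ^ 2) * cutPos w ε r ^ 2 := by
    simp only [pow_two (cutPos w ε _), ← mul_assoc]
    simp only [mul_assoc (_ * _ : ℝ) (cutPos w ε _) (max _ _)]
    rw [← intervalIntegral.integral_sub hiΨ hiN]
    refine intervalIntegral.integral_congr fun r _ => ?_
    have : w r * (cutPos w ε r * max (r - ε) 0) = cutPos w ε r * cutPos w ε r := by
      rcases le_or_gt r ε with h | h
      · simp [cutPos_of_le w h]
      · rw [cutPos_of_ge w h.le, max_eq_left (sub_nonneg.2 h.le)]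
        rcases le_total (w r) 0 with h' | h'
        · simp [h']
        · rw [max_eq_left h']; ring
    simp only [mul_assoc _ (w r), mul_assoc _ (cutPos w ε r), this]
    ring
  linarith

/-- Maximum principle for subsolutions of the linear problem. -/
lemma subsolution_nonpos {N : ℕ} (hN : 3 ≤ N) {Ψ w w' : ℝ → ℝ} {C : ℝ}
    (hmeas : Measurable Ψ) (hbd : ∀ r ∈ Ioc (0:ℝ) 1, |Ψ r| * r ^ 2 ≤ C)
    (hstab : RadialStability N Ψ)
    (hd : ∀ r ∈ Ioc (0:ℝ) 1, HasDerivWithinAt w (w' r) (Ioc 0 1) r)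
    (hc : ContinuousOn w' (Ioc 0 1)) (hw1 : w 1 ≤ 0)
    (hint : IntervalIntegrable (fun r => r ^ (N - 1) * w r ^ 2) volume 0 1)
    (hsub : ∀ v : ℝ → ℝ, (∃ K : NNReal, LipschitzOnWith K v (Icc 0 1)) → v 1 = 0 →
      (∀ r, 0 ≤ v r) → (∃ ε > 0, ∀ r ≤ ε, v r = 0) →
      (∫ r in (0:ℝ)..1, r ^ (N - 1) * w' r * deriv v r) ≤
        ∫ r in (0:ℝ)..1, r ^ (N - 1) * (Ψ r - ((N:ℝ) - 1) / r ^ 2) * w r * v r) :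
    ∀ r ∈ Ioc (0:ℝ) 1, w r ≤ 0 := by
  have hw : ContinuousOn w (Ioc 0 1) := fun r hr => (hd r hr).continuousWithinAt
  have hN' : (3:ℝ) ≤ N := by exact_mod_cast hN
  have hiu := intervalIntegrable_weight_mul_posPart_sq hw hint
  set u : ℝ → ℝ := fun r => r ^ (N - 1) * max (w r) 0 ^ 2 with hu
  have hu0 : ∀ r ∈ Ioc (0:ℝ) 1, 0 ≤ u r := fun r hr =>
    mul_nonneg (pow_nonneg hr.1.le _) (sq_nonneg _)
  have huc : ContinuousOn u (Ioc 0 1) :=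
    (continuousOn_id.pow _).mul ((hw.sup continuousOn_const).pow 2)
  have hlim : Tendsto (fun n : ℕ => ∫ r in (0:ℝ)..1, r ^ (N - 1) * (((N:ℝ) - 1) / r ^ 2) *
      cutPos w (1 / ((n:ℝ) + 1)) r ^ 2) atTop (nhds (∫ r in (0:ℝ)..1, ((N:ℝ) - 1) * u r)) := by
    have hεpos : ∀ n : ℕ, 0 < 1 / ((n:ℝ) + 1) := fun n => by positivity
    have hform : ∀ r ∈ Ioc (0:ℝ) 1, ∀ ε > 0, r ^ (N - 1) * (((N:ℝ) - 1) / r ^ 2) *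
        cutPos w ε r ^ 2 = ((N:ℝ) - 1) * u r * (max (r - ε) 0 / r) ^ 2 := by
      intro r hr ε hε
      have hr0 := hr.1.ne'
      rcases le_or_gt r ε with h | h
      · simp [cutPos_of_le w h, h]
      · rw [cutPos_of_ge w h.le, max_eq_left (sub_nonneg.2 h.le)]
        simp only [hu]
        field_simp
    refine intervalIntegral.tendsto_integral_filter_of_dominated_convergence
      (fun r => ((N:ℝ) - 1) * u r) ?_ ?_ (hiu.const_mul _) ?_
    · refine Eventually.of_forall fun n => ?_
      rw [uIoc_of_le zero_le_one]
      have : ContinuousOn (fun r => ((N:ℝ) - 1) * u r *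
          (max (r - 1 / ((n:ℝ) + 1)) 0 / r) ^ 2) (Ioc 0 1) := by
        refine (continuousOn_const.mul huc).mul (ContinuousOn.pow (ContinuousOn.div ?_
          continuousOn_id fun r hr => hr.1.ne') 2)
        fun_prop
      exact (this.congr fun r hr => hform r hr _ (hεpos n)).aestronglyMeasurable
        measurableSet_Ioc
    · refine Eventually.of_forall fun n => Eventually.of_forall fun r hr => ?_
      rw [uIoc_of_le zero_le_one] at hr
      rw [hform r hr _ (hεpos n)]
      have hA : 0 ≤ ((N:ℝ) - 1) * u r := mul_nonneg (by linarith) (hu0 r hr)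
      rw [Real.norm_of_nonneg (mul_nonneg hA (sq_nonneg _))]
      refine mul_le_of_le_one_right hA (pow_le_one₀ (div_nonneg (le_max_right _ _) hr.1.le) ?_)
      rw [div_le_one hr.1]
      exact max_le (by linarith [hεpos n]) hr.1.le
    · refine Eventually.of_forall fun r hr => ?_
      rw [uIoc_of_le zero_le_one] at hr
      have h1 : Tendsto (fun n : ℕ => ((N:ℝ) - 1) * u r *
          (max (r - 1 / ((n:ℝ) + 1)) 0 / r) ^ 2) atTop
          (nhds (((N:ℝ) - 1) * u r * (max (r - 0) 0 / r) ^ 2)) :=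
        ((((tendsto_const_nhds.sub tendsto_one_div_add_atTop_nhds_zero_nat).max
          tendsto_const_nhds).div_const r).pow 2).const_mul _
      have h2 : max (r - 0) 0 / r = 1 := by
        rw [sub_zero, max_eq_left hr.1.le, div_self hr.1.ne']
      rw [h2, one_pow, mul_one] at h1
      exact h1.congr fun n => (hform r hr _ (hεpos n)).symm
  have hle : (∫ r in (0:ℝ)..1, ((N:ℝ) - 1) * u r) ≤ ∫ r in (0:ℝ)..1, u r :=
    le_of_tendsto hlim (Eventually.of_forall fun n =>
      integral_cutPos_sq_le (by positivity) (by
        rw [div_le_one (by positivity)]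
        linarith [(Nat.cast_nonneg n : (0:ℝ) ≤ n)]) hmeas hbd hstab hd hc hw1 hint hsub)
  rw [intervalIntegral.integral_const_mul] at hle
  have hae : 0 ≤ᵐ[volume.restrict (Ioc 0 1)] u :=
    (ae_restrict_mem measurableSet_Ioc).mono hu0
  have hnn : 0 ≤ ∫ r in (0:ℝ)..1, u r :=
    intervalIntegral.integral_nonneg_of_ae_restrict zero_le_one (by
      rwa [← restrict_Ioc_eq_restrict_Icc])
  have hzero : ∫ r in (0:ℝ)..1, u r = 0 := by nlinarith
  have hz := Measure.eqOn_Ioc_of_ae_eq volume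
    ((intervalIntegral.integral_eq_zero_iff_of_le_of_nonneg_ae zero_le_one hae hiu).1 hzero)
    huc continuousOn_const
  intro r hr
  have h := hz hr
  simp only [hu, Pi.zero_apply, mul_eq_zero] at h
  rcases h with h | h
  · exact absurd h (pow_ne_zero _ hr.1.ne')
  · exact (le_max_left _ _).trans (pow_eq_zero_iff two_ne_zero |>.1 h).le

lemma IsRadialSolution.intervalIntegrable_weight_mul_sq {N : ℕ} {Ψ ω ω' : ℝ → ℝ}
    (h : IsRadialSolution N Ψ ω ω') :
    IntervalIntegrable (fun r => r ^ (N - 1) * ω r ^ 2) volume 0 1 := by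
  refine h.2.2.2.1.mono_fun ?_ (Eventually.of_forall fun r => ?_)
  · rw [uIoc_of_le zero_le_one]
    exact ((continuousOn_id.pow _).mul (h.continuousOn.pow 2)).aestronglyMeasurable
      measurableSet_Ioc
  · simp only [norm_mul]
    gcongr ‖r ^ (N - 1)‖ * ?_
    rw [Real.norm_of_nonneg (by positivity), Real.norm_of_nonneg (by positivity)]
    exact le_add_of_nonneg_right (sq_nonneg _)

lemma IsRadialSolution.nonneg {N : ℕ} (hN : 3 ≤ N) {Ψ ω ω' : ℝ → ℝ} {C : ℝ}
    (hmeas : Measurable Ψ) (hbd : ∀ r ∈ Ioc (0:ℝ) 1, |Ψ r| * r ^ 2 ≤ C)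
    (hstab : RadialStability N Ψ) (h : IsRadialSolution N Ψ ω ω') :
    ∀ r ∈ Ioc (0:ℝ) 1, 0 ≤ ω r := by
  have hneg := subsolution_nonpos hN hmeas hbd hstab (w := fun r => -ω r)
    (w' := fun r => -ω' r) (fun r hr => (h.1 r hr).neg) h.2.1.neg (by simp [h.2.2.1])
    (by simpa using h.intervalIntegrable_weight_mul_sq) (fun v hv hv1 _ _ => by
      simpa using (h.2.2.2.2 v hv hv1).ge)
  exact fun r hr => neg_nonpos.1 (hneg r hr)

lemma abs_sub_hardy_mul_sq_le {N : ℕ} {Ψ : ℝ → ℝ} {C : ℝ}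
    (hbd : ∀ r ∈ Ioc (0:ℝ) 1, |Ψ r| * r ^ 2 ≤ C) :
    ∀ r ∈ Ioc (0:ℝ) 1, |Ψ r - ((N:ℝ) - 1) / r ^ 2| * r ^ 2 ≤ C + |(N:ℝ) - 1| := by
  intro r hr
  have h0 : 0 < r ^ 2 := pow_pos hr.1 2
  calc |Ψ r - ((N:ℝ) - 1) / r ^ 2| * r ^ 2
      ≤ (|Ψ r| + |((N:ℝ) - 1) / r ^ 2|) * r ^ 2 := by gcongr; exact abs_sub _ _
    _ = |Ψ r| * r ^ 2 + |(N:ℝ) - 1| := by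
        rw [abs_div, abs_of_pos h0, add_mul, div_mul_cancel₀ _ h0.ne']
    _ ≤ C + |(N:ℝ) - 1| := by gcongr; exact hbd r hr

theorem stmt7 (N : ℕ) (hN : 3 ≤ N) (Ψ₁ Ψ₂ : ℝ → ℝ)
    (hmeas₁ : Measurable Ψ₁) (hmeas₂ : Measurable Ψ₂)
    (hle : ∀ r ∈ Set.Ioc (0:ℝ) 1, Ψ₁ r ≤ Ψ₂ r)
    (C : ℝ) (hC : 0 < C)
    (hbd₁ : ∀ r ∈ Set.Ioc (0:ℝ) 1, |Ψ₁ r| * r ^ 2 ≤ C)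
    (hbd₂ : ∀ r ∈ Set.Ioc (0:ℝ) 1, |Ψ₂ r| * r ^ 2 ≤ C)
    (hstab₁ : RadialStability N Ψ₁) (hstab₂ : RadialStability N Ψ₂)
    (ω₁ ω₁' ω₂ ω₂' : ℝ → ℝ)
    (h₁ : IsRadialSolution N Ψ₁ ω₁ ω₁') (h₂ : IsRadialSolution N Ψ₂ ω₂ ω₂') :
    ∀ r ∈ Set.Ioc (0:ℝ) 1, ω₁ r ≤ ω₂ r := by
  have hnonneg := h₁.nonneg hN hmeas₁ hbd₁ hstab₁
  have hint : IntervalIntegrable (fun r => r ^ (N - 1) * (ω₁ r - ω₂ r) ^ 2) volume 0 1 := by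
    refine ((h₁.intervalIntegrable_weight_mul_sq.add
      h₂.intervalIntegrable_weight_mul_sq).const_mul 2).mono_fun ?_
      ((ae_restrict_mem measurableSet_uIoc).mono fun r hr => ?_)
    · rw [uIoc_of_le zero_le_one]
      exact ((continuousOn_id.pow _).mul
        ((h₁.continuousOn.sub h₂.continuousOn).pow 2)).aestronglyMeasurable measurableSet_Ioc
    · rw [uIoc_of_le zero_le_one] at hr
      have hp : 0 ≤ r ^ (N - 1) := pow_nonneg hr.1.le _
      beta_reduce
      rw [Real.norm_of_nonneg (by positivity), Real.norm_of_nonneg (by positivity)]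
      nlinarith [mul_nonneg hp (sq_nonneg (ω₁ r + ω₂ r))]
  have hdiff := subsolution_nonpos hN hmeas₂ hbd₂ hstab₂ (w := fun r => ω₁ r - ω₂ r)
    (w' := fun r => ω₁' r - ω₂' r) (fun r hr => (h₁.1 r hr).sub (h₂.1 r hr))
    (h₁.2.1.sub h₂.2.1) (by simp [h₁.2.2.1, h₂.2.2.1]) hint ?_
  · exact fun r hr => sub_nonpos.1 (hdiff r hr)
  rintro v hv hv1 hv0 ⟨ε, hε, hvε⟩
  have hvc : ContinuousOn v (Set.Icc 0 1) := hv.choose_spec.continuousOn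
  have hd₁ := intervalIntegrable_weight_mul_deriv (N := N) hε h₁.2.1 hv hvε
  have hd₂ := intervalIntegrable_weight_mul_deriv (N := N) hε h₂.2.1 hv hvε
  have hp₁ := intervalIntegrable_weight_mul_potential (N := N) hε
    (hmeas₁.sub (by fun_prop : Measurable fun r : ℝ => ((N:ℝ) - 1) / r ^ 2))
    (abs_sub_hardy_mul_sq_le hbd₁) h₁.continuousOn hvc hvε
  have hp₂ := intervalIntegrable_weight_mul_potential (N := N) hε
    (hmeas₂.sub (by fun_prop : Measurable fun r : ℝ => ((N:ℝ) - 1) / r ^ 2))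
    (abs_sub_hardy_mul_sq_le hbd₂) h₂.continuousOn hvc hvε
  have hp := intervalIntegrable_weight_mul_potential (N := N) hε
    (hmeas₂.sub (by fun_prop : Measurable fun r : ℝ => ((N:ℝ) - 1) / r ^ 2))
    (abs_sub_hardy_mul_sq_le hbd₂) (h₁.continuousOn.sub h₂.continuousOn) hvc hvε
  simp only [Pi.sub_apply] at hp₁ hp₂ hp
  simp only [mul_sub (_ ^ (N - 1)) (ω₁' _) (ω₂' _), sub_mul (_ * ω₁' _)]
  rw [intervalIntegral.integral_sub hd₁ hd₂, h₁.2.2.2.2 v hv hv1, h₂.2.2.2.2 v hv hv1,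
    ← intervalIntegral.integral_sub hp₁ hp₂]
  refine intervalIntegral.integral_mono_on_of_le_Ioo zero_le_one (hp₁.sub hp₂) hp
    fun r hr => ?_
  have hr' : r ∈ Set.Ioc (0:ℝ) 1 := ⟨hr.1, hr.2.le⟩
  have hkey : 0 ≤ r ^ (N - 1) * (Ψ₂ r - Ψ₁ r) * ω₁ r * v r :=
    mul_nonneg (mul_nonneg (mul_nonneg (pow_nonneg hr.1.le _) (sub_nonneg.2 (hle r hr')))
      (hnonneg r hr')) (hv0 r)
  linear_combination hkey
end
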